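/- At least one of the four 2-adic numbers ζ₂(7,1/4), ζ₂(9,1/4), ζ₂(11,1/4), ζ₂(13,1/4) is irrational, i.e. does not lie in the image of ℚ in ℚ₂. (Since ζ₂(j) = (1/2)·ζ₂(j,1/4) for odd j ≥ 3, this is equivalent to the statement that at least one of the Kubota–Leopoldt 2-adic zeta values ζ₂(7), ζ₂(9), ζ₂(11), ζ₂(13) is irrational.) -/

import Mathlib

open Filter Finset

/-- `zeta2Quarter j z` says that `z` is the 2-adic Hurwitz zeta value `ζ₂(j, 1/4)`,
i.e. `(j-1) * 4^(j-1) * z` is the 2-adic limit of the Volkenborn sums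
`2^{-M} ∑_{k=0}^{2^M-1} (k+1/4)^{1-j}`. -/
def zeta2Quarter (j : ℕ) (z : ℚ_[2]) : Prop :=
  Filter.Tendsto
    (fun M : ℕ => (2 ^ M : ℚ_[2])⁻¹ *
      ∑ k ∈ Finset.range (2 ^ M), ((((k : ℚ) + 1/4) ^ ((1 : ℤ) - (j : ℤ)) : ℚ) : ℚ_[2]))
    Filter.atTop (nhds (((j : ℚ_[2]) - 1) * 4 ^ (j - 1) * z))

section
/-- Strictly differentiable functions on `ℤ` with a second order remainder. -/
def VC (A : Type*) [CommRing A] : Subring (ℤ → A) where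
  carrier := {f | ∃ g : ℤ → A, (∀ x d : ℤ, ∃ e : A, f (x + d) = f x + d * g x + d ^ 2 * e) ∧
    (∀ x d : ℤ, ∃ e : A, g (x + d) = g x + d * e)}
  mul_mem' := by
    rintro f f' ⟨g, h1, h2⟩ ⟨g', h1', h2'⟩
    refine ⟨fun x => f x * g' x + g x * f' x, ?_, ?_⟩
    · intro x d
      obtain ⟨e, he⟩ := h1 x d
      obtain ⟨e', he'⟩ := h1' x d
      refine ⟨f x * e' + f' x * e + (g x + d * e) * (g' x + d * e'), ?_⟩
      simp only [Pi.mul_apply, he, he']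
      ring
    · intro x d
      obtain ⟨e, he⟩ := h1 x d
      obtain ⟨e', he'⟩ := h1' x d
      obtain ⟨k, hk⟩ := h2 x d
      obtain ⟨k', hk'⟩ := h2' x d
      refine ⟨f x * k' + (g x + d * e) * (g' x + d * k') + (g x) * (g' x + d * e') +
        k * (f' x + d * g' x + d ^ 2 * e'), ?_⟩
      simp only [he, he', hk, hk']
      ring
  one_mem' := ⟨0, fun x d => ⟨0, by simp⟩, fun x d => ⟨0, by simp⟩⟩
  add_mem' := by
    rintro f f' ⟨g, h1, h2⟩ ⟨g', h1', h2'⟩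
    refine ⟨g + g', ?_, ?_⟩
    · intro x d
      obtain ⟨e, he⟩ := h1 x d
      obtain ⟨e', he'⟩ := h1' x d
      exact ⟨e + e', by simp only [Pi.add_apply, he, he']; ring⟩
    · intro x d
      obtain ⟨e, he⟩ := h2 x d
      obtain ⟨e', he'⟩ := h2' x d
      exact ⟨e + e', by simp only [Pi.add_apply, he, he']; ring⟩
  zero_mem' := ⟨0, fun x d => ⟨0, by simp⟩, fun x d => ⟨0, by simp⟩⟩
  neg_mem' := by
    rintro f ⟨g, h1, h2⟩
    refine ⟨-g, ?_, ?_⟩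
    · intro x d
      obtain ⟨e, he⟩ := h1 x d
      exact ⟨-e, by simp only [Pi.neg_apply, he]; ring⟩
    · intro x d
      obtain ⟨e, he⟩ := h2 x d
      exact ⟨-e, by simp only [Pi.neg_apply, he]; ring⟩

theorem VC_def {A : Type*} [CommRing A] {f : ℤ → A} : f ∈ VC A ↔
    ∃ g : ℤ → A, (∀ x d : ℤ, ∃ e : A, f (x + d) = f x + d * g x + d ^ 2 * e) ∧
    (∀ x d : ℤ, ∃ e : A, g (x + d) = g x + d * e) := Iff.rfl

theorem VC_const {A : Type*} [CommRing A] (a : A) : (fun _ => a) ∈ VC A :=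
  ⟨0, fun x d => ⟨0, by simp⟩, fun x d => ⟨0, by simp⟩⟩

theorem VC_lin {A : Type*} [CommRing A] (a b : A) : (fun x : ℤ => a + b * (x : A)) ∈ VC A :=
  ⟨fun _ => b, fun x d => ⟨0, by push_cast; ring⟩, fun x d => ⟨0, by simp⟩⟩

theorem VC_inv {A : Type*} [CommRing A] {f h : ℤ → A} (hf : f ∈ VC A) (hh : ∀ x, f x * h x = 1) :
    h ∈ VC A := by
  obtain ⟨g, h1, h2⟩ := hf
  have key : ∀ x d : ℤ, ∃ e, h (x + d) = h x + d * e := by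
    intro x d
    obtain ⟨e, he⟩ := h1 x d
    refine ⟨-(h (x + d) * h x * (g x + d * e)), ?_⟩
    have a1 := hh x
    have a2 := hh (x + d)
    rw [he] at a2
    linear_combination (-h (x+d)) * a1 + (h x) * a2
  refine ⟨fun x => -(h x ^ 2 * g x), ?_, ?_⟩
  · intro x d
    obtain ⟨e, he⟩ := h1 x d
    obtain ⟨e1, he1⟩ := key x d
    have a1 := hh x
    have a2 := hh (x + d)
    rw [he] at a2
    have a3 : h (x + d) = h x - d * (h (x + d) * h x * (g x + d * e)) := by
      linear_combination (-h (x+d)) * a1 + (h x) * a2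
    refine ⟨-(h x ^ 2 * e + e1 * h x * (g x + d * e)), ?_⟩
    rw [a3, he1]
    ring
  · intro x d
    obtain ⟨e, he⟩ := h2 x d
    obtain ⟨e1, he1⟩ := key x d
    refine ⟨-((2 * h x * e1 + d * e1 ^ 2) * (g x + d * e) + h x ^ 2 * e), ?_⟩
    simp only [he, he1]
    ring

theorem VC_map {A B : Type*} [CommRing A] [CommRing B] (φ : A →+ B) {f : ℤ → A}
    (hf : f ∈ VC A) : (fun x => φ (f x)) ∈ VC B := by
  obtain ⟨g, h1, h2⟩ := hf
  have hz : ∀ (d : ℤ) (a : A), φ (d * a) = d * φ a := by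
    intro d a
    rw [← zsmul_eq_mul, map_zsmul, zsmul_eq_mul]
  refine ⟨fun x => φ (g x), ?_, ?_⟩
  · intro x d
    obtain ⟨e, he⟩ := h1 x d
    refine ⟨φ e, ?_⟩
    have := hz (d ^ 2) e
    push_cast at this
    show φ (f (x + d)) = _
    rw [he, map_add, map_add, hz, this]
  · intro x d
    obtain ⟨e, he⟩ := h2 x d
    exact ⟨φ e, by show φ (g (x + d)) = _; rw [he, map_add, hz]⟩

theorem sum_range_two_pow_succ {A : Type*} [AddCommMonoid A] (f : ℤ → A) (M : ℕ) :
    ∑ k ∈ range (2 ^ (M + 1)), f k = ∑ k ∈ range (2 ^ M), (f k + f (k + (2 ^ M : ℕ))) := by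
  rw [pow_succ, mul_two, Finset.sum_range_add, ← Finset.sum_add_distrib]
  refine Finset.sum_congr rfl fun k _ => ?_
  push_cast
  rw [add_comm (k : ℤ)]

theorem lip_sum {A : Type*} [CommRing A] {g : ℤ → A}
    (h : ∀ x d : ℤ, ∃ e : A, g (x + d) = g x + d * e) (M : ℕ) :
    ∃ e, 2 * ∑ k ∈ range (2 ^ M), g k = 2 ^ M * e := by
  induction M with
  | zero => exact ⟨2 * g 0, by simp⟩
  | succ M ih =>
    obtain ⟨e, he⟩ := ih
    choose E hE using fun k : ℕ => h k (2 ^ M : ℕ)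
    refine ⟨e + ∑ k ∈ range (2 ^ M), E k, ?_⟩
    rw [sum_range_two_pow_succ]
    simp only [hE]
    have : ∑ k ∈ range (2 ^ M), (g k + (g k + ((2 ^ M : ℕ) : ℤ) * E k)) =
      2 * ∑ k ∈ range (2 ^ M), g k + 2 ^ M * ∑ k ∈ range (2 ^ M), E k := by
      rw [Finset.sum_add_distrib, Finset.sum_add_distrib, Finset.mul_sum _ _ ((2 : A) ^ M)]
      push_cast
      ring
    rw [this, mul_add, he]
    ring

theorem VC_sum {A : Type*} [CommRing A] {f : ℤ → A} (hf : f ∈ VC A) (M : ℕ) :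
    ∃ e, 2 * ∑ k ∈ range (2 ^ (M + 1)), f k = 4 * ∑ k ∈ range (2 ^ M), f k + 4 ^ M * e := by
  obtain ⟨g, h1, h2⟩ := hf
  obtain ⟨e, he⟩ := lip_sum h2 M
  choose E hE using fun k : ℕ => h1 k (2 ^ M : ℕ)
  refine ⟨e + 2 * ∑ k ∈ range (2 ^ M), E k, ?_⟩
  rw [sum_range_two_pow_succ]
  simp only [hE]
  have : ∑ k ∈ range (2 ^ M), (f k + (f k + ((2 ^ M : ℕ) : ℤ) * g k + ((2 ^ M : ℕ) : ℤ) ^ 2 * E k)) =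
      2 * ∑ k ∈ range (2 ^ M), f k + 2 ^ M * ∑ k ∈ range (2 ^ M), g k +
       4 ^ M * ∑ k ∈ range (2 ^ M), E k := by
    rw [Finset.sum_add_distrib, Finset.sum_add_distrib, Finset.sum_add_distrib,
      Finset.mul_sum _ _ ((2 : A) ^ M), Finset.mul_sum _ _ ((4 : A) ^ M)]
    have h4 : (4 : A) ^ M = ((2 : A) ^ M) ^ 2 := by
      rw [← pow_mul, mul_comm, pow_mul]; norm_num
    push_cast
    rw [h4]
    ring
  rw [this]
  have h4 : (4 : A) ^ M = 2 ^ M * 2 ^ M := by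
    rw [← mul_pow]; norm_num
  rw [h4]
  linear_combination (2 : A) ^ M * he
end

section
/-- `F` has Volkenborn integral `I`. -/
def Vol (F : ℤ → ℚ_[2]) (I : ℚ_[2]) : Prop :=
  Tendsto (fun M : ℕ => (2 ^ M : ℚ_[2])⁻¹ * ∑ k ∈ range (2 ^ M), F k) atTop (nhds I)

theorem Vol.unique {F : ℤ → ℚ_[2]} {I J : ℚ_[2]} (h : Vol F I) (h' : Vol F J) : I = J :=
  tendsto_nhds_unique h h'

theorem Vol.add {F G : ℤ → ℚ_[2]} {I J : ℚ_[2]} (h : Vol F I) (h' : Vol G J) :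
    Vol (fun x => F x + G x) (I + J) := by
  refine (Tendsto.add h h').congr fun M => ?_
  rw [Finset.sum_add_distrib, mul_add]

theorem Vol.const_mul {F : ℤ → ℚ_[2]} {I : ℚ_[2]} (c : ℚ_[2]) (h : Vol F I) :
    Vol (fun x => c * F x) (c * I) := by
  refine (Tendsto.const_mul c h).congr fun M => ?_
  rw [← Finset.mul_sum]; ring

theorem Vol.zero : Vol (fun _ => 0) 0 := by
  simp [Vol]

theorem Vol.sum {ι : Type*} (s : Finset ι) {F : ι → ℤ → ℚ_[2]} {I : ι → ℚ_[2]}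
    (h : ∀ i ∈ s, Vol (F i) (I i)) : Vol (fun x => ∑ i ∈ s, F i x) (∑ i ∈ s, I i) := by
  classical
  induction s using Finset.induction_on with
  | empty => simpa using Vol.zero
  | insert i s hi ih =>
    simp only [Finset.sum_insert hi]
    exact (h i (by simp)).add (ih fun j hj => h j (by simp [hj]))

theorem two_pow_tendsto : Tendsto (fun M : ℕ => (2 : ℚ_[2]) ^ M) atTop (nhds 0) := by
  apply tendsto_pow_atTop_nhds_zero_of_norm_lt_one
  have : ‖(2 : ℚ_[2])‖ = 2⁻¹ := by simpa using Padic.norm_p (p := 2)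
  rw [this]; norm_num

theorem norm_two_q : ‖(2 : ℚ_[2])‖ = 2⁻¹ := by simpa using Padic.norm_p (p := 2)

theorem norm_two_pow_q (M : ℕ) : ‖(2 : ℚ_[2]) ^ M‖ = (2⁻¹ : ℝ) ^ M := by
  rw [norm_pow, norm_two_q]

theorem coe_sum2 {ι : Type*} (s : Finset ι) (f : ι → ℤ_[2]) :
    ((∑ i ∈ s, f i : ℤ_[2]) : ℚ_[2]) = ∑ i ∈ s, (f i : ℚ_[2]) :=
  map_sum (PadicInt.Coe.ringHom (p := 2)) f s

theorem coe_two2 : ((2 : ℤ_[2]) : ℚ_[2]) = 2 := map_ofNat (PadicInt.Coe.ringHom (p := 2)) 2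

theorem coe_four2 : ((4 : ℤ_[2]) : ℚ_[2]) = 4 := map_ofNat (PadicInt.Coe.ringHom (p := 2)) 4

/-- Existence and estimates for the Volkenborn integral of VC functions. -/
theorem VC_vol {f : ℤ → ℤ_[2]} (hf : f ∈ VC ℤ_[2]) :
    ∃ I : ℚ_[2], Vol (fun x => (f x : ℚ_[2])) I ∧
      ∀ M : ℕ, ‖I - (2 ^ M : ℚ_[2])⁻¹ * ∑ k ∈ range (2 ^ M), (f k : ℚ_[2])‖ ≤ 4 * (2⁻¹ : ℝ) ^ M := by
  set b : ℕ → ℚ_[2] := fun M => (2 ^ M : ℚ_[2])⁻¹ * ∑ k ∈ range (2 ^ M), (f k : ℚ_[2]) with hb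
  have step : ∀ M, ‖b (M + 1) - b M‖ ≤ 4 * (2⁻¹ : ℝ) ^ M := by
    intro M
    obtain ⟨e, he⟩ := VC_sum hf M
    have he' : (2 : ℚ_[2]) * ∑ k ∈ range (2 ^ (M + 1)), (f k : ℚ_[2]) =
        4 * ∑ k ∈ range (2 ^ M), (f k : ℚ_[2]) + 4 ^ M * (e : ℚ_[2]) := by
      have := congrArg (fun x : ℤ_[2] => (x : ℚ_[2])) he
      push_cast [coe_sum2, coe_two2, coe_four2] at this
      exact this
    have h2 : (2 : ℚ_[2]) ≠ 0 := two_ne_zero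
    have : b (M + 1) - b M = 2 ^ M * (e : ℚ_[2]) * (2 * 2 : ℚ_[2])⁻¹ := by
      simp only [hb]
      have h4 : (4 : ℚ_[2]) ^ M = 2 ^ M * 2 ^ M := by rw [← mul_pow]; norm_num
      rw [h4] at he'
      have h2M : (2 : ℚ_[2]) ^ M ≠ 0 := pow_ne_zero _ h2
      rw [pow_succ]
      field_simp
      linear_combination he'
    rw [this, norm_mul, norm_mul, norm_inv, norm_mul, norm_two_pow_q, norm_two_q]
    have h1 : ‖(e : ℚ_[2])‖ ≤ 1 := e.2
    have h3 : (0 : ℝ) < (2⁻¹ : ℝ) ^ M := by positivity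
    norm_num only [mul_inv, inv_inv]
    norm_num only at h3
    nlinarith
  have tail : ∀ M k, ‖b (M + k) - b M‖ ≤ 4 * (2⁻¹ : ℝ) ^ M := by
    intro M k
    induction k with
    | zero => simp
    | succ k ih =>
      have : b (M + (k + 1)) - b M = (b (M + k + 1) - b (M + k)) + (b (M + k) - b M) := by
        rw [← add_assoc]; ring
      rw [this]
      refine (Padic.nonarchimedean _ _).trans (max_le ((step _).trans ?_) ih)
      gcongr 4 * ?_
      exact pow_le_pow_of_le_one (by norm_num) (by norm_num) (by omega)
  have hc : CauchySeq b := by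
    rw [Metric.cauchySeq_iff']
    intro ε hε
    obtain ⟨M, hM⟩ := exists_pow_lt_of_lt_one (show 0 < ε / 4 by positivity)
      (show (2⁻¹ : ℝ) < 1 by norm_num)
    refine ⟨M, fun k hk => ?_⟩
    obtain ⟨j, rfl⟩ := Nat.exists_eq_add_of_le hk
    rw [dist_eq_norm]
    have := tail M j
    linarith
  obtain ⟨I, hI⟩ := cauchySeq_tendsto_of_complete hc
  refine ⟨I, hI, fun M => ?_⟩
  have : Tendsto (fun k => ‖b k - b M‖) atTop (nhds ‖I - b M‖) :=
    (hI.sub_const _).norm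
  refine le_of_tendsto this ?_
  filter_upwards [eventually_ge_atTop M] with k hk
  obtain ⟨j, rfl⟩ := Nat.exists_eq_add_of_le hk
  exact tail M j

theorem Vol_norm_le {f : ℤ → ℤ_[2]} (hf : f ∈ VC ℤ_[2]) {I : ℚ_[2]}
    (hI : Vol (fun x => (f x : ℚ_[2])) I) : ‖I‖ ≤ 2 := by
  obtain ⟨J, hJ, h⟩ := VC_vol hf
  obtain rfl := hI.unique hJ
  have h1 := h 1
  have e : I = (I - (2 ^ 1 : ℚ_[2])⁻¹ * ∑ k ∈ range (2 ^ 1), (f k : ℚ_[2])) +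
    (2 ^ 1 : ℚ_[2])⁻¹ * ((∑ k ∈ range (2 ^ 1), (f k) : ℤ_[2]) : ℚ_[2]) := by
      push_cast [coe_sum2]; ring
  rw [e]
  refine (Padic.nonarchimedean _ _).trans (max_le (h1.trans (by norm_num)) ?_)
  rw [norm_mul, norm_inv, norm_two_pow_q]
  have : ‖((∑ k ∈ range (2 ^ 1), (f k) : ℤ_[2]) : ℚ_[2])‖ ≤ 1 := PadicInt.norm_le_one _
  norm_num at this ⊢
  linarith

/-- Splitting into residue classes modulo `2^K`. -/
theorem Vol_balls {F : ℤ → ℚ_[2]} (K : ℕ) {I : ℕ → ℚ_[2]}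
    (h : ∀ a ∈ range (2 ^ K), Vol (fun s => F (a + (2 ^ K : ℕ) * s)) (I a)) :
    Vol F ((2 ^ K : ℚ_[2])⁻¹ * ∑ a ∈ range (2 ^ K), I a) := by
  have h1 := (Vol.sum (range (2 ^ K)) h).const_mul ((2 ^ K : ℚ_[2])⁻¹)
  unfold Vol at h1 ⊢
  rw [← tendsto_add_atTop_iff_nat K]
  refine h1.congr fun M => ?_
  have : ∀ (P Q : ℕ), ∑ k ∈ range (P * Q), F k = ∑ a ∈ range P, ∑ s ∈ range Q, F (a + P * s) := by
    intro P Q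
    induction Q with
    | zero => simp
    | succ Q ih =>
      rw [Nat.mul_succ, Finset.sum_range_add, ih, ← Finset.sum_add_distrib]
      refine Finset.sum_congr rfl fun a _ => ?_
      rw [Finset.sum_range_succ]
      push_cast
      rw [add_comm (a : ℤ)]
  rw [add_comm M K, pow_add (2 : ℕ) K M, this, Finset.sum_comm, pow_add, mul_inv, ← Finset.mul_sum]
  push_cast
  ring

theorem vol_congr_tendsto {F G : ℤ → ℚ_[2]} {I J : ℚ_[2]} (hF : Vol F I)
    (h : Tendsto (fun M : ℕ => (2 ^ M : ℚ_[2])⁻¹ *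
      (∑ k ∈ range (2 ^ M), G k - ∑ k ∈ range (2 ^ M), F k)) atTop (nhds J)) :
    Vol G (I + J) := by
  refine (Tendsto.add hF h).congr fun M => ?_
  ring

theorem Vol_shift {F : ℤ → ℚ_[2]} {I D : ℚ_[2]} (hF : Vol F I)
    (h : Tendsto (fun M : ℕ => (2 ^ M : ℚ_[2])⁻¹ * (F (2 ^ M) - F 0)) atTop (nhds D)) :
    Vol (fun x => F (x + 1)) (I + D) := by
  refine vol_congr_tendsto hF (h.congr fun M => ?_)
  rw [← Finset.sum_sub_distrib]
  have := Finset.sum_range_sub (fun k : ℕ => F k) (2 ^ M)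
  push_cast at this
  rw [this]

theorem Vol_unshift {F : ℤ → ℚ_[2]} {I D : ℚ_[2]} (hF : Vol (fun x => F (x + 1)) I)
    (h : Tendsto (fun M : ℕ => (2 ^ M : ℚ_[2])⁻¹ * (F (2 ^ M) - F 0)) atTop (nhds D)) :
    Vol F (I - D) := by
  rw [sub_eq_add_neg]
  refine vol_congr_tendsto hF (h.neg.congr fun M => ?_)
  rw [← Finset.sum_sub_distrib]
  have := Finset.sum_range_sub (fun k : ℕ => F k) (2 ^ M)
  push_cast at this
  rw [← mul_neg, ← this, ← Finset.sum_neg_distrib]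
  congr 1
  exact Finset.sum_congr rfl fun k _ => by ring

theorem Vol_reflect {f : ℤ → ℤ_[2]} (hf : f ∈ VC ℤ_[2]) {I : ℚ_[2]}
    (hI : Vol (fun x => (f x : ℚ_[2])) I) : Vol (fun x => (f (-1 - x) : ℚ_[2])) I := by
  rw [← add_zero I]
  refine vol_congr_tendsto hI ?_
  obtain ⟨g, h1, h2⟩ := hf
  rw [tendsto_zero_iff_norm_tendsto_zero]
  have key : ∀ M : ℕ, ‖(2 ^ M : ℚ_[2])⁻¹ * (∑ k ∈ range (2 ^ M), (f (-1 - k) : ℚ_[2]) -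
      ∑ k ∈ range (2 ^ M), (f k : ℚ_[2]))‖ ≤ 2 * (2⁻¹ : ℝ) ^ M := by
    intro M
    obtain ⟨e, he⟩ := lip_sum h2 M
    choose E hE using fun k : ℕ => h1 k (-(2 ^ M : ℕ))
    have a1 : ∑ k ∈ range (2 ^ M), f (-1 - k) = ∑ k ∈ range (2 ^ M), f (k + (-(2 ^ M : ℕ) : ℤ)) := by
      rw [← Finset.sum_range_reflect]
      refine Finset.sum_congr rfl fun k hk => ?_
      rw [Finset.mem_range] at hk
      congr 1
      omega
    have a2 : 2 * (∑ k ∈ range (2 ^ M), f (-1 - k) - ∑ k ∈ range (2 ^ M), f k) =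
        2 ^ M * (2 ^ M * (2 * ∑ k ∈ range (2 ^ M), E k - e)) := by
      rw [a1]
      simp only [hE, Finset.sum_add_distrib, ← Finset.mul_sum]
      push_cast
      linear_combination (-2 ^ M : ℤ_[2]) * he
    have a3 : 2 * (∑ k ∈ range (2 ^ M), (f (-1 - k) : ℚ_[2]) - ∑ k ∈ range (2 ^ M), (f k : ℚ_[2])) =
        2 ^ M * (2 ^ M * ((2 * ∑ k ∈ range (2 ^ M), E k - e : ℤ_[2]) : ℚ_[2])) := by
      have := congrArg (fun x : ℤ_[2] => (x : ℚ_[2])) a2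
      push_cast [coe_sum2, coe_two2, coe_four2] at this ⊢
      exact this
    have a4 : (2 ^ M : ℚ_[2])⁻¹ * (∑ k ∈ range (2 ^ M), (f (-1 - k) : ℚ_[2]) -
      ∑ k ∈ range (2 ^ M), (f k : ℚ_[2])) = 2⁻¹ * (2 ^ M *
        ((2 * ∑ k ∈ range (2 ^ M), E k - e : ℤ_[2]) : ℚ_[2])) := by
      have h2M : (2 : ℚ_[2]) ^ M ≠ 0 := pow_ne_zero _ two_ne_zero
      field_simp
      linear_combination a3
    rw [a4, norm_mul, norm_mul, norm_inv, norm_two_pow_q, norm_two_q]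
    have := PadicInt.norm_le_one (2 * ∑ k ∈ range (2 ^ M), E k - e)
    rw [PadicInt.norm_def] at this
    have h3 : (0 : ℝ) < (2⁻¹ : ℝ) ^ M := by positivity
    rw [inv_inv]
    nlinarith
  have l0 : Tendsto (fun M : ℕ => 2 * (2⁻¹ : ℝ) ^ M) atTop (nhds 0) := by
    simpa using (tendsto_pow_atTop_nhds_zero_of_lt_one (show (0:ℝ) ≤ 2⁻¹ by norm_num)
      (by norm_num)).const_mul 2
  exact squeeze_zero (fun M => norm_nonneg _) key l0
end

section
theorem odd_unit2 (x : ℤ) : IsUnit (((2 * x + 1 : ℤ)) : ℤ_[2]) := by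
  rw [PadicInt.isUnit_iff]
  have h1 := PadicInt.norm_le_one ((2 * x + 1 : ℤ) : ℤ_[2])
  have h2 := PadicInt.norm_intCast_lt_one_iff (p := 2) (z := 2 * x + 1)
  rcases h1.lt_or_eq with h | h
  · have := h2.1 h
    push_cast at this
    omega
  · exact h

theorem odd_ne_zero2 (x : ℤ) : (2 * (x : ℚ_[2]) + 1) ≠ 0 := by
  intro h
  have : ((2 * x + 1 : ℤ) : ℚ_[2]) = 0 := by push_cast; exact h
  rw [Int.cast_eq_zero] at this
  omega

/-- inverse of an odd number in `ℤ₂`. -/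
noncomputable def oi (x : ℤ) : ℤ_[2] := Ring.inverse ((2 * x + 1 : ℤ) : ℤ_[2])

theorem oi_mul (x : ℤ) : ((2 * x + 1 : ℤ) : ℤ_[2]) * oi x = 1 :=
  Ring.mul_inverse_cancel _ (odd_unit2 x)

theorem oi_coe (x : ℤ) : (oi x : ℚ_[2]) = (2 * (x : ℚ_[2]) + 1)⁻¹ := by
  have h := congrArg (fun y : ℤ_[2] => (y : ℚ_[2])) (oi_mul x)
  push_cast [coe_two2] at h
  exact eq_inv_of_mul_eq_one_right h

theorem oi_VC : oi ∈ VC ℤ_[2] := by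
  refine VC_inv (f := fun x : ℤ => 1 + 2 * (x : ℤ_[2])) (VC_lin _ _) fun x => ?_
  have := oi_mul x
  push_cast at this
  rw [add_comm]
  exact this

theorem oi4_VC : (fun x => oi (2 * x)) ∈ VC ℤ_[2] := by
  refine VC_inv (f := fun x : ℤ => 1 + 4 * (x : ℤ_[2])) (VC_lin _ _) fun x => ?_
  have := oi_mul (2 * x)
  push_cast at this
  linear_combination this

theorem odd_vol (m : ℕ) : ∃ J : ℚ_[2], Vol (fun x => ((2 * (x : ℚ_[2]) + 1)⁻¹) ^ m) J ∧
    (Odd m → J = 0) ∧ (Even m → Vol (fun x => ((4 * (x : ℚ_[2]) + 1)⁻¹) ^ m) J) := by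
  have hV := pow_mem oi_VC m
  obtain ⟨J, hJ, -⟩ := VC_vol hV
  have hJ' : Vol (fun x => ((2 * (x : ℚ_[2]) + 1)⁻¹) ^ m) J := by
    simpa [oi_coe] using hJ
  refine ⟨J, hJ', ?_, ?_⟩
  · intro hm
    have h1 := Vol_reflect hV hJ
    have h2 : Vol (fun x => ((oi ^ m) (-1 - x) : ℚ_[2])) (-1 * J) := by
      convert hJ'.const_mul (-1) using 2 with x
      simp only [Pi.pow_apply, PadicInt.coe_pow, oi_coe]
      push_cast
      have : (2 * (-1 - (x : ℚ_[2])) + 1) = -(2 * x + 1) := by ring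
      rw [this, inv_neg, hm.neg_pow]
      ring
    have h3 := h1.unique h2
    have h4 : 2 * J = 0 := by linear_combination h3
    simpa using h4
  · intro hm
    have hV4 := pow_mem oi4_VC m
    obtain ⟨E, hE, -⟩ := VC_vol hV4
    have hE' : Vol (fun x => ((4 * (x : ℚ_[2]) + 1)⁻¹) ^ m) E := by
      convert hE using 2 with x
      simp only [Pi.pow_apply, PadicInt.coe_pow, oi_coe]
      push_cast
      congr 2
      ring
    have hR := Vol_reflect hV4 hE
    have hb := Vol_balls (F := fun x => ((2 * (x : ℚ_[2]) + 1)⁻¹) ^ m) 1 (I := fun _ => E) (by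
      intro a ha
      have : a = 0 ∨ a = 1 := by simp at ha; omega
      rcases this with rfl | rfl
      · convert hE' using 2 with x
        push_cast
        congr 2
        ring
      · convert hR using 2 with x
        simp only [Pi.pow_apply, PadicInt.coe_pow, oi_coe]
        push_cast
        have : (2 * (1 + 2 * (x : ℚ_[2])) + 1) = -(2 * (2 * (-1 - x)) + 1) := by ring
        rw [this, inv_neg, hm.neg_pow])
    have h3 := hJ'.unique hb
    rw [Finset.sum_const, Finset.card_range] at h3
    have : J = E := by
      rw [h3]; push_cast; simp
    rw [this]
    exact hE'

theorem zeta_link {m : ℕ} (hm : m ≠ 0) {J : ℚ_[2]} (h : Vol (fun x => ((4 * (x : ℚ_[2]) + 1)⁻¹) ^ m) J) :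
    Tendsto (fun M : ℕ => (2 ^ M : ℚ_[2])⁻¹ *
      ∑ k ∈ Finset.range (2 ^ M), ((((k : ℚ) + 1/4) ^ ((1 : ℤ) - ((m + 1 : ℕ) : ℤ)) : ℚ) : ℚ_[2]))
      Filter.atTop (nhds ((((m + 1 : ℕ) : ℚ_[2]) - 1) * 4 ^ (m + 1 - 1) * (J / m))) := by
  have h1 := h.const_mul (4 ^ m)
  have hm' : (m : ℚ_[2]) ≠ 0 := by exact_mod_cast hm
  have e1 : (((m + 1 : ℕ) : ℚ_[2]) - 1) * 4 ^ (m + 1 - 1) * (J / m) = 4 ^ m * J := by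
    push_cast
    field_simp
    ring
  rw [e1]
  refine Tendsto.congr (fun M => ?_) h1
  congr 1
  refine Finset.sum_congr rfl fun k _ => ?_
  have e2 : ((1 : ℤ) - ((m + 1 : ℕ) : ℤ)) = -(m : ℤ) := by push_cast; ring
  rw [e2, zpow_neg, zpow_natCast, ← inv_pow]
  push_cast
  rw [← mul_pow]
  congr 1
  have h4 : (4 * (k : ℚ_[2]) + 1) ≠ 0 := by exact_mod_cast (by omega : 4 * k + 1 ≠ 0)
  have h5 : ((k : ℚ_[2]) + 1 / 4) = (4 * k + 1) / 4 := by field_simp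
  rw [h5, inv_div]
  rfl

/-- rational part of the shifted integrals. -/
noncomputable def rr (m : ℕ) (p : ℤ) : ℚ :=
  m * (∑ i ∈ range (p + 1).toNat, ((-(i : ℚ) - 1 / 2)⁻¹) ^ (m + 1) -
    ∑ i ∈ range (-p - 1).toNat, (((i : ℚ) + 1 / 2)⁻¹) ^ (m + 1))

theorem half_ne2 (y : ℤ) : (y : ℚ_[2]) - 1 / 2 ≠ 0 := by
  have h := odd_ne_zero2 (y - 1)
  intro h'
  apply h
  push_cast
  linear_combination 2 * h'

theorem deriv_lim (m : ℕ) (y : ℤ) : Tendsto (fun M : ℕ => (2 ^ M : ℚ_[2])⁻¹ *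
    ((((y : ℚ_[2]) + 2 ^ M - 1 / 2)⁻¹) ^ m - (((y : ℚ_[2]) - 1 / 2)⁻¹) ^ m)) atTop
    (nhds (-(m * (((y : ℚ_[2]) - 1 / 2)⁻¹) ^ (m + 1)))) := by
  have hy := half_ne2 y
  have h1 : HasDerivAt (fun t : ℚ_[2] => ((t - 1 / 2)⁻¹) ^ m)
      (-(m * (((y : ℚ_[2]) - 1 / 2)⁻¹) ^ (m + 1))) (y : ℚ_[2]) := by
    have := ((((hasDerivAt_id (y : ℚ_[2])).sub_const (1 / 2)).inv hy)).pow m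
    refine HasDerivAt.congr_deriv this ?_
    show (m : ℚ_[2]) * (((y : ℚ_[2]) - 1 / 2)⁻¹) ^ (m - 1) * (-1 / ((y : ℚ_[2]) - 1 / 2) ^ 2) = _
    rcases m with _ | m
    · simp
    · simp only [Nat.add_sub_cancel]
      generalize (y : ℚ_[2]) - 1 / 2 = w
      rw [div_eq_mul_inv, ← inv_pow]
      ring
  rw [hasDerivAt_iff_tendsto_slope_zero] at h1
  have h2 : Tendsto (fun M : ℕ => (2 : ℚ_[2]) ^ M) atTop (nhdsWithin 0 {0}ᶜ) := by
    rw [tendsto_nhdsWithin_iff]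
    exact ⟨two_pow_tendsto, Filter.Eventually.of_forall fun M => by simp⟩
  exact h1.comp h2

theorem rr_step (m : ℕ) (p : ℤ) : rr m p = rr m (p - 1) + m * ((-(p : ℚ) - 1 / 2)⁻¹) ^ (m + 1) := by
  unfold rr
  rcases lt_or_ge p 0 with h | h
  · obtain ⟨k, rfl⟩ : ∃ k : ℕ, p = -1 - k := ⟨(-1 - p).toNat, by omega⟩
    have e1 : (-1 - (k : ℤ) + 1).toNat = 0 := by omega
    have e2 : (-1 - (k : ℤ) - 1 + 1).toNat = 0 := by omega
    have e3 : (-(-1 - (k : ℤ)) - 1).toNat = k := by omega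
    have e4 : (-(-1 - (k : ℤ) - 1) - 1).toNat = k + 1 := by omega
    rw [e1, e2, e3, e4, Finset.sum_range_succ]
    have : -(((-1 - k : ℤ)) : ℚ) - 1 / 2 = (k : ℚ) + 1 / 2 := by push_cast; ring
    rw [this]
    ring
  · obtain ⟨k, rfl⟩ : ∃ k : ℕ, p = k := ⟨p.toNat, by omega⟩
    have e1 : ((k : ℤ) + 1).toNat = k + 1 := by omega
    have e2 : ((k : ℤ) - 1 + 1).toNat = k := by omega
    have e3 : (-(k : ℤ) - 1).toNat = 0 := by omega
    have e4 : (-((k : ℤ) - 1) - 1).toNat = 0 := by omega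
    rw [e1, e2, e3, e4, Finset.sum_range_succ]
    push_cast
    ring

theorem pole_vol {m : ℕ} {H : ℚ_[2]} (hH : Vol (fun x => (((x : ℚ_[2]) + 1 / 2)⁻¹) ^ m) H) (p : ℤ) :
    Vol (fun x => (((x : ℚ_[2]) - ((p : ℚ_[2]) + 1 / 2))⁻¹) ^ m) (H + (rr m p : ℚ)) := by
  have up : ∀ p : ℤ, Vol (fun x => (((x : ℚ_[2]) - ((p : ℚ_[2]) + 1 / 2))⁻¹) ^ m) (H + (rr m p : ℚ)) →
      Vol (fun x => (((x : ℚ_[2]) - (((p + 1 : ℤ) : ℚ_[2]) + 1 / 2))⁻¹) ^ m) (H + (rr m (p + 1) : ℚ)) := by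
    intro p hp
    have h1 := Vol_unshift (F := fun x => (((x : ℚ_[2]) - (((p + 1 : ℤ) : ℚ_[2]) + 1 / 2))⁻¹) ^ m)
      (I := H + (rr m p : ℚ)) (D := -(m * ((((-(p + 1) : ℤ) : ℚ_[2]) - 1 / 2)⁻¹) ^ (m + 1))) (by
        convert hp using 2 with x
        push_cast
        congr 2
        ring) (by
        convert deriv_lim m (-(p + 1)) using 2 with M
        push_cast
        congr 4 <;> ring)
    convert h1 using 1
    rw [rr_step m (p + 1)]
    push_cast
    rw [add_sub_cancel_right]
    ring
  have down : ∀ p : ℤ, Vol (fun x => (((x : ℚ_[2]) - ((p : ℚ_[2]) + 1 / 2))⁻¹) ^ m) (H + (rr m p : ℚ)) →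
      Vol (fun x => (((x : ℚ_[2]) - (((p - 1 : ℤ) : ℚ_[2]) + 1 / 2))⁻¹) ^ m) (H + (rr m (p - 1) : ℚ)) := by
    intro p hp
    have h1 := Vol_shift (F := fun x => (((x : ℚ_[2]) - ((p : ℚ_[2]) + 1 / 2))⁻¹) ^ m)
      (I := H + (rr m p : ℚ)) (D := -(m * ((((-p : ℤ) : ℚ_[2]) - 1 / 2)⁻¹) ^ (m + 1))) hp (by
        convert deriv_lim m (-p) using 2 with M
        push_cast
        congr 4 <;> ring)
    convert h1 using 1
    · ext x
      push_cast
      congr 2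
      ring
    · rw [rr_step m p]
      push_cast
      ring
  induction p using Int.inductionOn' (b := -1) with
  | zero =>
    have : rr m (-1) = 0 := by simp [rr]
    rw [this]
    convert hH using 2 with x
    · push_cast
      congr 2
      ring
    · simp
  | succ k _ ih => exact up k ih
  | pred k _ ih => exact down k ih

theorem main_H (hneg : ∀ j : ℕ, (j = 7 ∨ j = 9 ∨ j = 11 ∨ j = 13) → ∀ z : ℚ_[2],
      Tendsto (fun M : ℕ => (2 ^ M : ℚ_[2])⁻¹ *
      ∑ k ∈ Finset.range (2 ^ M), ((((k : ℚ) + 1/4) ^ ((1 : ℤ) - (j : ℤ)) : ℚ) : ℚ_[2]))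
      Filter.atTop (nhds (((j : ℚ_[2]) - 1) * 4 ^ (j - 1) * z)) → ∃ q : ℚ, z = q) :
    ∃ (H : ℕ → ℚ_[2]) (h : ℕ → ℚ), (∀ m, Vol (fun x => (((x : ℚ_[2]) + 1 / 2)⁻¹) ^ m) (H m)) ∧
      h 4 = 0 ∧ ∀ m, 5 ≤ m → m ≤ 12 → H m = h m := by
  choose J hJ hodd heven using odd_vol
  have hH : ∀ m, Vol (fun x => (((x : ℚ_[2]) + 1 / 2)⁻¹) ^ m) (2 ^ m * J m) := by
    intro m
    convert (hJ m).const_mul (2 ^ m) using 2 with x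
    rw [← mul_pow]
    congr 1
    have h4 := odd_ne_zero2 x
    have h5 : ((x : ℚ_[2]) + 1 / 2) = (2 * x + 1) / 2 := by field_simp
    rw [h5, inv_div]
    rfl
  have key : ∀ m, 5 ≤ m → m ≤ 12 → ∃ q : ℚ, 2 ^ m * J m = q := by
    intro m h5 h12
    rcases Nat.even_or_odd m with he | ho
    · obtain ⟨q, hq⟩ := hneg (m + 1) (by obtain ⟨k, rfl⟩ := he; omega) (J m / m)
        (zeta_link (by omega) (heven m he))
      have hm' : (m : ℚ_[2]) ≠ 0 := by
        have : m ≠ 0 := by omega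
        exact_mod_cast this
      refine ⟨2 ^ m * (q * m), ?_⟩
      push_cast
      rw [← hq]
      field_simp
    · exact ⟨0, by rw [hodd m ho]; simp⟩
  choose! h hh using key
  refine ⟨fun m => 2 ^ m * J m, fun m => if m = 4 then 0 else h m, hH, by simp, ?_⟩
  intro m h5 h12
  simp only
  rw [if_neg (by omega)]
  exact hh m h5 h12
end

section
/-- product over the zeros of the brick. -/
noncomputable def ZP {A : Type*} [CommMonoid A] (n : ℤ) (f : ℤ → A) : A :=
  (∏ z ∈ Ioc (-4 * n) (4 * n), f z) ^ 2 * (∏ z ∈ Ioo (-10 * n) (6 * n), f z) *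
    ∏ z ∈ Ioc (-6 * n) (10 * n), f z

/-- product over the poles of the brick. -/
noncomputable def PP {A : Type*} [CommMonoid A] (n : ℤ) (f : ℤ → A) : A :=
  (∏ p ∈ Ico (-5 * n) (5 * n), f p) * (∏ p ∈ Ico (-8 * n) (8 * n), f p) *
    ∏ p ∈ Ico (-11 * n) (11 * n), f p

theorem ZP_mul {A : Type*} [CommMonoid A] (n : ℤ) (f g : ℤ → A) :
    ZP n (fun z => f z * g z) = ZP n f * ZP n g := by
  simp only [ZP, Finset.prod_mul_distrib, mul_pow]
  simp only [mul_assoc, mul_left_comm, mul_comm]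

theorem PP_mul {A : Type*} [CommMonoid A] (n : ℤ) (f g : ℤ → A) :
    PP n (fun z => f z * g z) = PP n f * PP n g := by
  simp only [PP, Finset.prod_mul_distrib]
  simp only [mul_assoc, mul_left_comm, mul_comm]

theorem ZP_map {A B F : Type*} [CommMonoid A] [CommMonoid B] [FunLike F A B] [MonoidHomClass F A B]
    (φ : F) (n : ℤ) (f : ℤ → A) : φ (ZP n f) = ZP n (fun z => φ (f z)) := by
  simp only [ZP, map_mul, map_pow, map_prod]

theorem PP_map {A B F : Type*} [CommMonoid A] [CommMonoid B] [FunLike F A B] [MonoidHomClass F A B]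
    (φ : F) (n : ℤ) (f : ℤ → A) : φ (PP n f) = PP n (fun z => φ (f z)) := by
  simp only [PP, map_mul, map_prod]

theorem PP_const {A : Type*} [CommMonoid A] (n : ℕ) (c : A) : PP n (fun _ => c) = c ^ (48 * n) := by
  simp only [PP, Finset.prod_const, Int.card_Ico, ← pow_add]
  congr 1
  omega

open PowerSeries in
/-- The rational function `R(x + X)` as a power series. -/
noncomputable def fser (n : ℤ) (x : ℚ) : PowerSeries ℚ :=
  (ZP n (fun z => C (x - z) + X) * PP n (fun p => (C (x - (p + 1 / 2)) + X)⁻¹)) ^ 3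

/-- `gcd(a - z, 2^K)` -/
def gg (K a : ℕ) (z : ℤ) : ℕ := Int.gcd (a - z) (2 ^ K : ℕ)

theorem gg_pos (K a : ℕ) (z : ℤ) : 0 < gg K a z :=
  Int.gcd_pos_of_ne_zero_right _ (by positivity)

open PowerSeries in
/-- normalized zero factor on a ball -/
noncomputable def ell (K a : ℕ) (z s : ℤ) : PowerSeries ℤ_[2] :=
  ((((a - z) / gg K a z : ℤ)) : PowerSeries ℤ_[2]) +
    (((2 ^ K : ℕ) / gg K a z : ℤ) : PowerSeries ℤ_[2]) * ((s : PowerSeries ℤ_[2]) + X)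

open PowerSeries in
/-- normalized pole factor on a ball -/
noncomputable def pol (K a : ℕ) (p s : ℤ) : PowerSeries ℤ_[2] :=
  ((2 * (a - p - 1) + 1 : ℤ) : PowerSeries ℤ_[2]) +
    ((2 * (2 ^ K : ℕ) : ℤ) : PowerSeries ℤ_[2]) * ((s : PowerSeries ℤ_[2]) + X)

/-- inverse of the pole factor -/
noncomputable def poli (K a : ℕ) (p s : ℤ) : PowerSeries ℤ_[2] := Ring.inverse (pol K a p s)

theorem pol_mul (K a : ℕ) (p s : ℤ) : pol K a p s * poli K a p s = 1 := by
  apply Ring.mul_inverse_cancel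
  rw [PowerSeries.isUnit_iff_constantCoeff]
  have h := odd_unit2 (a - p - 1 + (2 ^ K : ℕ) * s)
  convert h using 1
  simp only [pol, map_add, map_mul, map_intCast, PowerSeries.constantCoeff_X, add_zero]
  push_cast
  ring

theorem ell_VC (K a : ℕ) (z : ℤ) : (fun s => ell K a z s) ∈ VC (PowerSeries ℤ_[2]) := by
  convert VC_lin ((((a - z) / gg K a z : ℤ) : PowerSeries ℤ_[2]) + (((2 ^ K : ℕ) / gg K a z : ℤ) : PowerSeries ℤ_[2]) *
    PowerSeries.X) (((2 ^ K : ℕ) / gg K a z : ℤ) : PowerSeries ℤ_[2]) using 2 with s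
  simp only [ell]
  ring

theorem pol_VC (K a : ℕ) (p : ℤ) : (fun s => pol K a p s) ∈ VC (PowerSeries ℤ_[2]) := by
  convert VC_lin (((2 * (a - p - 1) + 1 : ℤ) : PowerSeries ℤ_[2]) +
    ((2 * (2 ^ K : ℕ) : ℤ) : PowerSeries ℤ_[2]) * PowerSeries.X)
      ((2 * (2 ^ K : ℕ) : ℤ) : PowerSeries ℤ_[2]) using 2 with s
  simp only [pol]
  ring

theorem poli_VC (K a : ℕ) (p : ℤ) : (fun s => poli K a p s) ∈ VC (PowerSeries ℤ_[2]) :=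
  VC_inv (pol_VC K a p) fun s => pol_mul K a p s

/-- normalized function on a ball -/
noncomputable def GG (n : ℤ) (K a : ℕ) (s : ℤ) : PowerSeries ℤ_[2] :=
  (ZP n (fun z => ell K a z s) * PP n (fun p => poli K a p s)) ^ 3

theorem prod_VC {A ι : Type*} [CommRing A] (S : Finset ι) (f : ι → ℤ → A)
    (h : ∀ i ∈ S, f i ∈ VC A) : (fun s => ∏ i ∈ S, f i s) ∈ VC A := by
  have := prod_mem (S := VC A) (t := S) (f := f) h
  convert this using 1
  ext s
  rw [Finset.prod_apply]

theorem GG_VC (n : ℤ) (K a : ℕ) : (fun s => GG n K a s) ∈ VC (PowerSeries ℤ_[2]) := by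
  have h1 : ∀ S : Finset ℤ, (fun s => ∏ z ∈ S, ell K a z s) ∈ VC (PowerSeries ℤ_[2]) :=
    fun S => prod_VC S (fun z s => ell K a z s) fun z _ => ell_VC K a z
  have h2 : ∀ S : Finset ℤ, (fun s => ∏ z ∈ S, poli K a z s) ∈ VC (PowerSeries ℤ_[2]) :=
    fun S => prod_VC S (fun z s => poli K a z s) fun z _ => poli_VC K a z
  exact pow_mem (mul_mem (mul_mem (mul_mem (pow_mem (h1 _) 2) (h1 _)) (h1 _))
    (mul_mem (mul_mem (h2 _) (h2 _)) (h2 _))) 3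

theorem coeff_VC {g : ℤ → PowerSeries ℤ_[2]} (hg : g ∈ VC (PowerSeries ℤ_[2])) (j : ℕ) :
    (fun s => PowerSeries.coeff j (g s)) ∈ VC ℤ_[2] :=
  VC_map (PowerSeries.coeff j : PowerSeries ℤ_[2] →ₗ[ℤ_[2]] ℤ_[2]).toAddMonoidHom hg

theorem half_ne (y p : ℤ) : (y : ℚ) - (p + 1 / 2) ≠ 0 := by
  intro h
  have : (2 * (y - p) : ℤ) = (1 : ℤ) := by
    have h' : (2 * ((y : ℚ) - p)) = 1 := by linear_combination 2 * h
    exact_mod_cast h'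
  omega

theorem ball_ident (n K a : ℕ) (s : ℤ) :
    (2 ^ K : ℚ_[2]) ^ 3 * ((PowerSeries.coeff 3 (fser n ((a + (2 ^ K : ℕ) * s : ℤ) : ℚ)) : ℚ) : ℚ_[2]) =
      ((ZP n (fun z => (gg K a z : ℚ_[2]))) * 2 ^ (48 * n)) ^ 3 *
        ((PowerSeries.coeff 3 (GG n K a s) : ℤ_[2]) : ℚ_[2]) := by
  set Φ : PowerSeries ℚ →+* PowerSeries ℚ_[2] :=
    (PowerSeries.map (Rat.castHom ℚ_[2])).comp (PowerSeries.rescale (2 ^ K : ℚ)) with hΦ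
  set Ψ : PowerSeries ℤ_[2] →+* PowerSeries ℚ_[2] := PowerSeries.map (PadicInt.Coe.ringHom (p := 2)) with hΨ
  have hX : Φ PowerSeries.X = 2 ^ K * PowerSeries.X := by
    simp [hΦ, PowerSeries.rescale_X]
    rw [← map_ofNat (PowerSeries.C (R := ℚ_[2])) 2]
  have hC : ∀ q : ℚ, Φ (PowerSeries.C q) = PowerSeries.C (q : ℚ_[2]) := by
    intro q
    ext j
    simp only [hΦ, RingHom.comp_apply, PowerSeries.coeff_map, PowerSeries.coeff_rescale,
      PowerSeries.coeff_C]
    split_ifs with h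
    · simp [h]
    · simp
  have hz : ∀ z : ℤ, Φ (PowerSeries.C (((a + (2 ^ K : ℕ) * s : ℤ) : ℚ) - z) + PowerSeries.X) =
      PowerSeries.C (gg K a z : ℚ_[2]) * Ψ (ell K a z s) := by
    intro z
    rw [map_add, hX, hC]
    have e1 : ((a - z : ℤ) : PowerSeries ℚ_[2]) = (gg K a z : PowerSeries ℚ_[2]) * (((a - z) / gg K a z : ℤ) : PowerSeries ℚ_[2]) := by
      have : (a - z : ℤ) = gg K a z * ((a - z) / gg K a z) :=
        (Int.mul_ediv_cancel' (Int.gcd_dvd_left _ _)).symm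
      exact_mod_cast congrArg (fun t : ℤ => (t : PowerSeries ℚ_[2])) this
    have e2 : (((2 ^ K : ℕ) : ℤ) : PowerSeries ℚ_[2]) = (gg K a z : PowerSeries ℚ_[2]) * (((2 ^ K : ℕ) / gg K a z : ℤ) : PowerSeries ℚ_[2]) := by
      have : ((2 ^ K : ℕ) : ℤ) = gg K a z * ((2 ^ K : ℕ) / gg K a z) :=
        (Int.mul_ediv_cancel' (Int.gcd_dvd_right _ _)).symm
      exact_mod_cast congrArg (fun t : ℤ => (t : PowerSeries ℚ_[2])) this
    simp only [ell, map_add, map_mul, map_intCast, hΨ, PowerSeries.map_X]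
    have e3 : PowerSeries.C ((((a + (2 ^ K : ℕ) * s : ℤ) : ℚ) - z : ℚ) : ℚ_[2]) =
      ((a - z : ℤ) : PowerSeries ℚ_[2]) + (((2 ^ K : ℕ) : ℤ) : PowerSeries ℚ_[2]) * (s : PowerSeries ℚ_[2]) := by
      push_cast
      simp only [map_add, map_sub, map_mul, map_natCast, map_intCast, map_pow, map_ofNat]
      ring
    rw [e3, map_natCast, mul_add, ← e1, ← mul_assoc, ← e2]
    push_cast
    ring
  have hp : ∀ p : ℤ, Φ ((PowerSeries.C (((a + (2 ^ K : ℕ) * s : ℤ) : ℚ) - (p + 1 / 2)) + PowerSeries.X)⁻¹) =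
      2 * Ψ (poli K a p s) := by
    intro p
    set Q := PowerSeries.C (((a + (2 ^ K : ℕ) * s : ℤ) : ℚ) - (p + 1 / 2)) + PowerSeries.X with hQ
    have h1 : Q * Q⁻¹ = 1 := by
      apply PowerSeries.mul_inv_cancel
      simp only [hQ, map_add, PowerSeries.constantCoeff_C, PowerSeries.constantCoeff_X, add_zero]
      exact half_ne _ p
    have h2 : 2 * Φ Q = Ψ (pol K a p s) := by
      rw [hQ, map_add, hX, hC]
      simp only [pol, map_add, map_mul, map_intCast, hΨ, PowerSeries.map_X]
      have e3 : 2 * PowerSeries.C ((((a + (2 ^ K : ℕ) * s : ℤ) : ℚ) - (p + 1 / 2) : ℚ) : ℚ_[2]) =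
        ((2 * (a - p - 1) + 1 : ℤ) : PowerSeries ℚ_[2]) + (((2 * (2 ^ K : ℕ) : ℤ) : ℤ) : PowerSeries ℚ_[2]) * (s : PowerSeries ℚ_[2]) := by
        have : (2 : PowerSeries ℚ_[2]) = PowerSeries.C (2 : ℚ_[2]) :=
          (map_ofNat (PowerSeries.C (R := ℚ_[2])) 2).symm
        rw [this, ← map_mul]
        have e4 : (2 : ℚ_[2]) * ((((a + (2 ^ K : ℕ) * s : ℤ) : ℚ) - (p + 1 / 2) : ℚ) : ℚ_[2]) =
          (((2 * (a - p - 1) + 1) + (2 * (2 ^ K : ℕ)) * s : ℤ) : ℚ_[2]) := by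
          push_cast
          ring
        rw [e4, map_intCast]
        push_cast
        ring
      rw [mul_add, e3]
      push_cast
      ring
    have h3 : Φ Q * Φ Q⁻¹ = 1 := by rw [← map_mul, h1, map_one]
    have h4 : Ψ (pol K a p s) * Ψ (poli K a p s) = 1 := by rw [← map_mul, pol_mul, map_one]
    rw [← h2] at h4
    calc Φ Q⁻¹ = Φ Q⁻¹ * (2 * Φ Q * Ψ (poli K a p s)) := by rw [h4, mul_one]
      _ = (Φ Q * Φ Q⁻¹) * (2 * Ψ (poli K a p s)) := by ring
      _ = _ := by rw [h3, one_mul]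
  have hF : Φ (fser n ((a + (2 ^ K : ℕ) * s : ℤ) : ℚ)) =
      PowerSeries.C (((ZP n (fun z => (gg K a z : ℚ_[2]))) * 2 ^ (48 * n)) ^ 3) * Ψ (GG n K a s) := by
    simp only [fser, GG, map_pow, map_mul, ZP_map, PP_map, hz, hp, ZP_mul, PP_mul, PP_const]
    simp only [map_ofNat]
    ring
  have h1 := congrArg (PowerSeries.coeff 3) hF
  rw [PowerSeries.coeff_C_mul, hΨ, PowerSeries.coeff_map, hΦ, RingHom.comp_apply,
    PowerSeries.coeff_map, PowerSeries.coeff_rescale] at h1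
  refine Eq.trans ?_ h1
  simp
end

section
theorem prod_range_two_mul {A : Type*} [CommMonoid A] (f : ℕ → A) (m : ℕ) :
    ∏ x ∈ range (2 * m), f x = ∏ y ∈ range m, (f (2 * y) * f (2 * y + 1)) := by
  induction m with
  | zero => simp
  | succ m ih =>
    rw [show 2 * (m + 1) = 2 * m + 1 + 1 by ring, Finset.prod_range_succ, Finset.prod_range_succ, ih,
      Finset.prod_range_succ, mul_assoc]

theorem prod_gcd_two_pow (K : ℕ) : ∏ x ∈ range (2 ^ K), Nat.gcd x (2 ^ K) = 2 ^ (2 ^ K - 1) := by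
  induction K with
  | zero => simp
  | succ K ih =>
    rw [pow_succ, mul_comm (2 ^ K) 2, prod_range_two_mul]
    have : ∀ y ∈ range (2 ^ K), Nat.gcd (2 * y) (2 * 2 ^ K) * Nat.gcd (2 * y + 1) (2 * 2 ^ K) =
        2 * Nat.gcd y (2 ^ K) := by
      intro y _
      rw [Nat.gcd_mul_left]
      have : Nat.gcd (2 * y + 1) (2 * 2 ^ K) = 1 := by
        rw [← pow_succ', ← Nat.coprime_iff_gcd_eq_one]
        apply Nat.Coprime.pow_right
        simp
      rw [this, mul_one]
    rw [Finset.prod_congr rfl this, Finset.prod_mul_distrib, ih, Finset.prod_const, card_range,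
      ← pow_add]
    congr 1
    have : 0 < 2 ^ K := by positivity
    omega

theorem gg_periodic (K a : ℕ) (z : ℤ) : gg K a (z + (2 ^ K : ℕ)) = gg K a z := by
  unfold gg
  have : (a : ℤ) - (z + (2 ^ K : ℕ)) = (a - z) - (2 ^ K : ℕ) := by ring
  rw [this, Int.gcd_sub_right_left_of_dvd]
  exact dvd_refl _

theorem prod_Ioc_shift (K a : ℕ) (A : ℤ) :
    ∏ z ∈ Ioc (A + 1) (A + 1 + (2 ^ K : ℕ)), gg K a z = ∏ z ∈ Ioc A (A + (2 ^ K : ℕ)), gg K a z := by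
  have hN : (0 : ℤ) < (2 ^ K : ℕ) := by positivity
  set N : ℤ := ((2 ^ K : ℕ) : ℤ) with hNd
  have e1 : Ioc A (A + 1 + N) = insert (A + 1) (Ioc (A + 1) (A + 1 + N)) := by
    ext x; simp only [mem_Ioc, mem_insert]; omega
  have e2 : Ioc A (A + 1 + N) = insert (A + 1 + N) (Ioc A (A + N)) := by
    ext x; simp only [mem_Ioc, mem_insert]; omega
  have h1 : ∏ z ∈ Ioc A (A + 1 + N), gg K a z = gg K a (A + 1) * ∏ z ∈ Ioc (A + 1) (A + 1 + N), gg K a z := by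
    rw [e1, Finset.prod_insert]; simp
  have h2 : ∏ z ∈ Ioc A (A + 1 + N), gg K a z = gg K a (A + 1) * ∏ z ∈ Ioc A (A + N), gg K a z := by
    rw [e2, Finset.prod_insert, hNd, gg_periodic]; simp
  rw [h1] at h2
  exact Nat.eq_of_mul_eq_mul_left (gg_pos _ _ _) h2

theorem prod_gg (K a : ℕ) (A : ℤ) : ∏ z ∈ Ioc A (A + (2 ^ K : ℕ)), gg K a z = 2 ^ (2 ^ K - 1) := by
  induction A using Int.inductionOn' (b := (a : ℤ) - (2 ^ K : ℕ)) with
  | zero =>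
    rw [← prod_gcd_two_pow]
    symm
    refine Finset.prod_bij (fun x _ => (a : ℤ) - x) ?_ ?_ ?_ ?_
    · intro x hx
      simp only [mem_range, mem_Ioc] at hx ⊢
      omega
    · intro x _ y _ h
      omega
    · intro z hz
      simp only [mem_Ioc] at hz
      exact ⟨(a - z).toNat, by simp only [mem_range]; omega, by omega⟩
    · intro x _
      simp only [gg]
      rw [show (a : ℤ) - (a - x) = (x : ℤ) by ring, Int.gcd_natCast_natCast]
  | succ k _ ih => rw [prod_Ioc_shift, ih]
  | pred k _ ih => rw [← prod_Ioc_shift, sub_add_cancel, ih]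

theorem ZP_gg (k a : ℕ) : ZP ((2 ^ k : ℕ) : ℤ) (gg (k + 3) a) * gg (k + 3) a (6 * (2 ^ k : ℕ)) =
    2 ^ (6 * (2 ^ (k + 3) - 1)) := by
  have hn : (0 : ℤ) < (2 ^ k : ℕ) := by positivity
  have hN : ((2 ^ (k + 3) : ℕ) : ℤ) = 8 * ((2 ^ k : ℕ) : ℤ) := by push_cast; ring
  set n : ℤ := ((2 ^ k : ℕ) : ℤ) with hnd
  have P := prod_gg (k + 3) a
  rw [hN] at P
  have h1 : ∏ z ∈ Ioc (-4 * n) (4 * n), gg (k + 3) a z = 2 ^ (2 ^ (k + 3) - 1) := by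
    rw [← P (-4 * n)]; congr 2; ring
  have split : ∀ A : ℤ, ∏ z ∈ Ioc A (A + 16 * n), gg (k + 3) a z = 2 ^ (2 ^ (k + 3) - 1) * 2 ^ (2 ^ (k + 3) - 1) := by
    intro A
    have e : Ioc A (A + 16 * n) = Ioc A (A + 8 * n) ∪ Ioc (A + 8 * n) (A + 8 * n + 8 * n) := by
      ext x; simp only [mem_Ioc, mem_union]; omega
    rw [e, Finset.prod_union, P, P]
    rw [Finset.disjoint_left]
    intro x; simp only [mem_Ioc]; omega
  have h2 : (∏ z ∈ Ioo (-10 * n) (6 * n), gg (k + 3) a z) * gg (k + 3) a (6 * n) =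
      2 ^ (2 ^ (k + 3) - 1) * 2 ^ (2 ^ (k + 3) - 1) := by
    rw [← split (-10 * n)]
    have e : Ioc (-10 * n) (-10 * n + 16 * n) = insert (6 * n) (Ioo (-10 * n) (6 * n)) := by
      ext x; simp only [mem_Ioc, mem_insert, mem_Ioo]; omega
    rw [e, Finset.prod_insert (by simp), mul_comm]
  have h3 : ∏ z ∈ Ioc (-6 * n) (10 * n), gg (k + 3) a z =
      2 ^ (2 ^ (k + 3) - 1) * 2 ^ (2 ^ (k + 3) - 1) := by
    rw [← split (-6 * n)]; congr 2; ring
  unfold ZP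
  rw [h1, h3, mul_right_comm, mul_assoc _ _ (gg (k + 3) a (6 * n)), h2]
  ring

theorem gg_cases (K a : ℕ) (z : ℤ) (h : ¬ ((2 ^ K : ℕ) : ℤ) ∣ a - z) :
    ∃ v < K, gg K a z = 2 ^ v := by
  have h1 : gg K a z ∣ 2 ^ K := Int.gcd_dvd_natAbs_right _ _
  rw [Nat.dvd_prime_pow Nat.prime_two] at h1
  obtain ⟨v, hv, hg⟩ := h1
  refine ⟨v, lt_of_le_of_ne hv ?_, hg⟩
  rintro rfl
  apply h
  rw [← hg]
  exact Int.gcd_dvd_left _ _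

theorem gg_dvd (K a : ℕ) (z : ℤ) (h : ((2 ^ K : ℕ) : ℤ) ∣ a - z) : gg K a z = 2 ^ K := by
  unfold gg
  have := (Int.gcd_eq_right_iff_dvd (by positivity)).2 h
  exact_mod_cast this

theorem gg_norm (K a : ℕ) (z : ℤ) : ‖(gg K a z : ℚ_[2])‖ = ((gg K a z : ℝ))⁻¹ := by
  have h1 : gg K a z ∣ 2 ^ K := Int.gcd_dvd_natAbs_right _ _
  rw [Nat.dvd_prime_pow Nat.prime_two] at h1
  obtain ⟨v, hv, hg⟩ := h1
  rw [hg]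
  push_cast
  rw [norm_two_pow_q, inv_pow]

/-- functions congruent to 1 modulo 2. -/
def Odd1 (h : ℤ → PowerSeries ℤ_[2]) : Prop :=
  ∃ w ∈ VC (PowerSeries ℤ_[2]), ∀ s, h s = 1 + 2 * w s

theorem Odd1.mul {f g : ℤ → PowerSeries ℤ_[2]} (hf : Odd1 f) (hg : Odd1 g) :
    Odd1 (fun s => f s * g s) := by
  obtain ⟨w, hw, e⟩ := hf
  obtain ⟨v, hv, e'⟩ := hg
  refine ⟨w + v + 2 * (w * v), add_mem (add_mem hw hv) (mul_mem (ofNat_mem _ 2) (mul_mem hw hv)), ?_⟩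
  intro s
  simp only [e, e', Pi.add_apply, Pi.mul_apply, Pi.ofNat_apply]
  ring

theorem Odd1.one : Odd1 (fun _ => 1) := ⟨0, zero_mem _, fun s => by simp⟩

theorem Odd1.prod {ι : Type*} (S : Finset ι) {f : ι → ℤ → PowerSeries ℤ_[2]}
    (h : ∀ i ∈ S, Odd1 (f i)) : Odd1 (fun s => ∏ i ∈ S, f i s) := by
  classical
  induction S using Finset.induction_on with
  | empty => simpa using Odd1.one
  | insert i S hi ih =>
    simp only [Finset.prod_insert hi]
    exact (h i (by simp)).mul (ih fun j hj => h j (by simp [hj]))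

theorem ell_odd (K a : ℕ) (z : ℤ) (h : ¬ ((2 ^ K : ℕ) : ℤ) ∣ a - z) : Odd1 (fun s => ell K a z s) := by
  obtain ⟨v, hv, hg⟩ := gg_cases K a z h
  obtain ⟨c, rfl⟩ := Nat.exists_eq_add_of_lt hv
  have hd : (gg (v + c + 1) a z : ℤ) ∣ a - z := Int.gcd_dvd_left _ _
  obtain ⟨u, hu⟩ := hd
  have hg0 : (gg (v + c + 1) a z : ℤ) ≠ 0 := by
    have := gg_pos (v + c + 1) a z
    omega
  have e1 : ((a : ℤ) - z) / gg (v + c + 1) a z = u := by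
    rw [hu, Int.mul_ediv_cancel_left _ hg0]
  have e2 : ((2 ^ (v + c + 1) : ℕ) : ℤ) / gg (v + c + 1) a z = 2 * 2 ^ c := by
    rw [hg]
    have : ((2 ^ (v + c + 1) : ℕ) : ℤ) = ((2 ^ v : ℕ) : ℤ) * (2 * 2 ^ c) := by push_cast; ring
    rw [this, Int.mul_ediv_cancel_left _ (by positivity)]
  have hodd : Odd u := by
    by_contra hne
    rw [Int.not_odd_iff_even] at hne
    obtain ⟨t, rfl⟩ := hne
    have d1 : ((2 * 2 ^ v : ℕ) : ℤ) ∣ a - z := ⟨t, by rw [hu, hg]; push_cast; ring⟩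
    have d2 : ((2 * 2 ^ v : ℕ) : ℤ) ∣ ((2 ^ (v + c + 1) : ℕ) : ℤ) := ⟨2 ^ c, by push_cast; ring⟩
    have d3 := Int.dvd_coe_gcd d1 d2
    change _ ∣ (gg (v + c + 1) a z : ℤ) at d3
    rw [hg] at d3
    have d4 := Nat.le_of_dvd (by positivity) (Int.natCast_dvd_natCast.1 d3)
    have : 0 < 2 ^ v := by positivity
    omega
  obtain ⟨t, rfl⟩ := hodd
  refine ⟨_, VC_lin ((t : PowerSeries ℤ_[2]) + 2 ^ c * PowerSeries.X) (2 ^ c), fun s => ?_⟩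
  simp only [ell, e1, e2]
  push_cast
  ring

theorem poli_odd (K a : ℕ) (p : ℤ) : Odd1 (fun s => poli K a p s) := by
  set v : ℤ → PowerSeries ℤ_[2] := fun s => ((((a : ℤ) - p - 1 : ℤ) : PowerSeries ℤ_[2]) +
    ((2 ^ K : ℕ) : PowerSeries ℤ_[2]) * PowerSeries.X) + ((2 ^ K : ℕ) : PowerSeries ℤ_[2]) * (s : PowerSeries ℤ_[2]) with hv
  have hvV : v ∈ VC _ := VC_lin _ _
  refine ⟨-(v * fun s => poli K a p s), neg_mem (mul_mem hvV (poli_VC K a p)), fun s => ?_⟩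
  have h := pol_mul K a p s
  have e : pol K a p s = 1 + 2 * v s := by
    simp only [pol, hv]
    push_cast
    ring
  rw [e] at h
  simp only [Pi.neg_apply, Pi.mul_apply]
  linear_combination h

theorem coeff_main (s : ℤ) :
    PowerSeries.coeff 3 ((((s : PowerSeries ℤ_[2]) + PowerSeries.X)) ^ 3 *
      (1 + ((s : PowerSeries ℤ_[2]) + PowerSeries.X)) ^ 12) =
     ((220 * s ^ 3 * (1 + s) ^ 9 + 198 * s ^ 2 * (1 + s) ^ 10 + 36 * s * (1 + s) ^ 11 + (1 + s) ^ 12 : ℤ) : ℤ_[2]) := by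
  set X : PowerSeries ℤ_[2] := PowerSeries.X
  have gen : ∀ S : PowerSeries ℤ_[2], ∃ Q : PowerSeries ℤ_[2], (S + X) ^ 3 * (1 + (S + X)) ^ 12 =
      (S ^ 3 * (1 + S) ^ 12) + (12 * S ^ 3 * (1 + S) ^ 11 + 3 * S ^ 2 * (1 + S) ^ 12) * X +
      (66 * S ^ 3 * (1 + S) ^ 10 + 36 * S ^ 2 * (1 + S) ^ 11 + 3 * S * (1 + S) ^ 12) * X ^ 2 +
      (220 * S ^ 3 * (1 + S) ^ 9 + 198 * S ^ 2 * (1 + S) ^ 10 + 36 * S * (1 + S) ^ 11 + (1 + S) ^ 12) * X ^ 3 +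
      X ^ 4 * Q := by
    intro S
    obtain ⟨t, ht⟩ : ∃ t, t = 1 + S := ⟨_, rfl⟩
    obtain ⟨Q, hQ⟩ : ∃ Q, (t + X) ^ 12 = t ^ 12 + 12 * t ^ 11 * X + 66 * t ^ 10 * X ^ 2 +
        220 * t ^ 9 * X ^ 3 + X ^ 4 * Q :=
      ⟨495 * t ^ 8 + 792 * t ^ 7 * X + 924 * t ^ 6 * X ^ 2 + 792 * t ^ 5 * X ^ 3 + 495 * t ^ 4 * X ^ 4 +
        220 * t ^ 3 * X ^ 5 + 66 * t ^ 2 * X ^ 6 + 12 * t * X ^ 7 + X ^ 8, by ring⟩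
    refine ⟨S ^ 3 * Q + 3 * S ^ 2 * (220 * t ^ 9 + X * Q) +
      3 * S * (66 * t ^ 10 + 220 * t ^ 9 * X + X ^ 2 * Q) +
      (12 * t ^ 11 + 66 * t ^ 10 * X + 220 * t ^ 9 * X ^ 2 + X ^ 3 * Q), ?_⟩
    rw [show 1 + (S + X) = t + X by rw [ht]; ring, hQ, ← ht]
    ring
  obtain ⟨Q, hQ⟩ := gen (s : PowerSeries ℤ_[2])
  rw [hQ]
  have e : ∀ m : ℤ, (m : PowerSeries ℤ_[2]) = PowerSeries.C (m : ℤ_[2]) := fun m => by simp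
  have e0 : ((s : PowerSeries ℤ_[2]) ^ 3 * (1 + (s : PowerSeries ℤ_[2])) ^ 12) = PowerSeries.C ((s ^ 3 * (1 + s) ^ 12 : ℤ) : ℤ_[2]) := by
    rw [← e]; push_cast; ring
  have e1 : (12 * (s : PowerSeries ℤ_[2]) ^ 3 * (1 + (s : PowerSeries ℤ_[2])) ^ 11 + 3 * (s : PowerSeries ℤ_[2]) ^ 2 * (1 + (s : PowerSeries ℤ_[2])) ^ 12) = PowerSeries.C ((12 * s ^ 3 * (1 + s) ^ 11 + 3 * s ^ 2 * (1 + s) ^ 12 : ℤ) : ℤ_[2]) := by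
    rw [← e]; push_cast; ring
  have e2 : (66 * (s : PowerSeries ℤ_[2]) ^ 3 * (1 + (s : PowerSeries ℤ_[2])) ^ 10 + 36 * (s : PowerSeries ℤ_[2]) ^ 2 * (1 + (s : PowerSeries ℤ_[2])) ^ 11 + 3 * (s : PowerSeries ℤ_[2]) * (1 + (s : PowerSeries ℤ_[2])) ^ 12) = PowerSeries.C ((66 * s ^ 3 * (1 + s) ^ 10 + 36 * s ^ 2 * (1 + s) ^ 11 + 3 * s * (1 + s) ^ 12 : ℤ) : ℤ_[2]) := by
    rw [← e]; push_cast; ring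
  have e3 : (220 * (s : PowerSeries ℤ_[2]) ^ 3 * (1 + (s : PowerSeries ℤ_[2])) ^ 9 + 198 * (s : PowerSeries ℤ_[2]) ^ 2 * (1 + (s : PowerSeries ℤ_[2])) ^ 10 + 36 * (s : PowerSeries ℤ_[2]) * (1 + (s : PowerSeries ℤ_[2])) ^ 11 + (1 + (s : PowerSeries ℤ_[2])) ^ 12) = PowerSeries.C ((220 * s ^ 3 * (1 + s) ^ 9 + 198 * s ^ 2 * (1 + s) ^ 10 + 36 * s * (1 + s) ^ 11 + (1 + s) ^ 12 : ℤ) : ℤ_[2]) := by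
    rw [← e]; push_cast; ring
  rw [e0, e1, e2, e3]
  simp only [map_add, PowerSeries.coeff_C_mul, PowerSeries.coeff_C, PowerSeries.coeff_X_pow, X,
    PowerSeries.coeff_X, PowerSeries.coeff_X_pow_mul']
  norm_num

theorem main_ball (k : ℕ) : ∃ I : ℚ_[2],
    Vol (fun s => ((PowerSeries.coeff 3 (GG ((2 ^ k : ℕ) : ℤ) (k + 3) (6 * 2 ^ k) s) : ℤ_[2]) : ℚ_[2])) I ∧
      ‖I‖ = 2 := by
  have hn : (0 : ℤ) < (2 ^ k : ℕ) := by positivity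
  have hN : ((2 ^ (k + 3) : ℕ) : ℤ) = 8 * ((2 ^ k : ℕ) : ℤ) := by push_cast; ring
  have ha : ((6 * 2 ^ k : ℕ) : ℤ) = 6 * ((2 ^ k : ℕ) : ℤ) := by push_cast; ring
  have hell1 : ∀ s, ell (k + 3) (6 * 2 ^ k) (6 * ((2 ^ k : ℕ) : ℤ)) s = (s : PowerSeries ℤ_[2]) + PowerSeries.X := by
    intro s
    have hg := gg_dvd (k + 3) (6 * 2 ^ k) (6 * ((2 ^ k : ℕ) : ℤ)) (by rw [ha]; simp)
    simp only [ell, hg, ha, sub_self, Int.zero_ediv]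
    rw [Int.ediv_self (by positivity)]
    simp
  have hell2 : ∀ s, ell (k + 3) (6 * 2 ^ k) (-2 * ((2 ^ k : ℕ) : ℤ)) s = 1 + ((s : PowerSeries ℤ_[2]) + PowerSeries.X) := by
    intro s
    have e : ((6 * 2 ^ k : ℕ) : ℤ) - (-2 * ((2 ^ k : ℕ) : ℤ)) = ((2 ^ (k + 3) : ℕ) : ℤ) := by
      rw [hN, ha]; ring
    have hg := gg_dvd (k + 3) (6 * 2 ^ k) (-2 * ((2 ^ k : ℕ) : ℤ)) (by rw [e])
    simp only [ell, hg, e]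
    rw [Int.ediv_self (by positivity)]
    simp
  have hother : ∀ z : ℤ, -10 * ((2 ^ k : ℕ) : ℤ) < z → z ≤ 10 * ((2 ^ k : ℕ) : ℤ) →
      z ≠ 6 * ((2 ^ k : ℕ) : ℤ) → z ≠ -2 * ((2 ^ k : ℕ) : ℤ) → Odd1 (fun s => ell (k + 3) (6 * 2 ^ k) z s) := by
    intro z h1 h2 h3 h4
    apply ell_odd
    rw [hN, ha]
    rintro ⟨c, hc⟩
    have c1 : c < 2 := by nlinarith
    have c0 : -1 < c := by nlinarith
    have : c = 0 ∨ c = 1 := by omega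
    rcases this with rfl | rfl
    · apply h3; linarith
    · apply h4; linarith
  set n : ℤ := ((2 ^ k : ℕ) : ℤ) with hnd
  have pA : ∃ O, Odd1 O ∧ ∀ s, ∏ z ∈ Ioc (-4 * n) (4 * n), ell (k + 3) (6 * 2 ^ k) z s =
      (1 + ((s : PowerSeries ℤ_[2]) + PowerSeries.X)) * O s := by
    refine ⟨_, Odd1.prod ((Ioc (-4 * n) (4 * n)).erase (-2 * n)) (f := fun z s => ell (k + 3) (6 * 2 ^ k) z s) ?_, ?_⟩
    · intro z hz
      simp only [mem_erase, mem_Ioc] at hz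
      exact hother z (by omega) (by omega) (by omega) hz.1
    · intro s
      rw [← hell2 s, Finset.mul_prod_erase _ (fun z => ell (k + 3) (6 * 2 ^ k) z s)]
      simp only [mem_Ioc]; omega
  have pB : ∃ O, Odd1 O ∧ ∀ s, ∏ z ∈ Ioo (-10 * n) (6 * n), ell (k + 3) (6 * 2 ^ k) z s =
      (1 + ((s : PowerSeries ℤ_[2]) + PowerSeries.X)) * O s := by
    refine ⟨_, Odd1.prod ((Ioo (-10 * n) (6 * n)).erase (-2 * n)) (f := fun z s => ell (k + 3) (6 * 2 ^ k) z s) ?_, ?_⟩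
    · intro z hz
      simp only [mem_erase, mem_Ioo] at hz
      exact hother z (by omega) (by omega) (by omega) hz.1
    · intro s
      rw [← hell2 s, Finset.mul_prod_erase _ (fun z => ell (k + 3) (6 * 2 ^ k) z s)]
      simp only [mem_Ioo]; omega
  have pC : ∃ O, Odd1 O ∧ ∀ s, ∏ z ∈ Ioc (-6 * n) (10 * n), ell (k + 3) (6 * 2 ^ k) z s =
      ((s : PowerSeries ℤ_[2]) + PowerSeries.X) * ((1 + ((s : PowerSeries ℤ_[2]) + PowerSeries.X)) * O s) := by
    refine ⟨_, Odd1.prod (((Ioc (-6 * n) (10 * n)).erase (6 * n)).erase (-2 * n)) (f := fun z s => ell (k + 3) (6 * 2 ^ k) z s) ?_, ?_⟩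
    · intro z hz
      simp only [mem_erase, mem_Ioc] at hz
      exact hother z (by omega) (by omega) (by omega) hz.1
    · intro s
      rw [← hell2 s, Finset.mul_prod_erase _ (fun z => ell (k + 3) (6 * 2 ^ k) z s), ← hell1 s,
        Finset.mul_prod_erase _ (fun z => ell (k + 3) (6 * 2 ^ k) z s)]
      · simp only [mem_Ioc]; omega
      · simp only [mem_erase, mem_Ioc]; omega
  obtain ⟨A, hA, eA⟩ := pA
  obtain ⟨B, hB, eB⟩ := pB
  obtain ⟨C, hC, eC⟩ := pC
  have pP : ∀ S : Finset ℤ, Odd1 (fun s => ∏ p ∈ S, poli (k + 3) (6 * 2 ^ k) p s) := fun S =>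
    Odd1.prod S fun p _ => poli_odd _ _ p
  have hP : Odd1 (fun s => PP n (fun p => poli (k + 3) (6 * 2 ^ k) p s)) :=
    ((pP _).mul (pP _)).mul (pP _)
  have hT := (((hA.mul hA).mul hB).mul hC).mul hP
  obtain ⟨w, hw, ew⟩ := (hT.mul hT).mul hT
  have hG : ∀ s, GG n (k + 3) (6 * 2 ^ k) s = ((s : PowerSeries ℤ_[2]) + PowerSeries.X) ^ 3 *
      (1 + ((s : PowerSeries ℤ_[2]) + PowerSeries.X)) ^ 12 * (1 + 2 * w s) := by
    intro s
    rw [← ew]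
    unfold GG ZP
    rw [eA, eB, eC]
    ring
  have hV0 : (fun s : ℤ => ((s : PowerSeries ℤ_[2]) + PowerSeries.X) ^ 3 *
      (1 + ((s : PowerSeries ℤ_[2]) + PowerSeries.X)) ^ 12) ∈ VC (PowerSeries ℤ_[2]) := by
    have h1 : (fun s : ℤ => (s : PowerSeries ℤ_[2]) + PowerSeries.X) ∈ VC (PowerSeries ℤ_[2]) := by
      convert VC_lin (PowerSeries.X : PowerSeries ℤ_[2]) 1 using 2 with s
      ring
    exact mul_mem (pow_mem h1 3) (pow_mem (add_mem (one_mem _) h1) 12)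
  have hV1 := mul_mem hV0 hw
  have hV0' := coeff_VC hV0 3
  have hV1' := coeff_VC hV1 3
  obtain ⟨I0, hI0, hb⟩ := VC_vol hV0'
  obtain ⟨I1, hI1, -⟩ := VC_vol hV1'
  have n1 := Vol_norm_le hV1' hI1
  refine ⟨I0 + 2 * I1, ?_, ?_⟩
  · convert hI0.add (hI1.const_mul 2) using 2 with s
    rw [hG]
    simp only [Pi.mul_apply]
    rw [← coe_two2, ← PadicInt.coe_mul, ← PadicInt.coe_add]
    congr 1
    rw [mul_add, mul_one, map_add]
    congr 1
    rw [mul_left_comm, show (2 : PowerSeries ℤ_[2]) = PowerSeries.C (2 : ℤ_[2]) from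
      (map_ofNat (PowerSeries.C (R := ℤ_[2])) 2).symm, PowerSeries.coeff_C_mul]
  · have h2 := hb 2
    simp only [coeff_main] at h2
    have n0 : ‖I0‖ = 2 := by
      have e : (2 ^ 2 : ℚ_[2])⁻¹ * ∑ s ∈ range (2 ^ 2), (((220 * (s : ℤ) ^ 3 * (1 + (s : ℤ)) ^ 9 + 198 * (s : ℤ) ^ 2 * (1 + (s : ℤ)) ^ 10 + 36 * (s : ℤ) * (1 + (s : ℤ)) ^ 11 + (1 + (s : ℤ)) ^ 12 : ℤ) : ℤ_[2]) : ℚ_[2]) = 2⁻¹ + (997636992 : ℚ_[2]) := by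
        rw [show (2 : ℕ) ^ 2 = 4 by norm_num]
        simp only [Finset.sum_range_succ, Finset.sum_range_zero, PadicInt.coe_intCast]
        norm_num
      rw [e] at h2
      have h3 : ‖(997636992 : ℚ_[2])‖ ≤ 1 := by
        have := PadicInt.norm_le_one (p := 2) ((997636992 : ℕ) : ℤ_[2])
        rw [PadicInt.norm_def, PadicInt.coe_natCast] at this
        exact_mod_cast this
      have h4 : ‖(I0 - (2⁻¹ + (997636992 : ℚ_[2]))) + 997636992‖ ≤ 1 :=
        (Padic.nonarchimedean _ _).trans (max_le (h2.trans (by norm_num)) h3)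
      have h5 : I0 = 2⁻¹ + ((I0 - (2⁻¹ + (997636992 : ℚ_[2]))) + 997636992) := by ring
      have h6 : ‖(2⁻¹ : ℚ_[2])‖ = 2 := by rw [norm_inv, norm_two_q, inv_inv]
      rw [h5, Padic.add_eq_max_of_ne, h6]
      · exact max_eq_left (by linarith)
      · rw [h6]; intro h; linarith
    have n2 : ‖2 * I1‖ ≤ 1 := by
      rw [norm_mul, norm_two_q]; linarith
    rw [Padic.add_eq_max_of_ne, n0]
    · exact max_eq_left (by linarith)
    · rw [n0]; intro h; linarith

theorem two_adic (k : ℕ) : ∃ L : ℚ_[2],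
    Vol (fun x => ((PowerSeries.coeff 3 (fser ((2 ^ k : ℕ) : ℤ) (x : ℚ)) : ℚ) : ℚ_[2])) L ∧
      ‖L‖ = 2 * (2 ^ (k + 3)) ^ 7 * 2 ^ 18 * ((2 : ℝ) ^ (288 * 2 ^ k))⁻¹ := by
  set n : ℕ := 2 ^ k with hn
  set K := k + 3 with hK
  have hN : (2 ^ K : ℕ) = 8 * n := by rw [hK, pow_add, hn]; ring
  have hn0 : 0 < n := by positivity
  choose I0 hI0 _ using fun a => VC_vol (coeff_VC (GG_VC n K a) 3)
  have hI2 : ∀ a, ‖I0 a‖ ≤ 2 := fun a => Vol_norm_le (coeff_VC (GG_VC n K a) 3) (hI0 a)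
  set W : ℕ → ℚ_[2] := fun a => ((ZP n (fun z => (gg K a z : ℚ_[2]))) * 2 ^ (48 * n)) ^ 3 with hW
  have h2K : (2 ^ K : ℚ_[2]) ≠ 0 := pow_ne_zero _ two_ne_zero
  have hball : ∀ a ∈ range (2 ^ K), Vol (fun s => ((PowerSeries.coeff 3 (fser (n : ℤ)
      (((a : ℤ) + (2 ^ K : ℕ) * s : ℤ) : ℚ)) : ℚ) : ℚ_[2])) (((2 ^ K : ℚ_[2]) ^ 3)⁻¹ * W a * I0 a) := by
    intro a _
    convert (hI0 a).const_mul (((2 ^ K : ℚ_[2]) ^ 3)⁻¹ * W a) using 2 with s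
    rw [mul_assoc, ← ball_ident n K a s, inv_mul_cancel_left₀ (pow_ne_zero _ h2K)]
  have hL := Vol_balls (F := fun x : ℤ => ((PowerSeries.coeff 3 (fser (n : ℤ) (x : ℚ)) : ℚ) : ℚ_[2])) K hball
  refine ⟨_, hL, ?_⟩
  have hgne : ∀ a, (gg K a (6 * n) : ℚ_[2]) ≠ 0 := fun a => by
    have := gg_pos K a (6 * n)
    exact_mod_cast this.ne'
  have hWa : ∀ a, W a = (2 ^ (6 * (8 * n - 1) + 48 * n)) ^ 3 * ((gg K a (6 * n) : ℚ_[2]) ^ 3)⁻¹ := by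
    intro a
    have h1 := ZP_gg k a
    rw [← hn, ← hK, hN] at h1
    have h2 : ZP n (fun z => (gg K a z : ℚ_[2])) * gg K a (6 * n) = 2 ^ (6 * (8 * n - 1)) := by
      have h5 : ((ZP n (gg K a) : ℕ) : ℚ_[2]) = ZP n (fun z => (gg K a z : ℚ_[2])) :=
        ZP_map (Nat.castRingHom ℚ_[2]) n (gg K a)
      rw [← h5]
      have h3 := congrArg (fun t : ℕ => (t : ℚ_[2])) h1
      push_cast at h3
      exact h3
    have h4 : ZP n (fun z => (gg K a z : ℚ_[2])) = 2 ^ (6 * (8 * n - 1)) * (gg K a (6 * n) : ℚ_[2])⁻¹ := by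
      rw [← h2, mul_assoc, mul_inv_cancel₀ (hgne a), mul_one]
    simp only [hW, h4, pow_add, mul_pow, inv_pow]
    ring
  set T : ℕ → ℚ_[2] := fun a => ((gg K a (6 * n) : ℚ_[2]) ^ 3)⁻¹ * I0 a with hT
  have hTn : ∀ a, ‖T a‖ = (gg K a (6 * n) : ℝ) ^ 3 * ‖I0 a‖ := by
    intro a
    rw [hT, norm_mul, norm_inv, norm_pow, gg_norm, inv_pow, inv_inv]
  have e1 : (2 ^ K : ℚ_[2])⁻¹ * ∑ a ∈ range (2 ^ K), ((2 ^ K : ℚ_[2]) ^ 3)⁻¹ * W a * I0 a =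
      ((2 ^ K : ℚ_[2]) ^ 4)⁻¹ * (2 ^ (6 * (8 * n - 1) + 48 * n)) ^ 3 * ∑ a ∈ range (2 ^ K), T a := by
    rw [Finset.mul_sum, Finset.mul_sum]
    refine Finset.sum_congr rfl fun a _ => ?_
    rw [hWa]
    simp only [hT]
    field_simp
  have hmem : 6 * n ∈ range (2 ^ K) := by rw [mem_range, hN]; omega
  have hmain : ‖T (6 * n)‖ = (8 * n : ℝ) ^ 3 * 2 := by
    obtain ⟨I, hI, hIn⟩ := main_ball k
    have : I0 (6 * n) = I := (hI0 (6 * n)).unique hI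
    rw [hTn, this, hIn, gg_dvd _ _ _ (by push_cast; simp), hN]
    push_cast
    ring
  have hrest : ‖∑ a ∈ (range (2 ^ K)).erase (6 * n), T a‖ ≤ (8 * n : ℝ) ^ 3 := by
    apply IsUltrametricDist.norm_sum_le_of_forall_le_of_nonneg (by positivity)
    intro a ha
    rw [mem_erase, mem_range, hN] at ha
    obtain ⟨v, hv, hg⟩ := gg_cases K a (6 * n) (by
      rw [hN]
      rintro ⟨c, hc⟩
      push_cast at hc
      have hn' : (0 : ℤ) < n := by exact_mod_cast hn0
      have ha' : (a : ℤ) < 8 * n := by exact_mod_cast ha.2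
      have ha0 : (0 : ℤ) ≤ a := by positivity
      have c1 : c < 1 := by nlinarith
      have c0 : -1 < c := by nlinarith
      have : c = 0 := by omega
      subst this
      apply ha.1
      omega)
    have hle : 2 * gg K a (6 * n) ≤ 8 * n := by
      rw [← hN, hg, ← pow_succ']
      exact Nat.pow_le_pow_right (by norm_num) hv
    have hle' : (2 * gg K a (6 * n) : ℝ) ≤ 8 * n := by exact_mod_cast hle
    rw [hTn]
    have h3 : (2 * gg K a (6 * n) : ℝ) ^ 3 ≤ (8 * n : ℝ) ^ 3 := by gcongr
    have h4 : (0 : ℝ) ≤ (gg K a (6 * n) : ℝ) ^ 3 := by positivity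
    have := hI2 a
    nlinarith
  have hsum : ‖∑ a ∈ range (2 ^ K), T a‖ = (8 * n : ℝ) ^ 3 * 2 := by
    have hpos : (0 : ℝ) < (8 * n : ℝ) ^ 3 := by positivity
    rw [← Finset.add_sum_erase _ _ hmem, Padic.add_eq_max_of_ne, hmain]
    · exact max_eq_left (by linarith)
    · rw [hmain]; intro h; linarith
  rw [e1, norm_mul, hsum, norm_mul, norm_inv, norm_pow _ 4, norm_pow _ 3, norm_two_pow_q, norm_two_pow_q]
  have hNr : (2 : ℝ) ^ K = 8 * n := by exact_mod_cast hN
  have e3 : (2 : ℝ) ^ (288 * n) = ((2 : ℝ) ^ (6 * (8 * n - 1) + 48 * n)) ^ 3 * 2 ^ 18 := by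
    rw [← pow_mul, ← pow_add]
    congr 1
    omega
  rw [e3, hNr, inv_pow, inv_pow, inv_pow, inv_pow, inv_inv, hNr]
  field_simp
end

section
/-- regularized function near the pole `p` -/
noncomputable def Psi {ι : Type*} [DecidableEq ι] (s : Finset ι) (c : ι → ℚ) (σ : ι → ℕ)
    (Nm : Polynomial ℚ) (p : ι) : PowerSeries ℚ :=
  Polynomial.aeval (PowerSeries.C (c p) + PowerSeries.X) Nm *
    ∏ q ∈ s.erase p, ((PowerSeries.C (c p - c q) + PowerSeries.X)⁻¹) ^ σ q

theorem lin_ne {a : ℚ} (h : a ≠ 0) : (PowerSeries.C a + PowerSeries.X : PowerSeries ℚ) *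
    (PowerSeries.C a + PowerSeries.X)⁻¹ = 1 := by
  apply PowerSeries.mul_inv_cancel
  simpa using h

theorem aeval_lin (x a : ℚ) : Polynomial.aeval (PowerSeries.C x + PowerSeries.X : PowerSeries ℚ)
    (Polynomial.X - Polynomial.C a) = PowerSeries.C (x - a) + PowerSeries.X := by
  rw [map_sub, Polynomial.aeval_X, Polynomial.aeval_C, map_sub]
  rw [PowerSeries.algebraMap_eq]
  ring

theorem dvd_of_aeval (c : ℚ) (m : ℕ) (D : Polynomial ℚ)
    (h : (PowerSeries.X : PowerSeries ℚ) ^ m ∣ Polynomial.aeval (PowerSeries.C c + PowerSeries.X) D) :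
    (Polynomial.X - Polynomial.C c) ^ m ∣ D := by
  rw [Polynomial.X_sub_C_pow_dvd_iff, Polynomial.X_pow_dvd_iff]
  have e : Polynomial.aeval (PowerSeries.C c + PowerSeries.X : PowerSeries ℚ) D =
      ((D.comp (Polynomial.X + Polynomial.C c) : Polynomial ℚ) : PowerSeries ℚ) := by
    have : (Polynomial.aeval (PowerSeries.C c + PowerSeries.X : PowerSeries ℚ)).toRingHom =
      (Polynomial.coeToPowerSeries.ringHom).comp (Polynomial.compRingHom (Polynomial.X + Polynomial.C c)) := by
      apply Polynomial.ringHom_ext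
      · intro a
        simp
      · simp [add_comm]
    exact congrArg (fun φ => φ D) this
  rw [e, PowerSeries.X_pow_dvd_iff] at h
  intro d hd
  have := h d hd
  rwa [Polynomial.coeff_coe] at this

theorem PF {ι : Type*} [DecidableEq ι] (s : Finset ι) (c : ι → ℚ) (hc : Set.InjOn c s) (σ : ι → ℕ)
    (Nm : Polynomial ℚ) (hdeg : Nm.degree < (∑ p ∈ s, σ p : ℕ)) :
    Nm = ∑ p ∈ s, ∑ j ∈ range (σ p), Polynomial.C (PowerSeries.coeff j (Psi s c σ Nm p)) *
      ((Polynomial.X - Polynomial.C (c p)) ^ j *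
        ∏ q ∈ s.erase p, (Polynomial.X - Polynomial.C (c q)) ^ σ q) := by
  rw [← sub_eq_zero]
  set Q : ι → Polynomial ℚ := fun p => ∏ q ∈ s.erase p, (Polynomial.X - Polynomial.C (c q)) ^ σ q with hQ
  set D := Nm - ∑ p ∈ s, ∑ j ∈ range (σ p), Polynomial.C (PowerSeries.coeff j (Psi s c σ Nm p)) *
      ((Polynomial.X - Polynomial.C (c p)) ^ j * Q p) with hD
  have hmonic : ∀ p j, ((Polynomial.X - Polynomial.C (c p)) ^ j * Q p).Monic := fun p j =>
    ((Polynomial.monic_X_sub_C _).pow _).mul (Polynomial.monic_prod_of_monic _ _ fun q _ =>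
      (Polynomial.monic_X_sub_C _).pow _)
  have hdegT : D.degree < (∑ p ∈ s, σ p : ℕ) := by
    rw [← Polynomial.mem_degreeLT]
    refine sub_mem (Polynomial.mem_degreeLT.2 hdeg) (sum_mem fun p hp => sum_mem fun j hj => ?_)
    rw [Polynomial.mem_degreeLT]
    refine lt_of_le_of_lt (b := (((Polynomial.X - Polynomial.C (c p)) ^ j * Q p).degree)) ?_ ?_
    · rw [← Polynomial.smul_eq_C_mul]
      exact Polynomial.degree_smul_le _ _
    rw [Polynomial.degree_mul, Polynomial.degree_pow, Polynomial.degree_X_sub_C, hQ,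
      Polynomial.degree_prod]
    simp only [Polynomial.degree_pow, Polynomial.degree_X_sub_C, nsmul_eq_mul, mul_one]
    rw [mem_range] at hj
    rw [← Finset.add_sum_erase s σ hp]
    push_cast
    have : (j : WithBot ℕ) < σ p := by exact_mod_cast hj
    have h2 : (j + (∑ q ∈ s.erase p, σ q : ℕ) : ℕ) < σ p + (∑ q ∈ s.erase p, σ q : ℕ) := by omega
    exact_mod_cast h2
  have hdvd : (∏ p ∈ s, (Polynomial.X - Polynomial.C (c p)) ^ σ p) ∣ D := by
    apply Finset.prod_dvd_of_coprime
    · intro p hp q hq hpq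
      apply IsCoprime.pow
      exact Polynomial.isCoprime_X_sub_C_of_isUnit_sub
        (IsUnit.mk0 _ (sub_ne_zero.2 fun h => hpq (hc hp hq h)))
    · intro p hp
      rw [hD, ← Finset.add_sum_erase _ _ hp, ← sub_sub]
      apply dvd_sub
      · apply dvd_of_aeval
        rw [map_sub, ← Finset.sum_congr rfl (fun j _ => mul_assoc _ _ (Q p)), ← Finset.sum_mul, map_mul]
        set q : PowerSeries ℚ := Polynomial.aeval (PowerSeries.C (c p) + PowerSeries.X : PowerSeries ℚ) (Q p) with hq
        have h1 : Psi s c σ Nm p * q = Polynomial.aeval (PowerSeries.C (c p) + PowerSeries.X : PowerSeries ℚ) Nm := by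
          rw [Psi, hq, hQ, map_prod, mul_assoc, ← Finset.prod_mul_distrib, Finset.prod_eq_one, mul_one]
          intro i hi
          rw [map_pow, aeval_lin, ← mul_pow, mul_comm, lin_ne, one_pow]
          rw [mem_erase] at hi
          exact sub_ne_zero.2 fun h => hi.1 (hc hp hi.2 h).symm
        rw [← h1, ← sub_mul]
        apply Dvd.dvd.mul_right
        rw [PowerSeries.X_pow_dvd_iff]
        intro m hm
        rw [map_sub, map_sum, map_sum]
        have : ∀ j ∈ range (σ p), PowerSeries.coeff m ((Polynomial.aeval (PowerSeries.C (c p) + PowerSeries.X : PowerSeries ℚ))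
            (Polynomial.C (PowerSeries.coeff j (Psi s c σ Nm p)) * (Polynomial.X - Polynomial.C (c p)) ^ j)) =
            if m = j then PowerSeries.coeff j (Psi s c σ Nm p) else 0 := by
          intro j _
          rw [map_mul, map_pow, aeval_lin, sub_self, map_zero, zero_add, Polynomial.aeval_C,
            PowerSeries.algebraMap_eq, PowerSeries.coeff_C_mul, PowerSeries.coeff_X_pow]
          simp
        rw [Finset.sum_congr rfl this, Finset.sum_ite_eq, if_pos (mem_range.2 hm), sub_self]
      · apply Finset.dvd_sum
        intro p' hp'
        apply Finset.dvd_sum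
        intro j _
        apply Dvd.dvd.mul_left
        apply Dvd.dvd.mul_left
        refine Finset.dvd_prod_of_mem (fun q => (Polynomial.X - Polynomial.C (c q)) ^ σ q) ?_
        rw [mem_erase] at hp' ⊢
        exact ⟨hp'.1.symm, hp⟩
  refine Polynomial.eq_zero_of_dvd_of_degree_lt hdvd ?_
  rw [Polynomial.degree_prod]
  simp only [Polynomial.degree_pow, Polynomial.degree_X_sub_C, nsmul_eq_mul, mul_one]
  exact_mod_cast hdegT

theorem PF_sum {ι : Type*} [DecidableEq ι] (s : Finset ι) (c : ι → ℚ) (hc : Set.InjOn c s) (σ : ι → ℕ)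
    (hσ : ∀ p ∈ s, 1 ≤ σ p) (Nm : Polynomial ℚ) (hdeg : Nm.degree < (∑ p ∈ s, σ p - 1 : ℕ)) :
    ∑ p ∈ s, PowerSeries.coeff (σ p - 1) (Psi s c σ Nm p) = 0 := by
  have h := PF s c hc σ Nm (lt_of_lt_of_le hdeg (by exact_mod_cast Nat.sub_le _ _))
  have h1 := congrArg (fun D => Polynomial.coeff D (∑ p ∈ s, σ p - 1)) h
  rw [Polynomial.coeff_eq_zero_of_degree_lt hdeg, Polynomial.finset_sum_coeff] at h1
  rw [h1]
  refine Finset.sum_congr rfl fun p hp => ?_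
  rw [Polynomial.finset_sum_coeff, Finset.sum_eq_single (σ p - 1)]
  · rw [Polynomial.coeff_C_mul]
    have hm : ((Polynomial.X - Polynomial.C (c p)) ^ (σ p - 1) *
        ∏ q ∈ s.erase p, (Polynomial.X - Polynomial.C (c q)) ^ σ q).Monic :=
      ((Polynomial.monic_X_sub_C _).pow _).mul (Polynomial.monic_prod_of_monic _ _ fun q _ =>
      (Polynomial.monic_X_sub_C _).pow _)
    have hd : ((Polynomial.X - Polynomial.C (c p)) ^ (σ p - 1) *
        ∏ q ∈ s.erase p, (Polynomial.X - Polynomial.C (c q)) ^ σ q).natDegree = ∑ p ∈ s, σ p - 1 := by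
      rw [Polynomial.natDegree_mul, Polynomial.natDegree_prod]
      · simp only [Polynomial.natDegree_pow, Polynomial.natDegree_X_sub_C, mul_one]
        rw [← Finset.add_sum_erase s σ hp]
        have := hσ p hp
        omega
      · intro q _; exact pow_ne_zero _ (Polynomial.X_sub_C_ne_zero _)
      · exact pow_ne_zero _ (Polynomial.X_sub_C_ne_zero _)
      · exact Finset.prod_ne_zero_iff.2 fun q _ => pow_ne_zero _ (Polynomial.X_sub_C_ne_zero _)
    have := hm.coeff_natDegree
    rw [hd] at this
    rw [this, mul_one]
  · intro j hj hne
    rw [mem_range] at hj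
    rw [Polynomial.coeff_C_mul, Polynomial.coeff_eq_zero_of_natDegree_lt, mul_zero]
    refine lt_of_le_of_lt Polynomial.natDegree_mul_le ?_
    rw [Polynomial.natDegree_prod]
    · simp only [Polynomial.natDegree_pow, Polynomial.natDegree_X_sub_C, mul_one]
      rw [← Finset.add_sum_erase s σ hp]
      omega
    · intro q _; exact pow_ne_zero _ (Polynomial.X_sub_C_ne_zero _)
  · intro h
    have := hσ p hp
    simp at h
    omega

/-- the expansion of the rational function at a regular point. -/
theorem PF_eval {ι : Type*} [DecidableEq ι] (s : Finset ι) (c : ι → ℚ) (hc : Set.InjOn c s) (σ : ι → ℕ)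
    (Nm : Polynomial ℚ) (hdeg : Nm.degree < (∑ p ∈ s, σ p : ℕ)) (x : ℚ) (hx : ∀ p ∈ s, x - c p ≠ 0) :
    Polynomial.aeval (PowerSeries.C x + PowerSeries.X : PowerSeries ℚ) Nm *
      ∏ p ∈ s, ((PowerSeries.C (x - c p) + PowerSeries.X)⁻¹) ^ σ p =
    ∑ p ∈ s, ∑ j ∈ range (σ p), PowerSeries.C (PowerSeries.coeff j (Psi s c σ Nm p)) *
      ((PowerSeries.C (x - c p) + PowerSeries.X)⁻¹) ^ (σ p - j) := by
  conv_lhs => rw [PF s c hc σ Nm hdeg]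
  rw [map_sum, Finset.sum_mul]
  refine Finset.sum_congr rfl fun p hp => ?_
  rw [map_sum, Finset.sum_mul]
  refine Finset.sum_congr rfl fun j hj => ?_
  rw [mem_range] at hj
  rw [map_mul, map_mul, map_prod, Polynomial.aeval_C, PowerSeries.algebraMap_eq, map_pow, aeval_lin,
    mul_assoc]
  congr 1
  simp only [map_pow, aeval_lin]
  rw [← Finset.mul_prod_erase s _ hp]
  have h1 : (∏ q ∈ s.erase p, (PowerSeries.C (x - c q) + PowerSeries.X : PowerSeries ℚ) ^ σ q) *
      ∏ q ∈ s.erase p, ((PowerSeries.C (x - c q) + PowerSeries.X : PowerSeries ℚ)⁻¹) ^ σ q = 1 := by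
    rw [← Finset.prod_mul_distrib, Finset.prod_eq_one]
    intro i hi
    rw [← mul_pow, lin_ne, one_pow]
    exact hx i (mem_of_mem_erase hi)
  have h2 : (PowerSeries.C (x - c p) + PowerSeries.X : PowerSeries ℚ) ^ j *
      ((PowerSeries.C (x - c p) + PowerSeries.X : PowerSeries ℚ)⁻¹) ^ j = 1 := by
    rw [← mul_pow, lin_ne (hx p hp), one_pow]
  have h3 : ((PowerSeries.C (x - c p) + PowerSeries.X : PowerSeries ℚ)⁻¹) ^ σ p =
    ((PowerSeries.C (x - c p) + PowerSeries.X : PowerSeries ℚ)⁻¹) ^ j *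
    ((PowerSeries.C (x - c p) + PowerSeries.X : PowerSeries ℚ)⁻¹) ^ (σ p - j) := by
    rw [← pow_add]; congr 1; omega
  rw [h3]
  linear_combination ((PowerSeries.C (x - c p) + PowerSeries.X : PowerSeries ℚ) ^ j *
      ((PowerSeries.C (x - c p) + PowerSeries.X : PowerSeries ℚ)⁻¹) ^ j *
      ((PowerSeries.C (x - c p) + PowerSeries.X : PowerSeries ℚ)⁻¹) ^ (σ p - j)) * h1 +
      ((PowerSeries.C (x - c p) + PowerSeries.X : PowerSeries ℚ)⁻¹) ^ (σ p - j) * h2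

theorem coeff3_inv_pow (y : ℚ) (hy : y ≠ 0) (i : ℕ) (hi : 1 ≤ i) :
    PowerSeries.coeff 3 (((PowerSeries.C y + PowerSeries.X : PowerSeries ℚ)⁻¹) ^ i) =
      -((i + 2).choose 3 : ℚ) * (y⁻¹) ^ (i + 3) := by
  obtain ⟨d, rfl⟩ := Nat.exists_eq_add_of_le' hi
  have h1 := PowerSeries.mk_one_pow_eq_mk_choose_add (S := ℚ) d
  have h2 : (PowerSeries.C y + PowerSeries.X : PowerSeries ℚ)⁻¹ =
      PowerSeries.C y⁻¹ * PowerSeries.rescale (-y⁻¹) (PowerSeries.mk 1) := by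
    have e : (PowerSeries.C y + PowerSeries.X : PowerSeries ℚ) * (PowerSeries.C y⁻¹ * PowerSeries.rescale (-y⁻¹) (PowerSeries.mk 1)) = 1 := by
      have e1 := PowerSeries.mk_one_mul_one_sub_eq_one ℚ
      have e2 := congrArg (PowerSeries.rescale (-y⁻¹)) e1
      rw [map_mul, map_sub, map_one, PowerSeries.rescale_X] at e2
      have e3 : (PowerSeries.C y + PowerSeries.X : PowerSeries ℚ) * PowerSeries.C y⁻¹ = 1 - PowerSeries.C (-y⁻¹) * PowerSeries.X := by
        rw [add_mul, ← map_mul, mul_inv_cancel₀ hy, map_one, map_neg]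
        ring
      rw [← mul_assoc, e3, mul_comm]
      exact e2
    have := lin_ne hy
    calc (PowerSeries.C y + PowerSeries.X : PowerSeries ℚ)⁻¹ = (PowerSeries.C y + PowerSeries.X : PowerSeries ℚ)⁻¹ *
      ((PowerSeries.C y + PowerSeries.X : PowerSeries ℚ) * (PowerSeries.C y⁻¹ * PowerSeries.rescale (-y⁻¹) (PowerSeries.mk 1))) := by rw [e, mul_one]
      _ = _ := by rw [← mul_assoc, mul_comm (_)⁻¹, this, one_mul]
  rw [h2, mul_pow, ← map_pow, ← map_pow, PowerSeries.coeff_C_mul, PowerSeries.coeff_rescale]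
  rw [show (PowerSeries.mk 1 : PowerSeries ℚ) ^ (d + 1) = _ from h1, PowerSeries.coeff_mk]
  have : (d + 1 + 2).choose 3 = (d + 3).choose d := by
    rw [show d + 1 + 2 = d + 3 by ring, ← Nat.choose_symm (show d ≤ d + 3 by omega)]
    congr 1
    omega
  rw [this]
  ring
end

section
/-- the set of poles -/
noncomputable def Pol (n : ℤ) : Finset ℤ := Ico (-11 * n) (11 * n)

/-- multiplicity of a pole in the brick -/
noncomputable def tau (n p : ℤ) : ℕ := (if p ∈ Ico (-5 * n) (5 * n) then 1 else 0) +
  (if p ∈ Ico (-8 * n) (8 * n) then 1 else 0) + (if p ∈ Ico (-11 * n) (11 * n) then 1 else 0)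

theorem prod_sub_ite {A : Type*} [CommMonoid A] (s t : Finset ℤ) (hst : s ⊆ t) (f : ℤ → A) :
    ∏ p ∈ s, f p = ∏ p ∈ t, f p ^ (if p ∈ s then 1 else 0) := by
  have : ∀ p ∈ t, f p ^ (if p ∈ s then 1 else 0) = if p ∈ s then f p else 1 := by
    intro p _
    split_ifs <;> simp
  rw [Finset.prod_congr rfl this, Finset.prod_ite_mem, Finset.inter_eq_right.2 hst]

theorem PP_eq {A : Type*} [CommMonoid A] (n : ℕ) (f : ℤ → A) :
    PP n f = ∏ p ∈ Pol n, f p ^ tau n p := by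
  simp only [tau, pow_add, Finset.prod_mul_distrib, PP, Pol]
  rw [← prod_sub_ite, ← prod_sub_ite, ← prod_sub_ite]
  · exact Finset.Subset.refl _
  · apply Finset.Ico_subset_Ico <;> omega
  · apply Finset.Ico_subset_Ico <;> omega

/-- the numerator polynomial -/
noncomputable def Nm (n : ℤ) : Polynomial ℚ := (ZP n fun z => Polynomial.X - Polynomial.C (z : ℚ)) ^ 3

theorem Nm_aeval (n : ℤ) (x : ℚ) : Polynomial.aeval (PowerSeries.C x + PowerSeries.X : PowerSeries ℚ) (Nm n) =
    (ZP n fun z => (PowerSeries.C (x - z) + PowerSeries.X : PowerSeries ℚ)) ^ 3 := by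
  rw [Nm, map_pow, ZP_map]
  simp only [aeval_lin]

theorem Nm_deg (n : ℕ) (hn : 1 ≤ n) : (Nm n).natDegree = 144 * n - 3 := by
  have h1 : ∀ s : Finset ℤ, (∏ z ∈ s, (Polynomial.X - Polynomial.C (z : ℚ))).natDegree = #s := by
    intro s
    rw [Polynomial.natDegree_prod _ _ fun z _ => Polynomial.X_sub_C_ne_zero _]
    simp only [Polynomial.natDegree_X_sub_C, Finset.sum_const, smul_eq_mul, mul_one]
  have h2 : ∀ s : Finset ℤ, (∏ z ∈ s, (Polynomial.X - Polynomial.C (z : ℚ))) ≠ 0 := fun s =>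
    Finset.prod_ne_zero_iff.2 fun z _ => Polynomial.X_sub_C_ne_zero _
  rw [Nm, Polynomial.natDegree_pow, ZP, Polynomial.natDegree_mul (mul_ne_zero (pow_ne_zero _ (h2 _)) (h2 _)) (h2 _),
    Polynomial.natDegree_mul (pow_ne_zero _ (h2 _)) (h2 _), Polynomial.natDegree_pow, h1, h1, h1]
  simp only [Int.card_Ioc, Int.card_Ioo]
  omega

theorem tau_sum (n : ℕ) : ∑ p ∈ Pol n, 3 * tau n p = 144 * n := by
  have := PP_eq n (fun _ => Multiplicative.ofAdd (3 : ℕ))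
  rw [PP_const] at this
  have h2 := congrArg Multiplicative.toAdd this
  rw [toAdd_prod] at h2
  simp only [toAdd_pow, toAdd_ofAdd, smul_eq_mul] at h2
  rw [Finset.sum_congr rfl fun p _ => mul_comm 3 (tau n p), ← h2]
  ring

theorem tau_pos (n p : ℤ) (hp : p ∈ Pol n) : 1 ≤ tau n p := by
  rw [Pol] at hp
  rw [tau, if_pos hp]
  omega

theorem tau_le (n p : ℤ) : tau n p ≤ 3 := by
  unfold tau
  split_ifs <;> simp

/-- partial fraction coefficients -/
noncomputable def bb (n p : ℤ) (j : ℕ) : ℚ :=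
  PowerSeries.coeff j (Psi (Pol n) (fun p => (p : ℚ) + 1 / 2) (fun p => 3 * tau n p) (Nm n) p)

/-- the rational linear form -/
noncomputable def lf (h : ℕ → ℚ) (n : ℤ) : ℚ :=
  ∑ p ∈ Pol n, ∑ j ∈ range (3 * tau n p), bb n p j *
    (-((3 * tau n p - j + 2).choose 3 : ℚ) * (h (3 * tau n p - j + 3) + rr (3 * tau n p - j + 3) p))

theorem half_inj (s : Finset ℤ) : Set.InjOn (fun p : ℤ => (p : ℚ) + 1 / 2) s := by
  intro a _ b _ hab
  simpa using hab

theorem coeff_fser (n : ℕ) (hn : 1 ≤ n) (x : ℤ) : PowerSeries.coeff 3 (fser n (x : ℚ)) =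
    ∑ p ∈ Pol n, ∑ j ∈ range (3 * tau n p), bb n p j *
      (-((3 * tau n p - j + 2).choose 3 : ℚ) * (((x : ℚ) - (p + 1 / 2))⁻¹) ^ (3 * tau n p - j + 3)) := by
  have hd : (Nm n).degree < (∑ p ∈ Pol n, 3 * tau n p : ℕ) := by
    rw [tau_sum]
    refine lt_of_le_of_lt Polynomial.degree_le_natDegree ?_
    rw [Nm_deg n hn]
    exact_mod_cast (by omega : 144 * n - 3 < 144 * n)
  have h1 := PF_eval (Pol n) (fun p => (p : ℚ) + 1 / 2) (half_inj _) (fun p => 3 * tau n p) (Nm n) hd x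
    (fun p _ => half_ne x p)
  have h2 : fser n (x : ℚ) = Polynomial.aeval (PowerSeries.C (x : ℚ) + PowerSeries.X : PowerSeries ℚ) (Nm n) *
      ∏ p ∈ Pol n, ((PowerSeries.C ((x : ℚ) - ((p : ℚ) + 1 / 2)) + PowerSeries.X)⁻¹) ^ (3 * tau n p) := by
    rw [fser, mul_pow, Nm_aeval, PP_eq, ← Finset.prod_pow]
    simp only [← pow_mul, mul_comm]
  rw [h2, h1, map_sum]
  refine Finset.sum_congr rfl fun p hp => ?_
  rw [map_sum]
  refine Finset.sum_congr rfl fun j hj => ?_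
  rw [mem_range] at hj
  rw [PowerSeries.coeff_C_mul, coeff3_inv_pow _ (half_ne x p) _ (by omega)]
  rfl

theorem lf_eq (H : ℕ → ℚ_[2]) (h : ℕ → ℚ)
    (hH : ∀ m, Vol (fun x => (((x : ℚ_[2]) + 1 / 2)⁻¹) ^ m) (H m)) (h4 : h 4 = 0)
    (hh : ∀ m, 5 ≤ m → m ≤ 12 → H m = h m) (n : ℕ) (hn : 1 ≤ n) (L : ℚ_[2])
    (hL : Vol (fun x => ((PowerSeries.coeff 3 (fser n (x : ℚ)) : ℚ) : ℚ_[2])) L) : L = (lf h n : ℚ) := by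
  have h1 : Vol (fun x => ((PowerSeries.coeff 3 (fser n (x : ℚ)) : ℚ) : ℚ_[2]))
      (∑ p ∈ Pol n, ∑ j ∈ range (3 * tau n p), (bb n p j : ℚ_[2]) *
      (-((3 * tau n p - j + 2).choose 3 : ℚ_[2]) *
        (H (3 * tau n p - j + 3) + (rr (3 * tau n p - j + 3) p : ℚ)))) := by
    have : (fun x : ℤ => ((PowerSeries.coeff 3 (fser n (x : ℚ)) : ℚ) : ℚ_[2])) = fun x : ℤ =>
      ∑ p ∈ Pol n, ∑ j ∈ range (3 * tau n p), (bb n p j : ℚ_[2]) *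
      (-((3 * tau n p - j + 2).choose 3 : ℚ_[2]) *
        (((x : ℚ_[2]) - ((p : ℚ_[2]) + 1 / 2))⁻¹) ^ (3 * tau n p - j + 3)) := by
      funext x
      rw [coeff_fser n hn]
      push_cast
      rfl
    rw [this]
    refine Vol.sum _ fun p hp => Vol.sum _ fun j hj => Vol.const_mul _ (Vol.const_mul _ (pole_vol (hH _) p))
  rw [hL.unique h1]
  have h5 : ∀ p ∈ Pol n, ∑ j ∈ range (3 * tau n p), (bb n p j : ℚ_[2]) *
      (-((3 * tau n p - j + 2).choose 3 : ℚ_[2]) *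
        (H (3 * tau n p - j + 3) + (rr (3 * tau n p - j + 3) p : ℚ))) =
      ((∑ j ∈ range (3 * tau n p), bb n p j *
    (-((3 * tau n p - j + 2).choose 3 : ℚ) * (h (3 * tau n p - j + 3) + rr (3 * tau n p - j + 3) p)) : ℚ) : ℚ_[2]) +
      (-H 4) * ((bb n p (3 * tau n p - 1) : ℚ) : ℚ_[2]) := by
    intro p hp
    have ht := tau_pos n p hp
    have ht3 := tau_le n p
    obtain ⟨s, hs⟩ : ∃ s, 3 * tau n p = s + 1 := ⟨3 * tau n p - 1, by omega⟩
    rw [hs, Finset.sum_range_succ, Finset.sum_range_succ]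
    push_cast
    have e : s + 1 - s = 1 := by omega
    rw [e]
    have e3 : ∑ x ∈ range s, (bb n p x : ℚ_[2]) * (-((s + 1 - x + 2).choose 3 : ℚ_[2]) * (H (s + 1 - x + 3) + (rr (s + 1 - x + 3) p : ℚ))) =
      ∑ x ∈ range s, (bb n p x : ℚ_[2]) * (-((s + 1 - x + 2).choose 3 : ℚ_[2]) * ((h (s + 1 - x + 3) : ℚ_[2]) + (rr (s + 1 - x + 3) p : ℚ))) := by
      refine Finset.sum_congr rfl fun j hj => ?_
      rw [mem_range] at hj
      rw [hh _ (by omega) (by omega)]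
    rw [e3]
    norm_num [h4]
    ring
  rw [Finset.sum_congr rfl h5, Finset.sum_add_distrib, ← Finset.mul_sum]
  have h6 := PF_sum (Pol n) (fun p => (p : ℚ) + 1 / 2) (half_inj _) (fun p => 3 * tau n p)
    (fun p hp => by have := tau_pos n p hp; omega) (Nm n) (by
    rw [tau_sum]
    refine lt_of_le_of_lt Polynomial.degree_le_natDegree ?_
    rw [Nm_deg n hn]
    exact_mod_cast (by omega : 144 * n - 3 < 144 * n - 1))
  have h7 : ∑ p ∈ Pol n, ((bb n p (3 * tau n p - 1) : ℚ) : ℚ_[2]) = 0 := by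
    have : ∑ p ∈ Pol n, bb n p (3 * tau n p - 1) = 0 := h6
    exact_mod_cast congrArg (fun q : ℚ => (q : ℚ_[2])) this
  rw [h7, mul_zero, add_zero, lf]
  push_cast
  rfl
end

section
theorem count_bd (a b v q : ℤ) (hab : a < b) (hq : 0 < q) :
    q * (#{x ∈ Ico a b | q ∣ x - v} : ℤ) ≤ b - a - 1 + q ∧
      b - a - q + 1 ≤ q * (#{x ∈ Ico a b | q ∣ x - v} : ℤ) := by
  have h1 : #{x ∈ Ico a b | q ∣ x - v} = #{x ∈ Ico a b | x ≡ v [ZMOD q]} := by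
    congr 1
    ext x
    simp only [mem_filter]
    rw [Int.modEq_comm, Int.modEq_iff_dvd]
  rw [h1, Int.Ico_filter_modEq_card _ _ hq]
  have hq' : (0 : ℚ) < q := by exact_mod_cast hq
  set A := ⌈((b - v : ℚ)) / q⌉ with hA
  set B := ⌈((a - v : ℚ)) / q⌉ with hB
  have a1 : ((b - v : ℚ)) ≤ q * A := by
    have := Int.le_ceil (((b - v : ℚ)) / q)
    rw [div_le_iff₀ hq'] at this; linarith
  have a2 : q * (A : ℚ) < b - v + q := by
    have := Int.ceil_lt_add_one (((b - v : ℚ)) / q)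
    rw [← sub_lt_iff_lt_add, lt_div_iff₀ hq'] at this; linarith
  have b1 : ((a - v : ℚ)) ≤ q * B := by
    have := Int.le_ceil (((a - v : ℚ)) / q)
    rw [div_le_iff₀ hq'] at this; linarith
  have b2 : q * (B : ℚ) < a - v + q := by
    have := Int.ceil_lt_add_one (((a - v : ℚ)) / q)
    rw [← sub_lt_iff_lt_add, lt_div_iff₀ hq'] at this; linarith
  have a1' : b - v ≤ q * A := by exact_mod_cast a1
  have a2' : q * A < b - v + q := by exact_mod_cast a2
  have b1' : a - v ≤ q * B := by exact_mod_cast b1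
  have b2' : q * B < a - v + q := by exact_mod_cast b2
  rcases max_cases (A - B) 0 with ⟨h, h'⟩ | ⟨h, h'⟩
  · rw [h, mul_sub]
    constructor <;> linarith
  · rw [h]
    have : q * (A - B) ≤ 0 := mul_nonpos_of_nonneg_of_nonpos hq.le h'.le
    have h3 : q * (A - B) ≤ - q := by nlinarith
    constructor <;> nlinarith

/-- weight of a zero -/
noncomputable def ww (n q z : ℤ) : ℤ :=
  (if 2 * z + q < 10 * n ∧ -2 * z + q < 10 * n then 1 else 0) +
  (if 2 * z + q < 16 * n ∧ -2 * z + q < 16 * n then 1 else 0) +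
  (if 2 * z + q < 22 * n ∧ -2 * z + q < 22 * n then 1 else 0) -
  2 * (if -4 * n < z ∧ z ≤ 4 * n then 1 else 0) -
  (if -10 * n < z ∧ z < 6 * n then 1 else 0) - (if -6 * n < z ∧ z ≤ 10 * n then 1 else 0)

theorem interlace (n q h p b : ℤ) (hn : 1 ≤ n) (hq : 3 ≤ q) (hh : q = 2 * h + 1) (hb : b ≤ 11) :
    (#{x ∈ Ico (-b * n) (b * n) | q ∣ x - p} : ℤ) ≤ 1 +
      ∑ z ∈ Icc (-11 * n) (11 * n) with q ∣ z - (p - h),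
        (if 2 * z + q < 2 * b * n ∧ -2 * z + q < 2 * b * n then (1:ℤ) else 0) := by
  have h1 : #{x ∈ Ico (-b * n) (b * n) | q ∣ x - p} ≤
      #{x ∈ Ico (-b * n) (b * n) | q ∣ x - p ∧ x < -b * n + q} +
      #{x ∈ Ico (-b * n) (b * n) | q ∣ x - p ∧ ¬ x < -b * n + q} := by
    rw [← Finset.filter_filter, ← Finset.filter_filter, Finset.card_filter_add_card_filter_not]
  have h2 : #{x ∈ Ico (-b * n) (b * n) | q ∣ x - p ∧ x < -b * n + q} ≤ 1 := by
    rw [Finset.card_le_one]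
    intro x hx y hy
    simp only [mem_filter, mem_Ico] at hx hy
    have : q ∣ x - y := by
      have := dvd_sub hx.2.1 hy.2.1
      simpa using this
    have h3 := Int.eq_zero_of_abs_lt_dvd this (by rw [abs_lt]; constructor <;> linarith [hx.1.1, hy.1.1, hx.2.2, hy.2.2])
    linarith
  have h3 : #{x ∈ Ico (-b * n) (b * n) | q ∣ x - p ∧ ¬ x < -b * n + q} ≤
      #{z ∈ Icc (-11 * n) (11 * n) | q ∣ z - (p - h) ∧ (2 * z + q < 2 * b * n ∧ -2 * z + q < 2 * b * n)} := by
    apply Finset.card_le_card_of_injOn (fun x => x - h)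
    · intro x hx
      simp only [coe_filter, Set.mem_ofPred_eq, mem_Ico, mem_Icc] at hx ⊢
      have hbn : b * n ≤ 11 * n := by nlinarith
      have e : 2 * b * n = 2 * (b * n) := by ring
      have e2 : -b * n = -(b * n) := by ring
      rw [e]
      rw [e2] at hx
      refine ⟨⟨by linarith, by linarith⟩, ?_, by linarith, by linarith⟩
      have : x - h - (p - h) = x - p := by ring
      rw [this]; exact hx.2.1
    · intro x _ y _ hxy
      simpa using hxy
  rw [← Finset.sum_filter, Finset.filter_filter]
  simp only [Finset.sum_const, mul_one, nsmul_eq_mul]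
  have : (#{z ∈ Icc (-11 * n) (11 * n) | q ∣ z - (p - h) ∧ (2 * z + q < 2 * b * n ∧ -2 * z + q < 2 * b * n)} : ℤ) =
    ((#{z ∈ Icc (-11 * n) (11 * n) | q ∣ z - (p - h) ∧ (2 * z + q < 2 * b * n ∧ -2 * z + q < 2 * b * n)} : ℕ) : ℤ) := rfl
  zify at h1 h2 h3
  linarith

theorem zcount (n q p h : ℤ) (hh : q = 2 * h + 1) (s : Finset ℤ) (P : ℤ → Prop) [DecidablePred P]
    (hs : ∀ z, z ∈ s ↔ P z) (hsub : s ⊆ Icc (-11 * n) (11 * n)) :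
    (#{z ∈ s | q ∣ 2 * p + 1 - 2 * z} : ℤ) = ∑ z ∈ Icc (-11 * n) (11 * n) with q ∣ z - (p - h),
        (if P z then (1:ℤ) else 0) := by
  rw [← Finset.sum_filter, Finset.filter_filter]
  simp only [Finset.sum_const, mul_one, nsmul_eq_mul]
  congr 2
  ext z
  simp only [mem_filter]
  have : q ∣ 2 * p + 1 - 2 * z ↔ q ∣ z - (p - h) := by
    have e : 2 * p + 1 - 2 * z = q - 2 * (z - (p - h)) := by rw [hh]; ring
    rw [e, dvd_sub_right (dvd_refl q)]
    constructor
    · intro h1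
      have hc : IsCoprime q 2 := ⟨1, -h, by rw [hh]; ring⟩
      exact hc.dvd_of_dvd_mul_left h1
    · intro h1; exact Dvd.dvd.mul_left h1 2
  rw [this, hs]
  constructor
  · rintro ⟨h1, h2⟩; exact ⟨hsub ((hs z).2 h1), h2, h1⟩
  · rintro ⟨h1, h2, h3⟩; exact ⟨h3, h2⟩
end

section
theorem sum_le_part (S A : Finset ℤ) (f : ℤ → ℤ) (hA : A ⊆ S) (h : ∀ z ∈ S, z ∉ A → f z ≤ 0) :
    ∑ z ∈ S, f z ≤ ∑ z ∈ A, f z := by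
  rw [← Finset.sum_sdiff hA]
  have : ∑ z ∈ S \ A, f z ≤ 0 := Finset.sum_nonpos fun z hz => by
    rw [Finset.mem_sdiff] at hz
    exact h z hz.1 hz.2
  linarith

theorem ww_sum (n q h p : ℤ) (hn : 1 ≤ n) (hq : 3 ≤ q) (hh : q = 2 * h + 1) :
    (#{x ∈ Ico (-5 * n) (5 * n) | q ∣ x - p} : ℤ) + #{x ∈ Ico (-8 * n) (8 * n) | q ∣ x - p} +
      #{x ∈ Ico (-11 * n) (11 * n) | q ∣ x - p} -
      (2 * (#{z ∈ Ioc (-4 * n) (4 * n) | q ∣ 2 * p + 1 - 2 * z} : ℤ) +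
        #{z ∈ Ioo (-10 * n) (6 * n) | q ∣ 2 * p + 1 - 2 * z} +
        #{z ∈ Ioc (-6 * n) (10 * n) | q ∣ 2 * p + 1 - 2 * z}) ≤
    3 + ∑ z ∈ Icc (-11 * n) (11 * n) with q ∣ z - (p - h), ww n q z ∧
    ((#{x ∈ Ico (-5 * n) (5 * n) | q ∣ x - p} : ℤ) = 0 → 
    (#{x ∈ Ico (-5 * n) (5 * n) | q ∣ x - p} : ℤ) + #{x ∈ Ico (-8 * n) (8 * n) | q ∣ x - p} +
      #{x ∈ Ico (-11 * n) (11 * n) | q ∣ x - p} -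
      (2 * (#{z ∈ Ioc (-4 * n) (4 * n) | q ∣ 2 * p + 1 - 2 * z} : ℤ) +
        #{z ∈ Ioo (-10 * n) (6 * n) | q ∣ 2 * p + 1 - 2 * z} +
        #{z ∈ Ioc (-6 * n) (10 * n) | q ∣ 2 * p + 1 - 2 * z}) ≤
    2 + ∑ z ∈ Icc (-11 * n) (11 * n) with q ∣ z - (p - h), ww n q z) := by
  have h5 := interlace n q h p 5 hn hq hh (by norm_num)
  have h8 := interlace n q h p 8 hn hq hh (by norm_num)
  have h11 := interlace n q h p 11 hn hq hh (by norm_num)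
  norm_num at h5 h8 h11
  have z4 := zcount n q p h hh (Ioc (-4 * n) (4 * n)) (fun z => -4 * n < z ∧ z ≤ 4 * n) (fun z => mem_Ioc)
    (by intro z hz; rw [mem_Ioc] at hz; rw [mem_Icc]; constructor <;> linarith)
  have z6 := zcount n q p h hh (Ioo (-10 * n) (6 * n)) (fun z => -10 * n < z ∧ z < 6 * n) (fun z => mem_Ioo)
    (by intro z hz; rw [mem_Ioo] at hz; rw [mem_Icc]; constructor <;> linarith)
  have z10 := zcount n q p h hh (Ioc (-6 * n) (10 * n)) (fun z => -6 * n < z ∧ z ≤ 10 * n) (fun z => mem_Ioc)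
    (by intro z hz; rw [mem_Ioc] at hz; rw [mem_Icc]; constructor <;> linarith)
  have hn5 : 0 ≤ ∑ z ∈ Icc (-11 * n) (11 * n) with q ∣ z - (p - h),
    (if 2 * z + q < 10 * n ∧ -2 * z + q < 10 * n then (1:ℤ) else 0) := Finset.sum_nonneg fun z _ => by split_ifs <;> norm_num
  simp only [ww, Finset.sum_sub_distrib, Finset.sum_add_distrib, ← Finset.mul_sum]
  rw [z4, z6, z10]
  norm_num at hn5 ⊢
  constructor
  · linarith
  · intro h0
    rw [Finset.filter_eq_empty_iff.2 (fun x hx => h0 (Finset.mem_Ico.1 hx).1 (Finset.mem_Ico.1 hx).2), Finset.card_empty]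
    push_cast
    linarith

theorem ww_a (n q z : ℤ) (hn : 1 ≤ n) (h4 : 4 * n ≤ q) : ww n q z ≤ 0 := by
  unfold ww
  split_ifs <;> omega

theorem ww_b (n q z : ℤ) (hn : 1 ≤ n) (c2 : 2 * n < q) (c4 : q < 4 * n) :
    ww n q z ≤ 0 ∨ (ww n q z ≤ 1 ∧ 6 * n ≤ z ∧ 2 * z + q < 16 * n) ∨
        (ww n q z ≤ 1 ∧ z ≤ -6 * n ∧ -2 * z + q < 16 * n) := by
  unfold ww
  split_ifs <;> omega

theorem ww_c (n q z : ℤ) (hn : 1 ≤ n) (h1 : -4 * n < z) (h2 : z < 4 * n) : ww n q z ≤ -1 := by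
  unfold ww
  split_ifs <;> omega

theorem ww_d (n q z : ℤ) (hn : 1 ≤ n) (h1 : -4 * n < z) (h2 : z < 4 * n)
    (r10 : ¬ (2 * z + q < 10 * n ∧ -2 * z + q < 10 * n)) : ww n q z ≤ -2 := by
  unfold ww
  split_ifs <;> omega

theorem ww_e (n q z r : ℤ) (hn : 1 ≤ n) (c7 : ¬ 3 * q ≤ 22 * n) (h2 : r < 4 * n) (h0 : 0 ≤ r)
    (r10 : 2 * r + q < 10 * n) (hz : z = q + r ∨ z = - q - r) : ww n q z ≤ -1 := by
  unfold ww
  split_ifs <;> omega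

theorem ww_f (n q z r : ℤ) (hn : 1 ≤ n) (c7 : ¬ 3 * q ≤ 22 * n) (c14 : q < 14 * n) (h2 : 4 * n ≤ r)
    (r10 : 2 * r < q) (hz : z = q - r ∨ z = r - q ∨ z = r ∨ z = -r) : ww n q z ≤ -1 := by
  unfold ww
  split_ifs <;> omega

theorem ww_g (n q z : ℤ) (hn : 1 ≤ n) (c14 : 14 * n < q) (hz1 : 2 * z + q < 22 * n) (hz2 : -2 * z + q < 22 * n) :
    ww n q z ≤ -2 ∧ (¬ (2 * z + q < 16 * n ∧ -2 * z + q < 16 * n) → ww n q z ≤ -3) := by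
  unfold ww
  constructor
  · split_ifs <;> omega
  · intro
    split_ifs <;> omega

set_option maxHeartbeats 4000000 in
theorem LI (n q h p p' : ℤ) (hn : 1 ≤ n) (hq : 3 ≤ q) (hh : q = 2 * h + 1) (hp : -11 * n ≤ p) (hp2 : p < 11 * n)
    (hp' : -11 * n ≤ p') (hp2' : p' < 11 * n) (hne : p' ≠ p) (hd : q ∣ p' - p) :
    3 * ((#{x ∈ Ico (-5 * n) (5 * n) | q ∣ x - p} : ℤ) + #{x ∈ Ico (-8 * n) (8 * n) | q ∣ x - p} +
      #{x ∈ Ico (-11 * n) (11 * n) | q ∣ x - p}) + 4 ≤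
      3 * (2 * (#{z ∈ Ioc (-4 * n) (4 * n) | q ∣ 2 * p + 1 - 2 * z} : ℤ) +
        #{z ∈ Ioo (-10 * n) (6 * n) | q ∣ 2 * p + 1 - 2 * z} +
        #{z ∈ Ioc (-6 * n) (10 * n) | q ∣ 2 * p + 1 - 2 * z}) +
      (12 * (if q ≤ 2 * n then 1 else 0) + 3 * (if 3 * q ≤ 22 * n then 1 else 0) +
        3 * (if q ≤ 14 * n then 1 else 0) + 3 * (if q ≤ 16 * n then 1 else 0) + (if q ≤ 22 * n then 1 else 0)) := by
  obtain ⟨hw, hw5⟩ := ww_sum n q h p hn hq hh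
  set P5 : ℤ := (#{x ∈ Ico (-5 * n) (5 * n) | q ∣ x - p} : ℤ) with hP5
  set P8 : ℤ := (#{x ∈ Ico (-8 * n) (8 * n) | q ∣ x - p} : ℤ) with hP8
  set P11 : ℤ := (#{x ∈ Ico (-11 * n) (11 * n) | q ∣ x - p} : ℤ) with hP11
  set Z4 : ℤ := (#{z ∈ Ioc (-4 * n) (4 * n) | q ∣ 2 * p + 1 - 2 * z} : ℤ) with hZ4
  set Z6 : ℤ := (#{z ∈ Ioo (-10 * n) (6 * n) | q ∣ 2 * p + 1 - 2 * z} : ℤ) with hZ6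
  set Z10 : ℤ := (#{z ∈ Ioc (-6 * n) (10 * n) | q ∣ 2 * p + 1 - 2 * z} : ℤ) with hZ10
  set S := {z ∈ Icc (-11 * n) (11 * n) | q ∣ z - (p - h)} with hS
  set Sw := ∑ z ∈ S, ww n q z with hSw
  have memS : ∀ z k : ℤ, z = p - h + q * k → -11 * n ≤ z → z ≤ 11 * n → z ∈ S := by
    intro z k hz h1 h2
    rw [hS, mem_filter, mem_Icc]
    exact ⟨⟨h1, h2⟩, k, by rw [hz]; ring⟩
  have hq0 : 0 < q := by omega
  -- the class element nearest to zero
  obtain ⟨ζ, k0, hζ, hζ1, hζ2⟩ : ∃ ζ k0 : ℤ, ζ = p - h + q * k0 ∧ -q < 2 * ζ ∧ 2 * ζ < q := by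
    refine ⟨(p - h + h) % q - h, - ((p - h + h) / q), ?_, ?_, ?_⟩
    · have := Int.emod_add_mul_ediv (p - h + h) q
      linarith
    · have := Int.emod_nonneg (p - h + h) hq0.ne'
      omega
    · have := Int.emod_lt_of_pos (p - h + h) hq0
      omega
  have hq22 : q < 22 * n := by
    rcases lt_or_gt_of_ne hne with h1 | h1
    · have := Int.le_of_dvd (by omega) ((dvd_neg.2 hd)); omega
    · have := Int.le_of_dvd (by omega) hd; omega
  rw [if_pos hq22.le]
  have npos : 4 * n ≤ q → ∀ z, ww n q z ≤ 0 := by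
    intro h4 z
    exact ww_a n q z hn h4
  by_cases c2 : q ≤ 2 * n
  · rw [if_pos c2, if_pos (by omega), if_pos (by omega), if_pos (by omega)]
    have cls : ∀ z, q ∣ 2 * p + 1 - 2 * z ↔ q ∣ z - (p - h) := by
      intro z
      have e : 2 * p + 1 - 2 * z = q - 2 * (z - (p - h)) := by rw [hh]; ring
      rw [e, dvd_sub_right (dvd_refl q)]
      constructor
      · intro h1
        have hc : IsCoprime q 2 := ⟨1, -h, by rw [hh]; ring⟩
        exact hc.dvd_of_dvd_mul_left h1
      · intro h1; exact Dvd.dvd.mul_left h1 2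
    have b5 := (count_bd (-5 * n) (5 * n) p q (by omega) hq0).1
    have b8 := (count_bd (-8 * n) (8 * n) p q (by omega) hq0).1
    have b11 := (count_bd (-11 * n) (11 * n) p q (by omega) hq0).1
    have z4 := (count_bd (-4 * n + 1) (4 * n + 1) (p - h) q (by omega) hq0).2
    have z6 := (count_bd (-10 * n + 1) (6 * n) (p - h) q (by omega) hq0).2
    have z10 := (count_bd (-6 * n + 1) (10 * n + 1) (p - h) q (by omega) hq0).2
    have e1 : ∀ a b : ℤ, Ico (a + 1) (b + 1) = Ioc a b := by
      intro a b; ext x; simp only [mem_Ico, mem_Ioc]; omega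
    have e2 : ∀ a b : ℤ, Ico (a + 1) b = Ioo a b := by
      intro a b; ext x; simp only [mem_Ico, mem_Ioo]; omega
    rw [e1] at z4 z10
    rw [e2] at z6
    simp only [← cls] at z4 z6 z10
    rw [← hP5] at b5
    rw [← hP8] at b8
    rw [← hP11] at b11
    rw [← hZ4] at z4
    rw [← hZ6] at z6
    rw [← hZ10] at z10
    have key : q * (P5 + P8 + P11 - (2 * Z4 + Z6 + Z10)) ≤ 7 * q - 6 := by linarith
    have key2 : P5 + P8 + P11 - (2 * Z4 + Z6 + Z10) < 7 := by nlinarith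
    omega
  rw [if_neg c2]
  by_cases c4 : q < 4 * n
  · rw [if_pos (by omega), if_pos (by omega), if_pos (by omega)]
    rw [not_le] at c2
    suffices key : Sw ≤ -1 by linarith
    -- the least class element above `-4 * n`
    obtain ⟨η, k1, hη, hη1, hη2⟩ : ∃ η k1 : ℤ, η = p - h + q * k1 ∧ -4 * n < η ∧ η ≤ -4 * n + q := by
      refine ⟨(p - h + 4 * n - 1) % q - 4 * n + 1, - ((p - h + 4 * n - 1) / q), ?_, ?_, ?_⟩
      · have := Int.emod_add_mul_ediv (p - h + 4 * n - 1) q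
        linarith
      · have := Int.emod_nonneg (p - h + 4 * n - 1) hq0.ne'
        omega
      · have := Int.emod_lt_of_pos (p - h + 4 * n - 1) hq0
        omega
    have wle : ∀ z, ww n q z ≤ 0 ∨ (ww n q z ≤ 1 ∧ 6 * n ≤ z ∧ 2 * z + q < 16 * n) ∨
        (ww n q z ≤ 1 ∧ z ≤ -6 * n ∧ -2 * z + q < 16 * n) := by
      intro z
      exact ww_b n q z hn c2 c4
    have wneg : ∀ z, -4 * n < z → z < 4 * n → ww n q z ≤ -1 := by
      intro z h1 h2
      exact ww_c n q z hn h1 h2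
    set U := {z ∈ S | 6 * n ≤ z ∧ 2 * z + q < 16 * n} with hU
    set V := {z ∈ S | z ≤ -6 * n ∧ -2 * z + q < 16 * n} with hV
    set N := {z ∈ S | -4 * n < z ∧ z < 4 * n} with hN
    have hUV : Disjoint U V := by
      rw [Finset.disjoint_left]
      intro z h1 h2
      simp only [hU, hV, mem_filter] at h1 h2
      omega
    have hUVN : Disjoint (U ∪ V) N := by
      rw [Finset.disjoint_left]
      intro z h1 h2
      simp only [hU, hV, hN, mem_union, mem_filter] at h1 h2
      omega
    have b0 := sum_le_part S (U ∪ V ∪ N) (ww n q) (by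
      intro z hz
      simp only [hU, hV, hN, mem_union, mem_filter] at hz
      tauto) (by
      intro z hz hz2
      simp only [hU, hV, hN, mem_union, mem_filter] at hz2
      rcases wle z with h1 | h1 | h1
      · exact h1
      · tauto
      · tauto)
    rw [Finset.sum_union hUVN, Finset.sum_union hUV] at b0
    have dS : ∀ x ∈ S, ∀ y ∈ S, q ∣ x - y := by
      intro x hx y hy
      rw [hS, mem_filter] at hx hy
      have := dvd_sub hx.2 hy.2
      simpa using this
    have cU : #U ≤ 1 := by
      rw [Finset.card_le_one]
      intro x hx y hy
      rw [hU, mem_filter] at hx hy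
      have h3 := Int.eq_zero_of_abs_lt_dvd (dS x hx.1 y hy.1) (by rw [abs_lt]; constructor <;> linarith)
      linarith
    have cV : #V ≤ 1 := by
      rw [Finset.card_le_one]
      intro x hx y hy
      rw [hV, mem_filter] at hx hy
      have h3 := Int.eq_zero_of_abs_lt_dvd (dS x hx.1 y hy.1) (by rw [abs_lt]; constructor <;> linarith)
      linarith
    have sU : ∑ z ∈ U, ww n q z ≤ #U := by
      have : ∑ z ∈ U, ww n q z ≤ ∑ z ∈ U, 1 := Finset.sum_le_sum fun z hz => by
        rcases wle z with h1 | h1 | h1 <;> omega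
      simpa using this
    have sV : ∑ z ∈ V, ww n q z ≤ #V := by
      have : ∑ z ∈ V, ww n q z ≤ ∑ z ∈ V, 1 := Finset.sum_le_sum fun z hz => by
        rcases wle z with h1 | h1 | h1 <;> omega
      simpa using this
    have sN : ∑ z ∈ N, ww n q z ≤ -(#N : ℤ) := by
      have : ∑ z ∈ N, ww n q z ≤ ∑ z ∈ N, (-1) := Finset.sum_le_sum fun z hz => by
        rw [hN, mem_filter] at hz
        exact wneg z hz.2.1 hz.2.2
      simpa using this
    have memN : ∀ z k : ℤ, z = p - h + q * k → -4 * n < z → z < 4 * n → z ∈ N := by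
      intro z k e h1 h2
      rw [hN, mem_filter]
      exact ⟨memS z k e (by omega) (by omega), h1, h2⟩
    have m1 : η ∈ N := memN η k1 hη (by omega) (by omega)
    have m2 : η + q ∈ N := memN (η + q) (k1 + 1) (by rw [hη]; ring) (by omega) (by omega)
    by_cases c3 : η + 2 * q < 4 * n
    · have m3 : η + 2 * q ∈ N := memN (η + 2 * q) (k1 + 2) (by rw [hη]; ring) (by omega) (by omega)
      have : 3 ≤ #N := by
        have hsub : ({η, η + q, η + 2 * q} : Finset ℤ) ⊆ N := by
          intro z hz
          simp only [mem_insert, mem_singleton] at hz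
          rcases hz with rfl | rfl | rfl <;> assumption
        have hc : #({η, η + q, η + 2 * q} : Finset ℤ) = 3 := by
          rw [Finset.card_eq_three]
          exact ⟨η, η + q, η + 2 * q, by omega, by omega, by omega, rfl⟩
        rw [← hc]; exact Finset.card_le_card hsub
      omega
    · have : 2 ≤ #N := by
        have hsub : ({η, η + q} : Finset ℤ) ⊆ N := by
          intro z hz
          simp only [mem_insert, mem_singleton] at hz
          rcases hz with rfl | rfl <;> assumption
        have hc : #({η, η + q} : Finset ℤ) = 2 := Finset.card_pair (by omega)
        rw [← hc]; exact Finset.card_le_card hsub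
      by_cases hu : U = ∅
      · have : #U = 0 := by rw [hu]; rfl
        omega
      by_cases hv : V = ∅
      · have : #V = 0 := by rw [hv]; rfl
        omega
      exfalso
      obtain ⟨x, hx⟩ := Finset.nonempty_iff_ne_empty.2 hu
      obtain ⟨y, hy⟩ := Finset.nonempty_iff_ne_empty.2 hv
      rw [hU, mem_filter] at hx
      rw [hV, mem_filter] at hy
      rw [hN, mem_filter] at m1
      obtain ⟨i, hi⟩ := dS x hx.1 η m1.1
      obtain ⟨j, hj⟩ := dS η m1.1 y hy.1
      have hi2 : 1 < i := by nlinarith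
      have hj1 : 0 < j := by nlinarith
      have hij : i + j < 7 := by nlinarith
      have i6 : i < 6 := by omega
      have j6 : j < 6 := by omega
      interval_cases i <;> interval_cases j <;> omega
  rw [not_lt] at c4
  by_cases c7 : 3 * q ≤ 22 * n
  · rw [if_pos c7, if_pos (by omega), if_pos (by omega)]
    have h1 := sum_le_part S {ζ} (ww n q) (by
      rw [singleton_subset_iff]; exact memS ζ k0 hζ (by omega) (by omega)) (fun z _ _ => npos c4 z)
    rw [sum_singleton] at h1
    have h2 : ww n q ζ ≤ -1 := ww_c n q ζ hn (by omega) (by omega)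
    linarith
  rw [if_neg c7]
  by_cases c14 : q ≤ 14 * n
  · rw [if_pos c14, if_pos (by omega)]
    have two : ∀ z1 z2 k1 k2 : ℤ, z1 = p - h + q * k1 → z2 = p - h + q * k2 → z1 ≠ z2 → -11 * n ≤ z1 → z1 ≤ 11 * n → 
        -11 * n ≤ z2 → z2 ≤ 11 * n → ww n q z1 ≤ -1 → ww n q z2 ≤ -1 → Sw ≤ -2 := by
      intro z1 z2 k1 k2 e1 e2 hne a1 a2 a3 a4 w1 w2
      have h1 := sum_le_part S {z1, z2} (ww n q) (by
        intro z hz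
        simp only [mem_insert, mem_singleton] at hz
        rcases hz with rfl | rfl
        · exact memS _ k1 e1 a1 a2
        · exact memS _ k2 e2 a3 a4) (fun z _ _ => npos c4 z)
      rw [sum_pair hne] at h1
      linarith
    have key : Sw ≤ -2 := by
      by_cases r4 : -4 * n < ζ ∧ ζ < 4 * n
      · by_cases r10 : 2 * ζ + q < 10 * n ∧ -2 * ζ + q < 10 * n
        · rcases le_total 0 ζ with hs | hs
          · refine two ζ (ζ + q) k0 (k0 + 1) hζ (by rw [hζ]; ring) (by omega) (by omega) (by omega) (by omega) (by omega) ?_ ?_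
            · exact ww_c n q ζ hn r4.1 r4.2
            · exact ww_e n q _ ζ hn c7 r4.2 hs r10.1 (by omega)
          · refine two ζ (ζ - q) k0 (k0 - 1) hζ (by rw [hζ]; ring) (by omega) (by omega) (by omega) (by omega) (by omega) ?_ ?_
            · exact ww_c n q ζ hn r4.1 r4.2
            · exact ww_e n q _ (-ζ) hn c7 (by omega) (by omega) (by omega) (by omega)
        · have h1 := sum_le_part S {ζ} (ww n q) (by
            rw [singleton_subset_iff]; exact memS ζ k0 hζ (by omega) (by omega)) (fun z _ _ => npos c4 z)
          rw [sum_singleton] at h1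
          have h2 : ww n q ζ ≤ -2 := ww_d n q ζ hn r4.1 r4.2 r10
          linarith
      · rcases le_total 0 ζ with hs | hs
        · refine two ζ (ζ - q) k0 (k0 - 1) hζ (by rw [hζ]; ring) (by omega) (by omega) (by omega) (by omega) (by omega) ?_ ?_
          · exact ww_f n q _ ζ hn c7 (by omega) (by omega) (by omega) (by omega)
          · exact ww_f n q _ ζ hn c7 (by omega) (by omega) (by omega) (by omega)
        · refine two ζ (ζ + q) k0 (k0 + 1) hζ (by rw [hζ]; ring) (by omega) (by omega) (by omega) (by omega) (by omega) ?_ ?_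
          · exact ww_f n q _ (-ζ) hn c7 (by omega) (by omega) (by omega) (by omega)
          · exact ww_f n q _ (-ζ) hn c7 (by omega) (by omega) (by omega) (by omega)
    linarith
  rw [if_neg c14]
  -- now `q > 14 n`: the class has exactly two poles
  obtain ⟨z, k, hz, hz1, hz2⟩ : ∃ z k : ℤ, z = p - h + q * k ∧ 2 * z + q < 22 * n ∧ -2 * z + q < 22 * n := by
    obtain ⟨t, ht⟩ := hd
    have t1 : t < 2 := by nlinarith
    have t2 : -2 < t := by nlinarith
    have t0 : t ≠ 0 := by rintro rfl; omega
    have : t = 1 ∨ t = -1 := by omega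
    rcases this with rfl | rfl
    · exact ⟨p - h + q * 1, 1, rfl, by omega, by omega⟩
    · exact ⟨p - h + q * 0, 0, rfl, by omega, by omega⟩
  have hzS := memS z k hz (by omega) (by omega)
  have h1 := sum_le_part S {z} (ww n q) (by
      rw [singleton_subset_iff]; exact hzS) (fun z _ _ => npos c4 z)
  rw [sum_singleton] at h1
  have e5 : 10 * n ≤ 2 * (z + h) → 2 * (z - h - 1) < - 10 * n → P5 = 0 := by
    intro a1 a2
    rw [hP5]
    norm_cast
    rw [Finset.card_eq_zero, Finset.filter_eq_empty_iff]
    intro x hx hxd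
    rw [mem_Ico] at hx
    obtain ⟨hx1, hx2⟩ := hx
    have hx1' : -5 * n ≤ x := hx1
    clear hx1
    obtain ⟨t, ht⟩ := hxd
    have hx' : x = z + h + q * (t - k) := by rw [hz]; linarith
    have b1 : t - k < 0 := by nlinarith
    have b2 : -1 < t - k := by nlinarith
    omega
  by_cases c16 : q ≤ 16 * n
  · rw [if_pos c16]
    by_cases r16 : 2 * z + q < 16 * n ∧ -2 * z + q < 16 * n
    · have h2 : ww n q z ≤ -2 := (ww_g n q z hn (by omega) hz1 hz2).1
      have := hw5 (e5 (by omega) (by omega))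
      linarith
    · have h2 : ww n q z ≤ -3 := (ww_g n q z hn (by omega) hz1 hz2).2 r16
      linarith
  · rw [if_neg c16]
    have h2 : ww n q z ≤ -3 := (ww_g n q z hn (by omega) hz1 hz2).2 (by omega)
    have := hw5 (e5 (by omega) (by omega))
    linarith
end

section
theorem inv_coeff (y : ℚ) (hy : y ≠ 0) (j : ℕ) :
    PowerSeries.coeff j ((PowerSeries.C y + PowerSeries.X : PowerSeries ℚ)⁻¹) = y⁻¹ * (-y⁻¹) ^ j := by
  have h2 : (PowerSeries.C y + PowerSeries.X : PowerSeries ℚ)⁻¹ =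
      PowerSeries.C y⁻¹ * PowerSeries.rescale (-y⁻¹) (PowerSeries.mk 1) := by
    have e : (PowerSeries.C y + PowerSeries.X : PowerSeries ℚ) * (PowerSeries.C y⁻¹ * PowerSeries.rescale (-y⁻¹) (PowerSeries.mk 1)) = 1 := by
      have e1 := PowerSeries.mk_one_mul_one_sub_eq_one ℚ
      have e2 := congrArg (PowerSeries.rescale (-y⁻¹)) e1
      rw [map_mul, map_sub, map_one, PowerSeries.rescale_X] at e2
      have e3 : (PowerSeries.C y + PowerSeries.X : PowerSeries ℚ) * PowerSeries.C y⁻¹ = 1 - PowerSeries.C (-y⁻¹) * PowerSeries.X := by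
        rw [add_mul, ← map_mul, mul_inv_cancel₀ hy, map_one, map_neg]
        ring
      rw [← mul_assoc, e3, mul_comm]
      exact e2
    have := lin_ne hy
    calc (PowerSeries.C y + PowerSeries.X : PowerSeries ℚ)⁻¹ = (PowerSeries.C y + PowerSeries.X : PowerSeries ℚ)⁻¹ *
      ((PowerSeries.C y + PowerSeries.X : PowerSeries ℚ) * (PowerSeries.C y⁻¹ * PowerSeries.rescale (-y⁻¹) (PowerSeries.mk 1))) := by rw [e, mul_one]
      _ = _ := by rw [← mul_assoc, mul_comm (_)⁻¹, this, one_mul]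
  rw [h2, PowerSeries.coeff_C_mul, PowerSeries.coeff_rescale, PowerSeries.coeff_mk]
  simp

/-- coefficient bound for a power series in the `π`-adic norm -/
def Bd (π : ℕ) (T M : ℚ) (F : PowerSeries ℚ) : Prop :=
  0 ≤ M ∧ ∀ j, padicNorm π (PowerSeries.coeff j F) ≤ M * T ^ j

section
variable {π : ℕ} [Fact π.Prime] {T : ℚ}

theorem pn_pow (x : ℚ) (j : ℕ) : padicNorm π (x ^ j) = padicNorm π x ^ j := by
  induction j with
  | zero => simp
  | succ j ih => rw [pow_succ, padicNorm.mul, ih, pow_succ]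

theorem pn_inv (x : ℚ) : padicNorm π (x⁻¹) = (padicNorm π x)⁻¹ := by
  rw [← one_div, padicNorm.div, padicNorm.one, one_div]

theorem Bd.mul {M N : ℚ} {F G : PowerSeries ℚ} (hT : 0 ≤ T) (hF : Bd π T M F) (hG : Bd π T N G) :
    Bd π T (M * N) (F * G) := by
  refine ⟨mul_nonneg hF.1 hG.1, fun j => ?_⟩
  rw [PowerSeries.coeff_mul]
  have hnn : 0 ≤ M * N * T ^ j := mul_nonneg (mul_nonneg hF.1 hG.1) (pow_nonneg hT j)
  refine padicNorm.sum_le' (fun x hx => ?_) hnn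
  rw [Finset.HasAntidiagonal.mem_antidiagonal] at hx
  rw [padicNorm.mul, ← hx, pow_add]
  calc _ ≤ (M * T ^ x.1) * (N * T ^ x.2) :=
      mul_le_mul (hF.2 _) (hG.2 _) (padicNorm.nonneg _) (mul_nonneg hF.1 (pow_nonneg hT _))
    _ = _ := by ring

theorem Bd.one (hT : 0 ≤ T) : Bd π T 1 1 := by
  refine ⟨zero_le_one, fun j => ?_⟩
  rw [PowerSeries.coeff_one]
  split_ifs with h
  · simp [h]
  · simp only [padicNorm.zero, one_mul]
    positivity

theorem Bd.prod {ι : Type*} (hT : 0 ≤ T) (s : Finset ι) {M : ι → ℚ} {F : ι → PowerSeries ℚ}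
    (h : ∀ i ∈ s, Bd π T (M i) (F i)) : Bd π T (∏ i ∈ s, M i) (∏ i ∈ s, F i) := by
  classical
  induction s using Finset.induction_on with
  | empty => simpa using Bd.one hT
  | insert a s ha ih =>
    rw [Finset.prod_insert ha, Finset.prod_insert ha]
    exact (h a (Finset.mem_insert_self _ _)).mul hT (ih fun i hi => h i (Finset.mem_insert_of_mem hi))

theorem Bd.pow (hT : 0 ≤ T) {M : ℚ} {F : PowerSeries ℚ} (h : Bd π T M F) (m : ℕ) :
    Bd π T (M ^ m) (F ^ m) := by
  have := Bd.prod hT (range m) (M := fun _ => M) (F := fun _ => F) (fun _ _ => h)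
  simpa using this

theorem Bd.lin (hT : 0 ≤ T) {M d : ℚ} (h1 : padicNorm π d ≤ M) (h2 : 1 ≤ M * T) :
    Bd π T M (PowerSeries.C d + PowerSeries.X) := by
  have hM : 0 ≤ M := (padicNorm.nonneg d).trans h1
  refine ⟨hM, fun j => ?_⟩
  rw [map_add, PowerSeries.coeff_C, PowerSeries.coeff_X]
  rcases j with _ | _ | j
  · simpa using h1
  · simpa using h2
  · simp
    positivity

theorem Bd.inv (hT : 0 ≤ T) {M d : ℚ} (hd : d ≠ 0) (h1 : (padicNorm π d)⁻¹ ≤ M) (h2 : (padicNorm π d)⁻¹ ≤ T) :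
    Bd π T M (PowerSeries.C d + PowerSeries.X)⁻¹ := by
  have hp : 0 ≤ (padicNorm π d)⁻¹ := inv_nonneg.2 (padicNorm.nonneg d)
  refine ⟨hp.trans h1, fun j => ?_⟩
  rw [inv_coeff d hd, padicNorm.mul, pn_pow, padicNorm.neg, pn_inv]
  exact mul_le_mul h1 (pow_le_pow_left₀ hp h2 j) (pow_nonneg hp j) (hp.trans h1)

theorem Bd.ZP {n : ℤ} (hT : 0 ≤ T) {M : ℤ → ℚ} {F : ℤ → PowerSeries ℚ} (h : ∀ z, Bd π T (M z) (F z)) :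
    Bd π T (ZP n M) (ZP n F) :=
  (((Bd.prod hT _ fun z _ => h z).pow hT 2).mul hT (Bd.prod hT _ fun z _ => h z)).mul hT
    (Bd.prod hT _ fun z _ => h z)
end

theorem dec_prod (a : ℚ) (Q : ℕ → Prop) [DecidablePred Q] (hQ : ∀ e, Q (e + 1) → Q e) (E : ℕ) :
    ∃ t ≤ E, ∏ e ∈ Icc 1 E, (if Q e then a else 1) = a ^ t ∧ (t = 0 ∨ Q t) ∧
      ∀ s ≤ E, 1 ≤ s → Q s → s ≤ t := by
  induction E with
  | zero => exact ⟨0, le_refl _, by simp, Or.inl rfl, fun s hs _ _ => hs⟩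
  | succ E ih =>
    obtain ⟨t, ht, h1, h2, h3⟩ := ih
    by_cases hE : Q (E + 1)
    · have hall : ∀ e ≤ E + 1, Q e := by
        intro e he
        obtain ⟨d, hd⟩ := Nat.exists_eq_add_of_le he
        rw [hd] at hE
        clear hd he h1 h2 h3 ht
        induction d with
        | zero => exact hE
        | succ d ih => exact ih (hQ _ hE)
      refine ⟨E + 1, le_refl _, ?_, Or.inr hE, fun s hs _ _ => hs⟩
      rw [Finset.prod_congr rfl (fun e he => if_pos (hall e (mem_Icc.1 he).2))]
      simp
    · refine ⟨t, by omega, ?_, h2, fun s hs h4 h5 => ?_⟩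
      · rw [Finset.prod_Icc_succ_top (by omega), if_neg hE, mul_one, h1]
      · refine h3 s ?_ h4 h5
        rcases Nat.lt_or_ge s (E + 1) with h6 | h6
        · omega
        · exfalso; apply hE; rwa [show E + 1 = s by omega]

/-- truncated valuation as a product -/
noncomputable def gE (π E : ℕ) (m : ℤ) : ℚ := ∏ e ∈ Icc 1 E, (if ((π : ℤ) ^ e) ∣ m then (π : ℚ) else 1)

section
variable {π : ℕ} [hπ : Fact π.Prime]

theorem gE_spec (E : ℕ) (m : ℤ) : ∃ t ≤ E, gE π E m = (π : ℚ) ^ t ∧ ((π : ℤ) ^ t) ∣ m ∧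
    ∀ s ≤ E, ((π : ℤ) ^ s) ∣ m → s ≤ t := by
  obtain ⟨t, h1, h2, h3, h4⟩ := dec_prod (π : ℚ) (fun e => ((π : ℤ) ^ e) ∣ m)
    (fun e h => (pow_dvd_pow _ (Nat.le_succ e)).trans h) E
  refine ⟨t, h1, h2, ?_, fun s hs hd => ?_⟩
  · rcases h3 with rfl | h3
    · simp
    · exact h3
  · rcases Nat.eq_zero_or_pos s with rfl | h5
    · exact Nat.zero_le _
    · exact h4 s hs h5 hd

theorem one_le_pi : (1 : ℚ) ≤ π := by exact_mod_cast hπ.out.one_lt.le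

theorem gE_one_le (E : ℕ) (m : ℤ) : 1 ≤ gE π E m := by
  obtain ⟨t, _, h, _⟩ := gE_spec (π := π) E m
  rw [h]
  exact one_le_pow₀ one_le_pi

theorem gE_le (E : ℕ) (m : ℤ) : gE π E m ≤ (π : ℚ) ^ E := by
  obtain ⟨t, ht, h, _⟩ := gE_spec (π := π) E m
  rw [h]
  exact pow_le_pow_right₀ one_le_pi ht

theorem gE_zero (E : ℕ) : gE π E 0 = (π : ℚ) ^ E := by
  simp [gE]

theorem norm_le_gE (E : ℕ) (m : ℤ) : padicNorm π (m : ℚ) ≤ (gE π E m)⁻¹ := by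
  obtain ⟨t, ht, h, hd, _⟩ := gE_spec (π := π) E m
  rw [h]
  have := (padicNorm.dvd_iff_norm_le (p := π) (n := t) (z := m)).1 (by exact_mod_cast hd)
  rwa [zpow_neg, zpow_natCast] at this

theorem norm_ge_gE (E : ℕ) (m : ℤ) (hm : m ≠ 0) (hE : padicValInt π m ≤ E) :
    (padicNorm π (m : ℚ))⁻¹ ≤ gE π E m := by
  obtain ⟨t, ht, h, hd, hmax⟩ := gE_spec (π := π) E m
  rw [h, padicNorm.eq_zpow_of_nonzero (by exact_mod_cast hm), padicValRat.of_int, zpow_neg, inv_inv,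
    zpow_natCast]
  exact pow_le_pow_right₀ one_le_pi (hmax _ hE (padicValInt_dvd m))

theorem norm_lcm (E N : ℕ) (hN : 1 ≤ N) : padicNorm π (Nat.lcmUpto N : ℚ) ≤
    (∏ e ∈ Icc 1 E, (if π ^ e ≤ N then (π : ℚ) else 1))⁻¹ := by
  obtain ⟨t, h1, h2, h3, h4⟩ := dec_prod (π : ℚ) (fun e => π ^ e ≤ N)
    (fun e h => (Nat.pow_le_pow_right hπ.out.pos (Nat.le_succ e)).trans h) E
  rw [h2]
  have hd : π ^ t ∣ Nat.lcmUpto N := by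
    rcases h3 with rfl | h3
    · simp
    · exact Finset.dvd_lcm (f := id) (mem_Icc.2 ⟨Nat.one_le_pow _ _ hπ.out.pos, h3⟩)
  have := (padicNorm.dvd_iff_norm_le (p := π) (n := t) (z := (Nat.lcmUpto N : ℤ))).1 (by exact_mod_cast hd)
  rw [zpow_neg, zpow_natCast] at this
  exact_mod_cast this
end
end

section
theorem ZP_prod {A : Type*} [CommMonoid A] {ι : Type*} (s : Finset ι) (n : ℤ) (f : ι → ℤ → A) :
    ZP n (fun z => ∏ e ∈ s, f e z) = ∏ e ∈ s, ZP n (f e) := by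
  simp only [ZP, Finset.prod_mul_distrib, Finset.prod_pow]
  rw [Finset.prod_comm, Finset.prod_comm (s := Ioo (-10 * n) (6 * n)),
    Finset.prod_comm (s := Ioc (-6 * n) (10 * n))]

theorem PP_prod {A : Type*} [CommMonoid A] {ι : Type*} (s : Finset ι) (n : ℤ) (f : ι → ℤ → A) :
    PP n (fun z => ∏ e ∈ s, f e z) = ∏ e ∈ s, PP n (f e) := by
  simp only [PP, Finset.prod_mul_distrib]
  rw [Finset.prod_comm, Finset.prod_comm (s := Ico (-8 * n) (8 * n)),
    Finset.prod_comm (s := Ico (-11 * n) (11 * n))]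

theorem ZP_inv (n : ℤ) (f : ℤ → ℚ) : ZP n (fun z => (f z)⁻¹) = (ZP n f)⁻¹ := by
  simp only [ZP, Finset.prod_inv_distrib, mul_inv, inv_pow]

theorem prod_ite_card (s : Finset ℤ) (P : ℤ → Prop) [DecidablePred P] (a : ℚ) :
    ∏ z ∈ s, (if P z then a else 1) = a ^ #{z ∈ s | P z} := by
  rw [← Finset.prod_filter, Finset.prod_const]

/-- the common denominator -/
noncomputable def Dn (n : ℕ) : ℕ := Nat.lcmUpto (2 * n) ^ 12 * Nat.lcmUpto (22 * n / 3) ^ 3 *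
  Nat.lcmUpto (14 * n) ^ 3 * Nat.lcmUpto (16 * n) ^ 3 * Nat.lcmUpto (22 * n)

theorem ite_pow' (P : Prop) [Decidable P] (a : ℚ) : (if P then a else 1) = a ^ (if P then 1 else 0) := by
  split_ifs <;> simp

theorem mul5_le {a b c d e a' b' c' d' e' : ℚ} (ha : 0 ≤ a) (hb : 0 ≤ b) (hc : 0 ≤ c) (hd : 0 ≤ d) (he : 0 ≤ e)
    (h1 : a ≤ a') (h2 : b ≤ b') (h3 : c ≤ c') (h4 : d ≤ d') (h5 : e ≤ e') :
    a * b * c * d * e ≤ a' * b' * c' * d' * e' := by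
  have := ha.trans h1
  have := hb.trans h2
  have := hc.trans h3
  have := hd.trans h4
  gcongr

theorem level (n : ℕ) (hn : 1 ≤ n) (π : ℕ) [hπ : Fact π.Prime] (h2 : π ≠ 2) (p : ℤ) (hp : p ∈ Pol n) (E : ℕ)
    (hE : ∀ e ∈ Icc 1 E, ∃ p' ∈ Pol n, p' ≠ p ∧ ((π : ℤ) ^ e) ∣ p' - p) :
    padicNorm π (Dn n : ℚ) * ((ZP n (fun z => (gE π E (2 * p + 1 - 2 * z))⁻¹)) ^ 3 *
      (PP n (fun p' => gE π E (p' - p))) ^ 3) * ((π : ℚ) ^ E) ^ 4 ≤ 1 := by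
  set A : ℕ → ℕ → ℚ := fun N e => if π ^ e ≤ N then (π : ℚ) else 1 with hA
  have hA1 : ∀ N e, 1 ≤ A N e := by
    intro N e
    simp only [hA]
    split_ifs
    · exact one_le_pi
    · exact le_refl _
  have hAp : ∀ N, 0 < ∏ e ∈ Icc 1 E, A N e := fun N => Finset.prod_pos fun e _ => zero_lt_one.trans_le (hA1 N e)
  have hD : padicNorm π (Dn n : ℚ) ≤ (∏ e ∈ Icc 1 E, (A (2 * n) e ^ 12 * A (22 * n / 3) e ^ 3 *
      A (14 * n) e ^ 3 * A (16 * n) e ^ 3 * A (22 * n) e))⁻¹ := by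
    have hl : ∀ N k : ℕ, 1 ≤ N → padicNorm π ((Nat.lcmUpto N : ℚ) ^ k) ≤ ((∏ e ∈ Icc 1 E, A N e)⁻¹) ^ k := by
      intro N k hN
      rw [pn_pow]
      exact pow_le_pow_left₀ (padicNorm.nonneg _) (norm_lcm E N hN) k
    simp only [Finset.prod_mul_distrib, Finset.prod_pow, mul_inv, ← inv_pow]
    rw [Dn]
    push_cast
    simp only [padicNorm.mul]
    have h1 := hl (22 * n) 1 (by omega)
    rw [pow_one, pow_one] at h1
    exact mul5_le (padicNorm.nonneg _) (padicNorm.nonneg _) (padicNorm.nonneg _) (padicNorm.nonneg _)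
      (padicNorm.nonneg _) (hl (2 * n) 12 (by omega)) (hl (22 * n / 3) 3 (by omega)) (hl (14 * n) 3 (by omega))
      (hl (16 * n) 3 (by omega)) h1
  have hZ0 : ∀ m : ℤ, 0 < gE π E m := fun m => zero_lt_one.trans_le (gE_one_le E m)
  have hZpos : 0 < ZP (n : ℤ) (fun z => gE π E (2 * p + 1 - 2 * z)) := by
    unfold ZP
    have : ∀ s : Finset ℤ, 0 < ∏ z ∈ s, gE π E (2 * p + 1 - 2 * z) := fun s => Finset.prod_pos fun z _ => hZ0 _
    have a1 := this (Ioc (-4 * (n : ℤ)) (4 * n))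
    have a2 := this (Ioo (-10 * (n : ℤ)) (6 * n))
    have a3 := this (Ioc (-6 * (n : ℤ)) (10 * n))
    positivity
  have hPpos : 0 < PP (n : ℤ) (fun p' => gE π E (p' - p)) := by
    unfold PP
    have : ∀ s : Finset ℤ, 0 < ∏ p' ∈ s, gE π E (p' - p) := fun s => Finset.prod_pos fun z _ => hZ0 _
    exact mul_pos (mul_pos (this _) (this _)) (this _)
  have hApos : 0 < ∏ e ∈ Icc 1 E, (A (2 * n) e ^ 12 * A (22 * n / 3) e ^ 3 *
      A (14 * n) e ^ 3 * A (16 * n) e ^ 3 * A (22 * n) e) := by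
    refine Finset.prod_pos fun e _ => ?_
    have : ∀ N, 0 < A N e := fun N => zero_lt_one.trans_le (hA1 N e)
    have a1 := this (2 * n)
    have a2 := this (22 * n / 3)
    have a3 := this (14 * n)
    have a4 := this (16 * n)
    have a5 := this (22 * n)
    positivity
  have key : (PP (n : ℤ) (fun p' => gE π E (p' - p))) ^ 3 * ((π : ℚ) ^ E) ^ 4 ≤
      (ZP (n : ℤ) (fun z => gE π E (2 * p + 1 - 2 * z))) ^ 3 * ∏ e ∈ Icc 1 E, (A (2 * n) e ^ 12 * A (22 * n / 3) e ^ 3 *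
      A (14 * n) e ^ 3 * A (16 * n) e ^ 3 * A (22 * n) e) := by
    have eT : (π : ℚ) ^ E = ∏ e ∈ Icc 1 E, (π : ℚ) := by simp
    rw [eT]
    unfold gE
    rw [PP_prod, ZP_prod, ← Finset.prod_pow, ← Finset.prod_pow, ← Finset.prod_pow, ← Finset.prod_mul_distrib,
      ← Finset.prod_mul_distrib]
    have hpi0 : (0 : ℚ) ≤ π := zero_le_one.trans one_le_pi
    refine Finset.prod_le_prod (fun e _ => ?_) (fun e he => ?_)
    · refine mul_nonneg (pow_nonneg ?_ 3) (pow_nonneg hpi0 4)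
      unfold PP
      have : ∀ s : Finset ℤ, 0 ≤ ∏ p' ∈ s, (if (π : ℤ) ^ e ∣ p' - p then (π : ℚ) else 1) := fun s =>
        Finset.prod_nonneg fun z _ => by split_ifs <;> positivity
      exact mul_nonneg (mul_nonneg (this _) (this _)) (this _)
    · obtain ⟨p', hp', hne, hd⟩ := hE e he
      rw [Pol, mem_Ico] at hp hp'
      have hodd : Odd ((π : ℤ) ^ e) := by
        apply Odd.pow
        exact_mod_cast hπ.out.odd_of_ne_two h2
      obtain ⟨h, hh⟩ := hodd
      have hq3 : 3 ≤ (π : ℤ) ^ e := by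
        have h3 : 3 ≤ π := by
          have := hπ.out.two_le
          omega
        have h4 : π ^ 1 ≤ π ^ e := Nat.pow_le_pow_right hπ.out.pos (mem_Icc.1 he).1
        rw [pow_one] at h4
        have : 3 ≤ π ^ e := by omega
        exact_mod_cast this
      have li := LI n ((π : ℤ) ^ e) h p p' (by omega) hq3 hh hp.1 hp.2 hp'.1 hp'.2 hne hd
      unfold PP ZP
      rw [prod_ite_card, prod_ite_card, prod_ite_card, prod_ite_card, prod_ite_card, prod_ite_card]
      simp only [hA, ite_pow']
      simp only [← pow_add, ← pow_mul]
      refine pow_le_pow_right₀ one_le_pi ?_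
      have q1 : (π : ℤ) ^ e ≤ 2 * n ↔ π ^ e ≤ 2 * n := by exact_mod_cast Iff.rfl
      have q2 : 3 * (π : ℤ) ^ e ≤ 22 * n ↔ π ^ e ≤ 22 * n / 3 := by
        rw [Nat.le_div_iff_mul_le (by norm_num), mul_comm]; exact_mod_cast Iff.rfl
      have q3 : (π : ℤ) ^ e ≤ 14 * n ↔ π ^ e ≤ 14 * n := by exact_mod_cast Iff.rfl
      have q4 : (π : ℤ) ^ e ≤ 16 * n ↔ π ^ e ≤ 16 * n := by exact_mod_cast Iff.rfl
      have q5 : (π : ℤ) ^ e ≤ 22 * n ↔ π ^ e ≤ 22 * n := by exact_mod_cast Iff.rfl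
      simp only [q1, q2, q3, q4, q5] at li
      clear q1 q2 q3 q4 q5
      split_ifs at li ⊢ <;> omega
  rw [ZP_inv]
  calc _ ≤ (∏ e ∈ Icc 1 E, (A (2 * n) e ^ 12 * A (22 * n / 3) e ^ 3 *
      A (14 * n) e ^ 3 * A (16 * n) e ^ 3 * A (22 * n) e))⁻¹ * (((ZP (n : ℤ) (fun z => gE π E (2 * p + 1 - 2 * z)))⁻¹) ^ 3 *
      (PP (n : ℤ) (fun p' => gE π E (p' - p))) ^ 3) * ((π : ℚ) ^ E) ^ 4 := by
        gcongr
    _ = ((ZP (n : ℤ) (fun z => gE π E (2 * p + 1 - 2 * z))) ^ 3 * ∏ e ∈ Icc 1 E, (A (2 * n) e ^ 12 * A (22 * n / 3) e ^ 3 *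
      A (14 * n) e ^ 3 * A (16 * n) e ^ 3 * A (22 * n) e))⁻¹ * ((PP (n : ℤ) (fun p' => gE π E (p' - p))) ^ 3 * ((π : ℚ) ^ E) ^ 4) := by
        rw [mul_inv, inv_pow]; ring
    _ ≤ 1 := by
        rw [inv_mul_le_iff₀ (by positivity), mul_one]
        exact key
end

section
section
variable {π : ℕ} [hπ : Fact π.Prime]

theorem pn_two (h2 : π ≠ 2) : padicNorm π (2 : ℚ) = 1 := by
  have : Fact (Nat.Prime 2) := ⟨Nat.prime_two⟩
  exact_mod_cast padicNorm.padicNorm_of_prime_of_ne h2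

theorem exE (n : ℕ) (hn : 1 ≤ n) (p : ℤ) (hp : p ∈ Pol n) : ∃ E : ℕ,
    (∀ e ∈ Icc 1 E, ∃ p' ∈ Pol n, p' ≠ p ∧ ((π : ℤ) ^ e) ∣ p' - p) ∧
    ∀ p' ∈ Pol n, p' ≠ p → padicValInt π (p' - p) ≤ E := by
  have hne : ((Pol n).erase p).Nonempty := by
    rw [Pol, mem_Ico] at hp
    by_cases h : p = 0
    · exact ⟨-1, by rw [mem_erase, Pol, mem_Ico]; omega⟩
    · exact ⟨0, by rw [mem_erase, Pol, mem_Ico]; omega⟩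
  obtain ⟨q, hq, hmax⟩ := Finset.exists_max_image _ (fun p' => padicValInt π (p' - p)) hne
  rw [mem_erase] at hq
  refine ⟨padicValInt π (q - p), fun e he => ⟨q, hq.2, hq.1, ?_⟩, fun p' hp' hne' => hmax p' (mem_erase.2 ⟨hne', hp'⟩)⟩
  exact (pow_dvd_pow _ (mem_Icc.1 he).2).trans (padicValInt_dvd _)

theorem bb_core (n : ℕ) (h2 : π ≠ 2) (p : ℤ) (hp : p ∈ Pol n) (E : ℕ)
    (hE : ∀ p' ∈ Pol n, p' ≠ p → padicValInt π (p' - p) ≤ E) (j : ℕ) :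
    padicNorm π (bb n p j) * ((π : ℚ) ^ E) ^ (3 * tau n p) ≤
      ((ZP n (fun z => (gE π E (2 * p + 1 - 2 * z))⁻¹)) ^ 3 *
      (PP n (fun p' => gE π E (p' - p))) ^ 3) * ((π : ℚ) ^ E) ^ j := by
  set T : ℚ := (π : ℚ) ^ E with hTdef
  have hT : 0 ≤ T := pow_nonneg (zero_le_one.trans one_le_pi) _
  have hZ : ∀ z : ℤ, Bd π T ((gE π E (2 * p + 1 - 2 * z))⁻¹)
      (PowerSeries.C (((p : ℚ) + 1 / 2) - (z : ℚ)) + PowerSeries.X) := by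
    intro z
    have hg := gE_one_le (π := π) E (2 * p + 1 - 2 * z)
    have hg' := gE_le (π := π) E (2 * p + 1 - 2 * z)
    refine Bd.lin hT ?_ ?_
    · have e : ((p : ℚ) + 1 / 2) - (z : ℚ) = ((2 * p + 1 - 2 * z : ℤ) : ℚ) / 2 := by push_cast; ring
      rw [e, padicNorm.div, pn_two h2, div_one]
      exact norm_le_gE E _
    · rw [← div_eq_inv_mul, one_le_div (zero_lt_one.trans_le hg)]
      exact hg'
  have hP : ∀ q ∈ (Pol n).erase p, Bd π T ((gE π E (q - p)) ^ (3 * tau n q))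
      (((PowerSeries.C (((p : ℚ) + 1 / 2) - ((q : ℚ) + 1 / 2)) + PowerSeries.X)⁻¹) ^ (3 * tau n q)) := by
    intro q hq
    rw [mem_erase] at hq
    have hqp : q - p ≠ 0 := sub_ne_zero.2 hq.1
    have e : ((p : ℚ) + 1 / 2) - ((q : ℚ) + 1 / 2) = -((q - p : ℤ) : ℚ) := by push_cast; ring
    have hg := norm_ge_gE (π := π) E (q - p) hqp (hE q hq.2 hq.1)
    refine Bd.pow hT (Bd.inv hT ?_ ?_ ?_) _
    · rw [e]
      exact neg_ne_zero.2 (by exact_mod_cast hqp)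
    · rw [e, padicNorm.neg]; exact hg
    · rw [e, padicNorm.neg]; exact hg.trans (gE_le E _)
  have hB := ((Bd.ZP (n := n) hT hZ).pow hT 3).mul hT (Bd.prod hT _ hP)
  have h3 := hB.2 j
  have e1 : bb n p j = PowerSeries.coeff j ((ZP (n : ℤ) fun z => (PowerSeries.C (((p : ℚ) + 1 / 2) - (z : ℚ)) + PowerSeries.X : PowerSeries ℚ)) ^ 3 *
    ∏ q ∈ (Pol n).erase p, ((PowerSeries.C (((p : ℚ) + 1 / 2) - ((q : ℚ) + 1 / 2)) + PowerSeries.X)⁻¹) ^ (3 * tau n q)) := by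
    rw [bb, Psi, Nm_aeval]
  rw [← e1] at h3
  have e2 : (PP (n : ℤ) (fun p' => gE π E (p' - p))) ^ 3 = (∏ q ∈ (Pol n).erase p, (gE π E (q - p)) ^ (3 * tau n q)) *
      T ^ (3 * tau n p) := by
    rw [PP_eq, ← Finset.prod_pow, ← Finset.prod_erase_mul _ _ hp, sub_self, gE_zero]
    congr 1
    · refine Finset.prod_congr rfl fun q _ => ?_
      rw [← pow_mul, mul_comm]
    · rw [← pow_mul, mul_comm]
  rw [e2]
  calc _ ≤ _ := mul_le_mul_of_nonneg_right h3 (pow_nonneg hT _)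
    _ = _ := by ring

theorem rr_core (n : ℕ) (h2 : π ≠ 2) (p : ℤ) (hp : p ∈ Pol n) (E : ℕ)
    (hE : ∀ p' ∈ Pol n, p' ≠ p → padicValInt π (p' - p) ≤ E) (m : ℕ) :
    padicNorm π (rr m p) ≤ ((π : ℚ) ^ E) ^ (m + 1) := by
  set T : ℚ := (π : ℚ) ^ E with hTdef
  have hT : 0 ≤ T := pow_nonneg (zero_le_one.trans one_le_pi) _
  rw [Pol, mem_Ico] at hp
  have key : ∀ i : ℕ, (∃ p' ∈ Pol n, p' - p = 2 * i + 1 ∨ p' - p = -(2 * i + 1)) →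
      padicNorm π ((((i : ℚ) + 1 / 2)⁻¹) ^ (m + 1)) ≤ T ^ (m + 1) := by
    rintro i ⟨p', hp', h⟩
    rw [pn_pow]
    refine pow_le_pow_left₀ (padicNorm.nonneg _) ?_ _
    have hne : p' - p ≠ 0 := by omega
    have e : ((i : ℚ) + 1 / 2)⁻¹ = 2 * ((2 * i + 1 : ℤ) : ℚ)⁻¹ := by
      push_cast
      have : (i : ℚ) + 1 / 2 ≠ 0 := by positivity
      field_simp
    rw [e, padicNorm.mul, pn_two h2, one_mul, pn_inv]
    have hg := (norm_ge_gE (π := π) E (p' - p) hne (hE p' hp' (sub_ne_zero.1 hne))).trans (gE_le E _)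
    rcases h with h | h
    · rw [h] at hg; exact hg
    · rw [h, Int.cast_neg, padicNorm.neg] at hg; exact hg
  rw [rr, padicNorm.mul]
  have hm : padicNorm π (m : ℚ) ≤ 1 := padicNorm.of_nat m
  have hTm : 0 ≤ T ^ (m + 1) := pow_nonneg hT _
  have hs : padicNorm π (∑ i ∈ range (p + 1).toNat, ((-(i : ℚ) - 1 / 2)⁻¹) ^ (m + 1) -
    ∑ i ∈ range (-p - 1).toNat, (((i : ℚ) + 1 / 2)⁻¹) ^ (m + 1)) ≤ T ^ (m + 1) := by
    refine padicNorm.sub.trans (max_le ?_ ?_)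
    · refine padicNorm.sum_le' (fun i hi => ?_) hTm
      rw [Finset.mem_range] at hi
      have e : (-(i : ℚ) - 1 / 2)⁻¹ = -(((i : ℚ) + 1 / 2)⁻¹) := by
        rw [← inv_neg]; congr 1; ring
      rw [e, pn_pow, padicNorm.neg, ← pn_pow]
      exact key i ⟨p - (2 * i + 1), by rw [Pol, mem_Ico]; omega, Or.inr (by ring)⟩
    · refine padicNorm.sum_le' (fun i hi => ?_) hTm
      rw [Finset.mem_range] at hi
      exact key i ⟨p + (2 * i + 1), by rw [Pol, mem_Ico]; omega, Or.inl (by ring)⟩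
  calc _ ≤ 1 * T ^ (m + 1) := mul_le_mul hm hs (padicNorm.nonneg _) zero_le_one
    _ = _ := one_mul _

theorem denom (n : ℕ) (hn : 1 ≤ n) (h2 : π ≠ 2) (p : ℤ) (hp : p ∈ Pol n) (j : ℕ) (hj : j < 3 * tau n p) :
    padicNorm π ((Dn n : ℚ) * bb n p j) ≤ 1 ∧
    padicNorm π ((Dn n : ℚ) * (bb n p j * rr (3 * tau n p - j + 3) p)) ≤ 1 := by
  obtain ⟨E, h1, hE⟩ := exE (π := π) n hn p hp
  have hl := level n hn π h2 p hp E h1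
  have hb := bb_core n h2 p hp E hE j
  have hr := rr_core n h2 p hp E hE (3 * tau n p - j + 3)
  set T : ℚ := (π : ℚ) ^ E with hTdef
  have hT1 : 1 ≤ T := one_le_pow₀ one_le_pi
  set M := ((ZP (n : ℤ) (fun z => (gE π E (2 * p + 1 - 2 * z))⁻¹)) ^ 3 *
      (PP (n : ℤ) (fun p' => gE π E (p' - p))) ^ 3) with hM
  have hD0 : 0 ≤ padicNorm π (Dn n : ℚ) := padicNorm.nonneg _
  have hb0 : 0 ≤ padicNorm π (bb n p j) := padicNorm.nonneg _
  have hTp : 0 < T := zero_lt_one.trans_le hT1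
  -- the main inequality
  have hmain : padicNorm π (bb n p j) * T ^ (3 * tau n p - j + 3 + 1) ≤ M * T ^ 4 := by
    have e : 3 * tau n p = (3 * tau n p - j) + j := by omega
    have : padicNorm π (bb n p j) * T ^ (3 * tau n p - j) ≤ M := by
      rw [e, pow_add, ← mul_assoc] at hb
      exact le_of_mul_le_mul_right hb (pow_pos hTp j)
    calc _ = (padicNorm π (bb n p j) * T ^ (3 * tau n p - j)) * T ^ 4 := by rw [add_assoc, pow_add, mul_assoc]
      _ ≤ _ := mul_le_mul_of_nonneg_right this (pow_nonneg hTp.le 4)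
  have hfin : padicNorm π (Dn n : ℚ) * (padicNorm π (bb n p j) * T ^ (3 * tau n p - j + 3 + 1)) ≤ 1 :=
    (mul_le_mul_of_nonneg_left hmain hD0).trans (by rw [← mul_assoc]; exact hl)
  rw [padicNorm.mul, padicNorm.mul, padicNorm.mul]
  refine ⟨le_trans (mul_le_mul_of_nonneg_left ?_ hD0) hfin, le_trans (mul_le_mul_of_nonneg_left ?_ hD0) hfin⟩
  · exact le_mul_of_one_le_right hb0 (one_le_pow₀ hT1)
  · exact mul_le_mul_of_nonneg_left hr hb0
end
end

section
theorem cheb_floor (T : ℕ) : (if 1 ≤ T then 1 else 0) + (T / 2 + T / 3 + T / 5) ≤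
    (if 6 ≤ T then 1 else 0) + (T + T / 30) := by
  split_ifs <;> omega

theorem log_eq_sum (p N b : ℕ) (hp : p.Prime) (hN : N ≠ 0) (hb : Nat.log p N < b) :
    Nat.log p N = ∑ i ∈ Ico 1 b, if p ^ i ≤ N then 1 else 0 := by
  rw [← Finset.sum_filter, ← Finset.card_eq_sum_ones]
  have : (Ico 1 b).filter (fun i => p ^ i ≤ N) = Icc 1 (Nat.log p N) := by
    ext i
    simp only [mem_filter, mem_Ico, mem_Icc]
    rw [← Nat.le_log_iff_pow_le hp.one_lt hN]
    omega
  rw [this, Nat.card_Icc]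
  omega

theorem cheb_dvd (m : ℕ) (hm : 1 ≤ m) : Nat.lcmUpto (30 * m) * (Nat.factorial (15 * m) * Nat.factorial (10 * m) * Nat.factorial (6 * m)) ∣
    Nat.lcmUpto (5 * m) * (Nat.factorial (30 * m) * Nat.factorial m) := by
  have hf : ∀ k, Nat.factorial k ≠ 0 := Nat.factorial_ne_zero
  have hl : ∀ k, Nat.lcmUpto k ≠ 0 := fun k => (Nat.lcmUpto_pos k).ne'
  rw [← Nat.factorization_le_iff_dvd (by simp [hf, hl]) (by simp [hf, hl])]
  intro p
  by_cases hp : p.Prime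
  swap
  · simp [Nat.factorization_eq_zero_of_not_prime _ hp]
  rw [Nat.factorization_mul (hl _) (by simp [hf]), Nat.factorization_mul (by simp [hf]) (hf _),
    Nat.factorization_mul (hf _) (hf _), Nat.factorization_mul (hl _) (by simp [hf]), Nat.factorization_mul (hf _) (hf _)]
  simp only [Finsupp.add_apply]
  set b := Nat.log p (30 * m) + 1 with hb
  have hlog : ∀ k, k ≤ 30 * m → Nat.log p k < b := fun k hk => Nat.lt_succ_of_le (Nat.log_mono_right hk)
  rw [Nat.factorization_factorial hp (hlog (15 * m) (by omega)), Nat.factorization_factorial hp (hlog (10 * m) (by omega)),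
    Nat.factorization_factorial hp (hlog (6 * m) (by omega)), Nat.factorization_factorial hp (hlog (30 * m) (by omega)),
    Nat.factorization_factorial hp (hlog m (by omega)), Nat.factorization_lcmUpto _ hp, Nat.factorization_lcmUpto _ hp,
    log_eq_sum p (30 * m) b hp (by omega) (hlog _ (by omega)), log_eq_sum p (5 * m) b hp (by omega) (hlog _ (by omega))]
  simp only [← Finset.sum_add_distrib]
  refine Finset.sum_le_sum fun i _ => ?_
  have hq : 0 < p ^ i := pow_pos hp.pos i
  generalize p ^ i = q at hq
  have hd : ∀ k c : ℕ, 0 < c → c * k = 30 * m → k / q = 30 * m / q / c := by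
    intro k c hc h
    rw [← h, Nat.div_div_eq_div_mul, mul_comm q c, Nat.mul_div_mul_left _ _ hc]
  have h1 : q ≤ 30 * m ↔ 1 ≤ 30 * m / q := by rw [Nat.le_div_iff_mul_le hq, one_mul]
  have h2 : q ≤ 5 * m ↔ 6 ≤ 30 * m / q := by
    rw [Nat.le_div_iff_mul_le hq]; omega
  rw [hd (15 * m) 2 (by norm_num) (by ring), hd (10 * m) 3 (by norm_num) (by ring),
    hd (6 * m) 5 (by norm_num) (by ring), hd m 30 (by norm_num) (by ring)]
  simp only [h1, h2]
  exact cheb_floor _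

theorem cheb_step (t : ℕ) : (t+1)*(t+2)*(t+3)*(t+4)*(t+5)*(t+6)*(t+7)*(t+8)*(t+9)*(t+10)*(t+11)*(t+12)*(t+13)*(t+14)*(t+15)*
    (t+16)*(t+17)*(t+18)*(t+19)*(t+20)*(t+21)*(t+22)*(t+23)*(t+24)*(t+25)*(t+26)*(t+27)*(t+28)*(t+29)*(t+30)*(t+30) ≤
    ((t+2)*(t+4)*(t+6)*(t+8)*(t+10)*(t+12)*(t+14)*(t+16)*(t+18)*(t+20)*(t+22)*(t+24)*(t+26)*(t+28)*(t+30)) *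
    ((t+3)*(t+6)*(t+9)*(t+12)*(t+15)*(t+18)*(t+21)*(t+24)*(t+27)*(t+30)) *
    ((t+5)*(t+10)*(t+15)*(t+20)*(t+25)*(t+30)) := by
  have h : (t+1)*(t+7)*(t+11)*(t+13)*(t+17)*(t+19)*(t+23)*(t+29) ≤ (t+6)*(t+10)*(t+12)*(t+15)*(t+18)*(t+20)*(t+24)*(t+30) := by
    gcongr <;> norm_num
  have h2 := Nat.mul_le_mul_left ((t+2)*(t+3)*(t+4)*(t+5)*(t+6)*(t+8)*(t+9)*(t+10)*(t+12)*(t+14)*(t+15)*(t+16)*(t+18)*(t+20)*(t+21)*(t+22)*(t+24)*(t+25)*(t+26)*(t+27)*(t+28)*(t+30)*(t+30)) h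
  generalize t+1 = a1 at *
  generalize t+2 = a2 at *
  generalize t+3 = a3 at *
  generalize t+4 = a4 at *
  generalize t+5 = a5 at *
  generalize t+6 = a6 at *
  generalize t+7 = a7 at *
  generalize t+8 = a8 at *
  generalize t+9 = a9 at *
  generalize t+10 = a10 at *
  generalize t+11 = a11 at *
  generalize t+12 = a12 at *
  generalize t+13 = a13 at *
  generalize t+14 = a14 at *
  generalize t+15 = a15 at *
  generalize t+16 = a16 at *
  generalize t+17 = a17 at *
  generalize t+18 = a18 at *
  generalize t+19 = a19 at *
  generalize t+20 = a20 at *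
  generalize t+21 = a21 at *
  generalize t+22 = a22 at *
  generalize t+23 = a23 at *
  generalize t+24 = a24 at *
  generalize t+25 = a25 at *
  generalize t+26 = a26 at *
  generalize t+27 = a27 at *
  generalize t+28 = a28 at *
  generalize t+29 = a29 at *
  generalize t+30 = a30 at *
  clear h
  calc _ = _ := ?_
    _ ≤ _ := h2
    _ = _ := ?_
  · ring
  · ring

theorem cheb_fact (m : ℕ) : Nat.factorial (30 * m) * Nat.factorial m ≤ (2 ^ 40) ^ m *
    (Nat.factorial (15 * m) * Nat.factorial (10 * m) * Nat.factorial (6 * m)) := by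
  induction m with
  | zero => simp
  | succ m ih =>
    have e1 : Nat.factorial (30 * (m + 1)) = Nat.factorial (30 * m) * Nat.ascFactorial (30 * m + 1) 30 := by
      rw [Nat.factorial_mul_ascFactorial, mul_add, mul_one]
    have e2 : Nat.factorial (15 * (m + 1)) = Nat.factorial (15 * m) * Nat.ascFactorial (15 * m + 1) 15 := by
      rw [Nat.factorial_mul_ascFactorial, mul_add, mul_one]
    have e3 : Nat.factorial (10 * (m + 1)) = Nat.factorial (10 * m) * Nat.ascFactorial (10 * m + 1) 10 := by
      rw [Nat.factorial_mul_ascFactorial, mul_add, mul_one]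
    have e4 : Nat.factorial (6 * (m + 1)) = Nat.factorial (6 * m) * Nat.ascFactorial (6 * m + 1) 6 := by
      rw [Nat.factorial_mul_ascFactorial, mul_add, mul_one]
    have hs : Nat.ascFactorial (30 * m + 1) 30 * (m + 1) ≤ 2 ^ 40 *
        (Nat.ascFactorial (15 * m + 1) 15 * Nat.ascFactorial (10 * m + 1) 10 * Nat.ascFactorial (6 * m + 1) 6) := by
      have h0 := cheb_step (30 * m)
      have q1 : Nat.ascFactorial (30 * m + 1) 30 * (30 * m + 30) ≤ (2 ^ 15 * Nat.ascFactorial (15 * m + 1) 15) *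
          (3 ^ 10 * Nat.ascFactorial (10 * m + 1) 10) * (5 ^ 6 * Nat.ascFactorial (6 * m + 1) 6) := by
        have p1 : ∀ c a k : ℕ, c ^ k * Nat.ascFactorial (a + 1) k = ∏ i ∈ range k, (c * a + c * (i + 1)) := by
          intro c a k
          have : c ^ k = ∏ i ∈ range k, c := by simp
          rw [Nat.ascFactorial_eq_prod_range, this, ← Finset.prod_mul_distrib]
          refine Finset.prod_congr rfl fun i _ => by ring
        rw [p1, p1, p1, Nat.ascFactorial_eq_prod_range]
        simp only [Finset.prod_range_succ, Finset.prod_range_zero, one_mul]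
        norm_num only [← mul_assoc] at h0 ⊢
        exact h0
      have hA : 2 ^ 14 * 3 ^ 9 * 5 ^ 5 ≤ 2 ^ 40 := by norm_num
      have q2 := Nat.mul_le_mul_right (Nat.ascFactorial (15 * m + 1) 15 * Nat.ascFactorial (10 * m + 1) 10 * Nat.ascFactorial (6 * m + 1) 6) hA
      refine le_trans ?_ q2
      refine Nat.le_of_mul_le_mul_left ?_ (show 0 < 30 by norm_num)
      calc _ = _ := ?_
        _ ≤ _ := q1
        _ = _ := ?_
      · ring
      · ring
    rw [e1, e2, e3, e4, Nat.factorial_succ, pow_succ]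
    calc _ = (Nat.factorial (30 * m) * Nat.factorial m) * (Nat.ascFactorial (30 * m + 1) 30 * (m + 1)) := by ring
      _ ≤ _ := Nat.mul_le_mul ih hs
      _ = _ := by ring

theorem cheb_rec (m : ℕ) (hm : 1 ≤ m) : Nat.lcmUpto (30 * m) ≤ Nat.lcmUpto (5 * m) * (2 ^ 40) ^ m := by
  have h1 := Nat.le_of_dvd (Nat.mul_pos (Nat.lcmUpto_pos _) (Nat.mul_pos (Nat.factorial_pos _) (Nat.factorial_pos _))) (cheb_dvd m hm)
  have h2 := Nat.mul_le_mul_left (Nat.lcmUpto (5 * m)) (cheb_fact m)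
  have hF : 0 < Nat.factorial (15 * m) * Nat.factorial (10 * m) * Nat.factorial (6 * m) :=
    Nat.mul_pos (Nat.mul_pos (Nat.factorial_pos _) (Nat.factorial_pos _)) (Nat.factorial_pos _)
  refine Nat.le_of_mul_le_mul_right ?_ hF
  rw [mul_assoc (Nat.lcmUpto (5 * m))]
  exact h1.trans h2

theorem lcmUpto_mono' {a b : ℕ} (h : a ≤ b) : Nat.lcmUpto a ≤ Nat.lcmUpto b := by
  refine Nat.le_of_dvd (Nat.lcmUpto_pos _) ?_
  exact Finset.lcm_mono (Finset.Icc_subset_Icc le_rfl h)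

/-- Chebyshev type bound -/
theorem cheb : ∃ K : ℝ, 0 ≤ K ∧ ∀ N : ℕ, Real.log (Nat.lcmUpto N) ≤ K + 1.61 * N * Real.log 2 := by
  have hl2 : 0 < Real.log 2 := Real.log_pos (by norm_num)
  have hpos : ∀ N, (0 : ℝ) < Nat.lcmUpto N := fun N => by exact_mod_cast Nat.lcmUpto_pos N
  have hK : 0 ≤ Real.log (Nat.lcmUpto 6000) := Real.log_natCast_nonneg _
  refine ⟨Real.log (Nat.lcmUpto 6000), hK, fun N => ?_⟩
  induction N using Nat.strong_induction_on with
  | _ N ih =>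
    by_cases hN : N ≤ 6000
    · have := Real.log_le_log (hpos N) (by exact_mod_cast lcmUpto_mono' hN : (Nat.lcmUpto N : ℝ) ≤ Nat.lcmUpto 6000)
      have : 0 ≤ 1.61 * (N : ℝ) * Real.log 2 := by positivity
      linarith
    · set m := N / 30 + 1 with hm
      have h1 : Real.log (Nat.lcmUpto N) ≤ Real.log (Nat.lcmUpto (5 * m)) + m * (40 * Real.log 2) := by
        have h3 : Nat.lcmUpto N ≤ Nat.lcmUpto (5 * m) * (2 ^ 40) ^ m :=
          (lcmUpto_mono' (by omega)).trans (cheb_rec m (by omega))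
        have h4 : (Nat.lcmUpto N : ℝ) ≤ Nat.lcmUpto (5 * m) * (2 ^ 40) ^ m := by exact_mod_cast h3
        have h5 := Real.log_le_log (hpos N) h4
        rw [Real.log_mul (hpos _).ne' (by positivity), Real.log_pow, Real.log_pow] at h5
        exact_mod_cast h5
      have h2 := ih (5 * m) (by omega)
      have h6 : (30 * m : ℝ) ≤ N + 30 := by
        have : 30 * m ≤ N + 30 := by omega
        exact_mod_cast this
      have h7 : (6000 : ℝ) ≤ N := by
        have : 6000 ≤ N := by omega
        exact_mod_cast this
      push_cast at h2
      have h8 : 1.61 * (5 * (m : ℝ)) + 40 * m ≤ 1.61 * N := by linarith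
      have h9 := mul_le_mul_of_nonneg_right h8 hl2.le
      linarith
end

section
/-- archimedean coefficient growth -/
def Gr (a M : ℚ) (F : PowerSeries ℚ) : Prop :=
  0 ≤ M ∧ 0 ≤ a ∧ ∀ j, |PowerSeries.coeff j F| ≤ M * a ^ j

theorem pow_add_bd {a b : ℚ} (ha : 0 ≤ a) (hb : 0 ≤ b) (j : ℕ) :
    ∑ x ∈ antidiagonal j, a ^ x.1 * b ^ x.2 ≤ (a + b) ^ j := by
  rw [(Commute.all a b).add_pow']
  refine Finset.sum_le_sum fun x hx => ?_
  rw [nsmul_eq_mul]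
  have h1 : 1 ≤ (j.choose x.1 : ℚ) := by
    rw [Finset.HasAntidiagonal.mem_antidiagonal] at hx
    exact_mod_cast Nat.choose_pos (by omega)
  exact le_mul_of_one_le_left (by positivity) h1

theorem Gr.mul {a b M N : ℚ} {F G : PowerSeries ℚ} (hF : Gr a M F) (hG : Gr b N G) :
    Gr (a + b) (M * N) (F * G) := by
  obtain ⟨m1, a1, f1⟩ := hF
  obtain ⟨m2, a2, f2⟩ := hG
  refine ⟨mul_nonneg m1 m2, add_nonneg a1 a2, fun j => ?_⟩
  rw [PowerSeries.coeff_mul]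
  refine (Finset.abs_sum_le_sum_abs _ _).trans ?_
  calc _ ≤ ∑ x ∈ antidiagonal j, M * N * (a ^ x.1 * b ^ x.2) := by
        refine Finset.sum_le_sum fun x _ => ?_
        rw [abs_mul]
        calc _ ≤ (M * a ^ x.1) * (N * b ^ x.2) :=
              mul_le_mul (f1 _) (f2 _) (abs_nonneg _) (mul_nonneg m1 (pow_nonneg a1 _))
          _ = _ := by ring
    _ ≤ _ := by
        rw [← Finset.mul_sum]
        exact mul_le_mul_of_nonneg_left (pow_add_bd a1 a2 j) (mul_nonneg m1 m2)

theorem Gr.mono {a b M : ℚ} {F : PowerSeries ℚ} (hF : Gr a M F) (h : a ≤ b) : Gr b M F :=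
  ⟨hF.1, hF.2.1.trans h, fun j => (hF.2.2 j).trans
    (mul_le_mul_of_nonneg_left (pow_le_pow_left₀ hF.2.1 h j) hF.1)⟩

theorem Gr.one : Gr 0 1 1 := by
  refine ⟨zero_le_one, le_refl _, fun j => ?_⟩
  rw [PowerSeries.coeff_one]
  split_ifs with h
  · simp [h]
  · simp

theorem Gr.prod {ι : Type*} (s : Finset ι) {a M : ι → ℚ} {F : ι → PowerSeries ℚ}
    (h : ∀ i ∈ s, Gr (a i) (M i) (F i)) : Gr (∑ i ∈ s, a i) (∏ i ∈ s, M i) (∏ i ∈ s, F i) := by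
  classical
  induction s using Finset.induction_on with
  | empty => simpa using Gr.one
  | insert x s hx ih =>
    rw [Finset.prod_insert hx, Finset.prod_insert hx, Finset.sum_insert hx]
    exact (h x (Finset.mem_insert_self _ _)).mul (ih fun i hi => h i (Finset.mem_insert_of_mem hi))

theorem Gr.pow {a M : ℚ} {F : PowerSeries ℚ} (h : Gr a M F) (m : ℕ) : Gr (m * a) (M ^ m) (F ^ m) := by
  have := Gr.prod (range m) (M := fun _ => M) (F := fun _ => F) (a := fun _ => a) (fun _ _ => h)
  simpa using this

theorem Gr.lin {d : ℚ} (h : 1 / 2 ≤ |d|) : Gr 2 |d| (PowerSeries.C d + PowerSeries.X) := by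
  refine ⟨abs_nonneg d, by norm_num, fun j => ?_⟩
  rw [map_add, PowerSeries.coeff_C, PowerSeries.coeff_X]
  rcases j with _ | _ | j
  · simp
  · simp
    linarith
  · simp

theorem Gr.inv {d : ℚ} (h : 1 / 2 ≤ |d|) : Gr 2 |d|⁻¹ (PowerSeries.C d + PowerSeries.X)⁻¹ := by
  have hd : 0 < |d| := lt_of_lt_of_le (by norm_num) h
  refine ⟨inv_nonneg.2 hd.le, by norm_num, fun j => ?_⟩
  rw [inv_coeff d (abs_pos.1 hd), abs_mul, abs_pow, abs_neg, abs_inv]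
  refine mul_le_mul_of_nonneg_left (pow_le_pow_left₀ (inv_nonneg.2 hd.le) ?_ j) (inv_nonneg.2 hd.le)
  rw [inv_le_comm₀ hd (by norm_num)]
  linarith

theorem half_abs (y : ℤ) : 1 / 2 ≤ |(y : ℚ) + 1 / 2| := by
  rcases lt_or_ge y 0 with h | h
  · have : (y : ℚ) ≤ -1 := by exact_mod_cast (by omega : y ≤ -1)
    rw [abs_of_neg (by linarith)]; linarith
  · have : (0 : ℚ) ≤ y := by exact_mod_cast h
    rw [abs_of_nonneg (by linarith)]; linarith

/-- the archimedean size of the brick -/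
noncomputable def BB (n : ℕ) (p : ℤ) : ℚ := ZP (n : ℤ) (fun z => |(p : ℚ) + 1 / 2 - z|) *
  (PP (n : ℤ) (fun q => if q = p then 1 else |(p : ℚ) - q|))⁻¹

theorem bb_arch (n : ℕ) (hn : 1 ≤ n) (p : ℤ) (hp : p ∈ Pol n) (j : ℕ) :
    |bb n p j| ≤ BB n p ^ 3 * (576 * n) ^ j := by
  have hZ : ∀ z : ℤ, Gr 2 |(p : ℚ) + 1 / 2 - z| (PowerSeries.C (((p : ℚ) + 1 / 2) - (z : ℚ)) + PowerSeries.X) := by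
    intro z
    refine Gr.lin ?_
    have := half_abs (p - z)
    push_cast at this
    convert this using 2
    ring
  have hP : ∀ q ∈ (Pol n).erase p, Gr ((3 * tau n q : ℕ) * 2) ((|(p : ℚ) - q|⁻¹) ^ (3 * tau n q))
      (((PowerSeries.C (((p : ℚ) + 1 / 2) - ((q : ℚ) + 1 / 2)) + PowerSeries.X)⁻¹) ^ (3 * tau n q)) := by
    intro q hq
    rw [mem_erase] at hq
    refine Gr.pow ?_ _
    have e : ((p : ℚ) + 1 / 2) - ((q : ℚ) + 1 / 2) = (p : ℚ) - q := by ring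
    rw [e]
    refine Gr.inv ?_
    have : 1 ≤ |p - q| := Int.one_le_abs (sub_ne_zero.2 (Ne.symm hq.1))
    have h1 : (1 : ℚ) ≤ |(p : ℚ) - q| := by exact_mod_cast this
    linarith
  have hZP : Gr (96 * n) (ZP (n : ℤ) (fun z => |(p : ℚ) + 1 / 2 - z|))
      (ZP (n : ℤ) fun z => (PowerSeries.C (((p : ℚ) + 1 / 2) - (z : ℚ)) + PowerSeries.X : PowerSeries ℚ)) := by
    have h := (((Gr.prod (Ioc (-4 * (n : ℤ)) (4 * n)) fun z _ => hZ z).pow 2).mul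
      (Gr.prod (Ioo (-10 * (n : ℤ)) (6 * n)) fun z _ => hZ z)).mul (Gr.prod (Ioc (-6 * (n : ℤ)) (10 * n)) fun z _ => hZ z)
    refine Gr.mono h ?_
    simp only [Finset.sum_const, Int.card_Ioc, Int.card_Ioo, nsmul_eq_mul]
    have e1 : (4 * (n : ℤ) - -4 * n).toNat = 8 * n := by omega
    have e2 : (6 * (n : ℤ) - -10 * n - 1).toNat ≤ 16 * n := by omega
    have e3 : (10 * (n : ℤ) - -6 * n).toNat = 16 * n := by omega
    have e4 : ((6 * (n : ℤ) - -10 * n - 1).toNat : ℚ) ≤ 16 * n := by exact_mod_cast e2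
    rw [e1, e3]
    push_cast
    linarith
  have hB := (hZP.pow 3).mul (Gr.prod _ hP)
  have hsum : ∑ q ∈ (Pol n).erase p, ((3 * tau n q : ℕ) : ℚ) * 2 ≤ 288 * n := by
    rw [← Finset.sum_mul]
    have h1 : ∑ q ∈ (Pol n).erase p, (3 * tau n q) ≤ 144 * n := by
      rw [← tau_sum n]
      exact Finset.sum_le_sum_of_subset (Finset.erase_subset _ _)
    have h2 : ∑ q ∈ (Pol n).erase p, ((3 * tau n q : ℕ) : ℚ) ≤ 144 * n := by exact_mod_cast h1
    linarith
  have h3 := (hB.mono (b := 576 * n) (by push_cast at *; linarith)).2.2 j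
  have e1 : bb n p j = PowerSeries.coeff j ((ZP (n : ℤ) fun z => (PowerSeries.C (((p : ℚ) + 1 / 2) - (z : ℚ)) + PowerSeries.X : PowerSeries ℚ)) ^ 3 *
    ∏ q ∈ (Pol n).erase p, ((PowerSeries.C (((p : ℚ) + 1 / 2) - ((q : ℚ) + 1 / 2)) + PowerSeries.X)⁻¹) ^ (3 * tau n q)) := by
    rw [bb, Psi, Nm_aeval]
  rw [← e1] at h3
  refine h3.trans (le_of_eq ?_)
  congr 1
  rw [BB, mul_pow]
  congr 1
  rw [PP_eq, ← Finset.prod_erase_mul _ _ hp, if_pos rfl, one_pow, mul_one, ← Finset.prod_inv_distrib, ← Finset.prod_pow]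
  refine Finset.prod_congr rfl fun q hq => ?_
  rw [if_neg (mem_erase.1 hq).1, inv_pow, inv_pow, ← pow_mul, mul_comm]
end

section
/-- `x log x` -/
noncomputable def psi' (x : ℝ) : ℝ := x * Real.log x

theorem psi'_neg (x : ℝ) : psi' (-x) = -psi' x := by
  simp [psi']

noncomputable def phi' (x : ℝ) : ℝ := psi' x - x

theorem phi'_neg (x : ℝ) : phi' (-x) = -phi' x := by
  rw [phi', phi', psi'_neg]; ring

theorem phi'_lo {x : ℝ} (hx : 0 < x) : Real.log x ≤ phi' (x + 1) - phi' x := by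
  have h1 := Real.one_sub_inv_le_log_of_pos (div_pos (by linarith : 0 < x + 1) hx)
  rw [Real.log_div (by linarith) (by linarith), inv_div] at h1
  have h2 := mul_le_mul_of_nonneg_left h1 (by linarith : 0 ≤ x + 1)
  have e : (x + 1) * (1 - x / (x + 1)) = 1 := by field_simp; ring
  rw [e] at h2
  unfold phi' psi'
  linarith

theorem phi'_hi {x : ℝ} (hx : 0 < x) : phi' (x + 1) - phi' x ≤ Real.log (x + 1) := by
  have h1 := Real.log_le_sub_one_of_pos (div_pos (by linarith : 0 < x + 1) hx)
  rw [Real.log_div (by linarith) (by linarith)] at h1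
  have h2 := mul_le_mul_of_nonneg_left h1 hx.le
  have e : x * ((x + 1) / x - 1) = 1 := by field_simp; ring
  rw [e] at h2
  unfold phi' psi'
  linarith

noncomputable def Del (x : ℤ) : ℝ := phi' x + (x.sign : ℝ) * (Real.log x + 1)
noncomputable def Del' (x : ℤ) : ℝ := phi' x - (x.sign : ℝ) * Real.log x

theorem Del_neg (x : ℤ) : Del (-x) = -Del x := by
  unfold Del
  rw [Int.sign_neg]
  push_cast
  rw [phi'_neg, Real.log_neg_eq_log]
  ring

theorem Del'_neg (x : ℤ) : Del' (-x) = -Del' x := by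
  unfold Del'
  rw [Int.sign_neg]
  push_cast
  rw [phi'_neg, Real.log_neg_eq_log]
  ring

theorem Del_step_pos (x : ℤ) (hx : 0 ≤ x) : Real.log ((x : ℝ) + 1 / 2) ≤ Del (x + 1) - Del x := by
  rcases hx.eq_or_lt with rfl | hx
  · simp [Del, phi', psi']
    exact Real.log_nonneg (by norm_num)
  · have hx' : (0 : ℝ) < x := by exact_mod_cast hx
    have h1 := phi'_lo hx'
    have h2 : Real.log ((x : ℝ) + 1 / 2) ≤ Real.log (x + 1) := Real.log_le_log (by linarith) (by linarith)
    rw [Del, Del, Int.sign_eq_one_of_pos hx, Int.sign_eq_one_of_pos (by omega)]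
    push_cast
    linarith

theorem Del_step (x : ℤ) : Real.log ((x : ℝ) + 1 / 2) ≤ Del (x + 1) - Del x := by
  rcases lt_or_ge x 0 with h | h
  · have h1 := Del_step_pos (-x - 1) (by omega)
    rw [show -x - 1 + 1 = -x by ring, Del_neg, show -x - 1 = -(x + 1) by ring, Del_neg] at h1
    push_cast at h1
    rw [show -((x : ℝ) + 1) + 1 / 2 = -((x : ℝ) + 1 / 2) by ring, Real.log_neg_eq_log] at h1
    linarith
  · exact Del_step_pos x h

theorem Del'_step (x : ℤ) : Del' x - Del' (x - 1) ≤ Real.log x := by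
  have key : ∀ y : ℤ, 0 ≤ y → Del' (y + 1) - Del' y ≤ Real.log y ∧ Real.log y ≤ Real.log ((y + 1 : ℤ) : ℝ) := by
    intro y hy
    rcases hy.eq_or_lt with rfl | hy
    · simp [Del', phi', psi']
    · have hy' : (0 : ℝ) < y := by exact_mod_cast hy
      have h1 := phi'_hi hy'
      rw [Del', Del', Int.sign_eq_one_of_pos hy, Int.sign_eq_one_of_pos (by omega)]
      push_cast
      refine ⟨by linarith, Real.log_le_log hy' (by linarith)⟩
  rcases lt_or_ge 0 x with h | h
  · have := key (x - 1) (by omega)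
    rw [sub_add_cancel] at this
    exact this.1.trans this.2
  · have := (key (-x) (by omega)).1
    rw [show -x + 1 = -(x - 1) by ring, Del'_neg, Del'_neg] at this
    push_cast at this
    rw [Real.log_neg_eq_log] at this
    linarith

theorem sum_tel (g E : ℤ → ℝ) (h : ∀ z, g z ≤ E (z + 1) - E z) (u v : ℤ) (huv : u ≤ v) :
    ∑ z ∈ Ico u v, g z ≤ E v - E u := by
  induction v, huv using Int.leInduction with
  | base => simp
  | succ v hv ih =>
    have e : Ico u (v + 1) = insert v (Ico u v) := by
      ext x
      simp only [mem_insert, mem_Ico]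
      omega
    rw [e, Finset.sum_insert (by simp)]
    have := h v
    linarith

theorem log_bd (n : ℕ) (hn : 1 ≤ n) (x : ℤ) (hx : |x| ≤ 22 * n) :
    |Del x - phi' x| ≤ Real.log (22 * n) + 1 ∧ |Del' x - phi' x| ≤ Real.log (22 * n) + 1 := by
  have hn' : (1 : ℝ) ≤ n := by exact_mod_cast hn
  have h0 : 0 ≤ Real.log (22 * n) := Real.log_nonneg (by linarith)
  have h1 : 0 ≤ Real.log x := by
    rw [← Real.log_abs, ← Int.cast_abs]
    exact Real.log_intCast_nonneg _
  have h2 : Real.log x ≤ Real.log (22 * n) := by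
    by_cases h : x = 0
    · subst h; simpa using h0
    rw [← Real.log_abs, ← Int.cast_abs]
    refine Real.log_le_log ?_ (by exact_mod_cast hx)
    exact_mod_cast abs_pos.2 h
  have hs : |(x.sign : ℝ)| ≤ 1 := by
    rcases lt_trichotomy x 0 with h | h | h
    · rw [Int.sign_eq_neg_one_of_neg h]; simp
    · rw [h]; simp
    · rw [Int.sign_eq_one_of_pos h]; simp
  constructor
  · rw [Del, add_sub_cancel_left, abs_mul, abs_of_nonneg (by linarith : 0 ≤ Real.log (x : ℝ) + 1)]
    have := mul_le_mul hs (by linarith : Real.log (x : ℝ) + 1 ≤ Real.log (22 * n) + 1) (by linarith) zero_le_one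
    linarith
  · rw [Del', sub_sub_cancel_left, abs_neg, abs_mul, abs_of_nonneg h1]
    have := mul_le_mul hs h2 h1 zero_le_one
    linarith

theorem zero_sum (p u v : ℤ) (huv : u ≤ v) :
    ∑ z ∈ Ico u v, Real.log ((p : ℝ) + 1 / 2 - z) ≤ Del (p - u + 1) - Del (p - v + 1) := by
  have := sum_tel (fun z => Real.log ((p : ℝ) + 1 / 2 - z)) (fun z => -Del (p - z + 1)) (by
    intro z
    have h := Del_step (p - z)
    push_cast at h
    rw [show (p : ℝ) - z + 1 / 2 = (p : ℝ) + 1 / 2 - z by ring] at h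
    rw [show p - (z + 1) + 1 = p - z by ring]
    linarith) u v huv
  linarith

theorem pole_sum (p u v : ℤ) (huv : u ≤ v) :
    Del' (p - u) - Del' (p - v) ≤ ∑ z ∈ Ico u v, Real.log ((p : ℝ) - z) := by
  have := sum_tel (fun z => -Real.log ((p : ℝ) - z)) (fun z => Del' (p - z)) (by
    intro z
    have h := Del'_step (p - z)
    push_cast at h
    rw [show p - (z + 1) = p - z - 1 by ring]
    linarith) u v huv
  simp only [Finset.sum_neg_distrib] at this
  linarith

theorem log_BB (n : ℕ) (hn : 1 ≤ n) (p : ℤ) (hp : p ∈ Pol n) : 0 < BB n p ∧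
    Real.log (BB n p) ≤ 2 * (psi' (p + 4 * n) - psi' (p - 4 * n)) + (psi' (p + 6 * n) - psi' (p - 6 * n)) +
    (psi' (p + 10 * n) - psi' (p - 10 * n)) - (psi' (p + 5 * n) - psi' (p - 5 * n)) - (psi' (p + 8 * n) - psi' (p - 8 * n))
    - (psi' (p + 11 * n) - psi' (p - 11 * n)) + 14 * (Real.log (22 * n) + 1) + Real.log 2 := by
  have hz : ∀ z : ℤ, 0 < |(p : ℚ) + 1 / 2 - z| := by
    intro z
    have := half_abs (p - z)
    push_cast at this
    rw [show (p : ℚ) - z + 1 / 2 = (p : ℚ) + 1 / 2 - z by ring] at this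
    linarith
  have hq : ∀ q : ℤ, 0 < (if q = p then (1 : ℚ) else |(p : ℚ) - q|) := by
    intro q
    split_ifs with h
    · exact one_pos
    · rw [abs_pos, sub_ne_zero]
      exact_mod_cast Ne.symm h
  have hzp : ∀ s : Finset ℤ, 0 < ∏ z ∈ s, |(p : ℚ) + 1 / 2 - z| := fun s => Finset.prod_pos fun z _ => hz z
  have hqp : ∀ s : Finset ℤ, 0 < ∏ q ∈ s, (if q = p then (1 : ℚ) else |(p : ℚ) - q|) := fun s => Finset.prod_pos fun z _ => hq z
  have lz : ∀ s : Finset ℤ, Real.log ((∏ z ∈ s, |(p : ℚ) + 1 / 2 - z| : ℚ) : ℝ) = ∑ z ∈ s, Real.log ((p : ℝ) + 1 / 2 - z) := by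
    intro s
    rw [Rat.cast_prod, Real.log_prod (fun z _ => by exact_mod_cast (hz z).ne')]
    refine Finset.sum_congr rfl fun z _ => ?_
    push_cast
    rw [Real.log_abs]
  have lq : ∀ s : Finset ℤ, Real.log ((∏ q ∈ s, (if q = p then (1 : ℚ) else |(p : ℚ) - q|) : ℚ) : ℝ) = ∑ z ∈ s, Real.log ((p : ℝ) - z) := by
    intro s
    rw [Rat.cast_prod, Real.log_prod (fun z _ => by exact_mod_cast (hq z).ne')]
    refine Finset.sum_congr rfl fun z _ => ?_
    split_ifs with h
    · rw [h]; simp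
    · push_cast
      rw [Real.log_abs]
  have hB : 0 < BB n p := by
    unfold BB ZP PP
    have a1 := hzp (Ioc (-4 * (n : ℤ)) (4 * n))
    have a2 := hzp (Ioo (-10 * (n : ℤ)) (6 * n))
    have a3 := hzp (Ioc (-6 * (n : ℤ)) (10 * n))
    have b1 := hqp (Ico (-5 * (n : ℤ)) (5 * n))
    have b2 := hqp (Ico (-8 * (n : ℤ)) (8 * n))
    have b3 := hqp (Ico (-11 * (n : ℤ)) (11 * n))
    exact mul_pos (mul_pos (mul_pos (pow_pos a1 2) a2) a3) (inv_pos.2 (mul_pos (mul_pos b1 b2) b3))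
  refine ⟨hB, ?_⟩
  have hlog : Real.log (BB n p) = 2 * ∑ z ∈ Ioc (-4 * (n : ℤ)) (4 * n), Real.log ((p : ℝ) + 1 / 2 - z) +
      ∑ z ∈ Ioo (-10 * (n : ℤ)) (6 * n), Real.log ((p : ℝ) + 1 / 2 - z) +
      ∑ z ∈ Ioc (-6 * (n : ℤ)) (10 * n), Real.log ((p : ℝ) + 1 / 2 - z) -
      (∑ z ∈ Ico (-5 * (n : ℤ)) (5 * n), Real.log ((p : ℝ) - z) + ∑ z ∈ Ico (-8 * (n : ℤ)) (8 * n), Real.log ((p : ℝ) - z) +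
      ∑ z ∈ Ico (-11 * (n : ℤ)) (11 * n), Real.log ((p : ℝ) - z)) := by
    rw [← lz, ← lz, ← lz, ← lq, ← lq, ← lq, BB, ZP, PP]
    have c1 : ∀ s : Finset ℤ, ((∏ z ∈ s, |(p : ℚ) + 1 / 2 - z| : ℚ) : ℝ) ≠ 0 := fun s => by exact_mod_cast (hzp s).ne'
    have c2 : ∀ s : Finset ℤ, ((∏ q ∈ s, (if q = p then (1 : ℚ) else |(p : ℚ) - q|) : ℚ) : ℝ) ≠ 0 := fun s => by exact_mod_cast (hqp s).ne'
    rw [Rat.cast_mul, Rat.cast_mul, Rat.cast_mul, Rat.cast_pow, Rat.cast_inv, Rat.cast_mul, Rat.cast_mul]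
    rw [Real.log_mul (mul_ne_zero (mul_ne_zero (pow_ne_zero 2 (c1 _)) (c1 _)) (c1 _)) (inv_ne_zero (mul_ne_zero (mul_ne_zero (c2 _) (c2 _)) (c2 _))),
      Real.log_mul (mul_ne_zero (pow_ne_zero 2 (c1 _)) (c1 _)) (c1 _), Real.log_mul (pow_ne_zero 2 (c1 _)) (c1 _), Real.log_pow,
      Real.log_inv, Real.log_mul (mul_ne_zero (c2 _) (c2 _)) (c2 _), Real.log_mul (c2 _) (c2 _)]
    push_cast
    ring
  have ioc : ∀ a b : ℤ, Ioc a b = Ico (a + 1) (b + 1) := by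
    intro a b; ext x; simp only [mem_Ioc, mem_Ico]; omega
  have ioo : ∀ a b : ℤ, Ioo a b = Ico (a + 1) b := by
    intro a b; ext x; simp only [mem_Ioo, mem_Ico]; omega
  rw [hlog, ioc, ioc, ioo]
  have z1 := zero_sum p (-4 * (n : ℤ) + 1) (4 * n + 1) (by omega)
  have z2 := zero_sum p (-10 * (n : ℤ) + 1) (6 * n) (by omega)
  have z3 := zero_sum p (-6 * (n : ℤ) + 1) (10 * n + 1) (by omega)
  have p1 := pole_sum p (-5 * (n : ℤ)) (5 * n) (by omega)
  have p2 := pole_sum p (-8 * (n : ℤ)) (8 * n) (by omega)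
  have p3 := pole_sum p (-11 * (n : ℤ)) (11 * n) (by omega)
  have z4 := Del_step (p - 6 * n)
  have z5 : -Real.log 2 ≤ Real.log (((p - 6 * n : ℤ) : ℝ) + 1 / 2) := by
    rw [← Real.log_inv, ← Real.log_abs (_ + _)]
    refine Real.log_le_log (by norm_num) ?_
    have := half_abs (p - 6 * n)
    rw [inv_eq_one_div]
    have h2 : (((1 / 2 : ℚ)) : ℝ) ≤ ((|((p - 6 * n : ℤ) : ℚ) + 1 / 2| : ℚ) : ℝ) := by exact_mod_cast this
    push_cast at h2 ⊢
    exact h2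
  rw [Pol, mem_Ico] at hp
  have ab : ∀ x : ℤ, x ≤ 22 * n → -(22 * n) ≤ x → _ := fun x h1 h2 => log_bd n hn x (abs_le.2 ⟨h2, h1⟩)
  have d : ∀ x : ℤ, x ≤ 22 * n → -(22 * n) ≤ x → Del x ≤ phi' x + (Real.log (22 * n) + 1) ∧ phi' x - (Real.log (22 * n) + 1) ≤ Del x ∧
      Del' x ≤ phi' x + (Real.log (22 * n) + 1) ∧ phi' x - (Real.log (22 * n) + 1) ≤ Del' x := by
    intro x h1 h2
    obtain ⟨h3, h4⟩ := ab x h1 h2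
    rw [abs_le] at h3 h4
    refine ⟨?_, ?_, ?_, ?_⟩ <;> linarith
  rw [show p - (-4 * (n : ℤ) + 1) + 1 = p + 4 * n by ring, show p - (4 * (n : ℤ) + 1) + 1 = p - 4 * n by ring] at z1
  rw [show p - (-10 * (n : ℤ) + 1) + 1 = p + 10 * n by ring] at z2
  rw [show p - (-6 * (n : ℤ) + 1) + 1 = p + 6 * n by ring, show p - (10 * (n : ℤ) + 1) + 1 = p - 10 * n by ring] at z3
  rw [show p - -5 * (n : ℤ) = p + 5 * n by ring] at p1
  rw [show p - -8 * (n : ℤ) = p + 8 * n by ring] at p2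
  rw [show p - -11 * (n : ℤ) = p + 11 * n by ring] at p3
  have k1 := (d (p + 4 * n) (by omega) (by omega)).1
  have k2 := (d (p - 4 * n) (by omega) (by omega)).2.1
  have k3 := (d (p + 10 * n) (by omega) (by omega)).1
  have k4 := (d (p - 6 * n) (by omega) (by omega)).2.1
  have k5 := (d (p + 6 * n) (by omega) (by omega)).1
  have k6 := (d (p - 10 * n) (by omega) (by omega)).2.1
  have l1 := (d (p + 5 * n) (by omega) (by omega)).2.2.2
  have l2 := (d (p - 5 * n) (by omega) (by omega)).2.2.1
  have l3 := (d (p + 8 * n) (by omega) (by omega)).2.2.2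
  have l4 := (d (p - 8 * n) (by omega) (by omega)).2.2.1
  have l5 := (d (p + 11 * n) (by omega) (by omega)).2.2.2
  have l6 := (d (p - 11 * n) (by omega) (by omega)).2.2.1
  simp only [phi'] at k1 k2 k3 k4 k5 k6 l1 l2 l3 l4 l5 l6
  push_cast at *
  linarith
end

section
noncomputable def FF (a t : ℝ) : ℝ := psi' (a + t) + psi' (a - t)

theorem FF_even (a t : ℝ) : FF a (-t) = FF a t := by
  unfold FF
  rw [sub_neg_eq_add, ← sub_eq_add_neg, add_comm]

theorem FF_abs (a t : ℝ) : FF a |t| = FF a t := by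
  rcases abs_choice t with h | h <;> rw [h]
  exact FF_even a t

theorem conv_incr {u v d : ℝ} (hu : 0 ≤ u) (huv : u ≤ v) (hd : 0 ≤ d) :
    psi' (u + d) - psi' u ≤ psi' (v + d) - psi' v := by
  have hcc : ∀ x y : ℝ, 0 ≤ x → 0 ≤ y → ∀ a b : ℝ, 0 ≤ a → 0 ≤ b → a + b = 1 →
      psi' (a * x + b * y) ≤ a * psi' x + b * psi' y := fun x y hx hy a b ha hb hab =>
    Real.convexOn_mul_log.2 hx hy ha hb hab
  rcases huv.eq_or_lt with rfl | huv
  · exact le_refl _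
  rcases hd.eq_or_lt with rfl | hd
  · simp
  have hw : 0 < v + d - u := by linarith
  have h1 := hcc u (v + d) hu (by linarith) ((v - u) / (v + d - u)) (d / (v + d - u))
    (div_nonneg (by linarith) hw.le) (div_nonneg (by linarith) hw.le) (by field_simp; ring)
  have h2 := hcc u (v + d) hu (by linarith) (d / (v + d - u)) ((v - u) / (v + d - u))
    (div_nonneg (by linarith) hw.le) (div_nonneg (by linarith) hw.le) (by field_simp; ring)
  have e1 : (v - u) / (v + d - u) * u + d / (v + d - u) * (v + d) = u + d := by
    field_simp; ring
  have e2 : d / (v + d - u) * u + (v - u) / (v + d - u) * (v + d) = v := by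
    field_simp; ring
  rw [e1] at h1
  rw [e2] at h2
  have e3 : (v - u) / (v + d - u) + d / (v + d - u) = 1 := by field_simp; ring
  have e4 : (v - u) / (v + d - u) * psi' u + d / (v + d - u) * psi' u = psi' u := by rw [← add_mul, e3, one_mul]
  have e5 : (v - u) / (v + d - u) * psi' (v + d) + d / (v + d - u) * psi' (v + d) = psi' (v + d) := by rw [← add_mul, e3, one_mul]
  linarith

theorem FF_mono {a s t : ℝ} (ha : 0 ≤ a) (hs : 0 ≤ s) (hst : s ≤ t) : FF a s ≤ FF a t := by
  have m1 : ∀ s t : ℝ, 0 ≤ s → s ≤ t → t ≤ a → FF a s ≤ FF a t := by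
    intro s t hs hst hta
    have := conv_incr (u := a - t) (v := a + s) (d := t - s) (by linarith) (by linarith) (by linarith)
    rw [show a - t + (t - s) = a - s by ring, show a + s + (t - s) = a + t by ring] at this
    unfold FF
    linarith
  have m2 : ∀ s t : ℝ, a ≤ s → s ≤ t → FF a s ≤ FF a t := by
    intro s t hs hst
    have := conv_incr (u := s - a) (v := s + a) (d := t - s) (by linarith) (by linarith) (by linarith)
    rw [show s - a + (t - s) = t - a by ring, show s + a + (t - s) = t + a by ring] at this
    unfold FF
    rw [show a - s = -(s - a) by ring, show a - t = -(t - a) by ring, psi'_neg, psi'_neg, add_comm a s, add_comm a t]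
    linarith
  rcases le_total t a with h | h
  · exact m1 s t hs hst h
  · rcases le_total s a with h' | h'
    · exact (m1 s a hs h' le_rfl).trans (m2 a t le_rfl h)
    · exact m2 s t h' hst

theorem psi'_scale {c : ℝ} (hc : 0 < c) (x : ℝ) : psi' (c * x) = c * psi' x + c * x * Real.log c := by
  unfold psi'
  by_cases hx : x = 0
  · simp [hx]
  · rw [Real.log_mul hc.ne' hx]; ring

theorem FF_scale {c : ℝ} (hc : 0 < c) (a t : ℝ) : FF (c * a) (c * t) = c * FF a t + 2 * c * a * Real.log c := by
  unfold FF
  rw [← mul_add, ← mul_sub, psi'_scale hc, psi'_scale hc]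
  ring

def epl (k : ℤ) : ℕ := k.natAbs ^ k.toNat
def emi (k : ℤ) : ℕ := k.natAbs ^ (-k).toNat

theorem psi'_int (k : ℤ) : psi' k = Real.log (epl k) - Real.log (emi k) := by
  unfold psi' epl emi
  push_cast
  rw [Real.log_pow, Real.log_pow, Nat.cast_natAbs, Int.cast_abs, Real.log_abs, ← sub_mul]
  congr 1
  have : k = (k.toNat : ℤ) - ((-k).toNat : ℤ) := by omega
  exact_mod_cast this

def numer (i : ℤ) : ℕ := (epl (16 + (i + 1)) * epl (16 - (i + 1))) ^ 2 * (epl (24 + (i + 1)) * epl (24 - (i + 1))) * (epl (40 + (i + 1)) * epl (40 - (i + 1))) *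
  ((emi (20 + i) * emi (20 - i)) * (emi (32 + i) * emi (32 - i)) * (emi (44 + i) * emi (44 - i)))
def denomi (i : ℤ) : ℕ := (emi (16 + (i + 1)) * emi (16 - (i + 1))) ^ 2 * (emi (24 + (i + 1)) * emi (24 - (i + 1))) * (emi (40 + (i + 1)) * emi (40 - (i + 1))) *
  ((epl (20 + i) * epl (20 - i)) * (epl (32 + i) * epl (32 - i)) * (epl (44 + i) * epl (44 - i)))

theorem cells : ∀ i ∈ range 44, numer (i : ℤ) ≤ 2 ^ 40 * denomi (i : ℤ) := by
  decide +kernel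

theorem epl_pos (k : ℤ) : (epl k : ℝ) ≠ 0 := by
  have : epl k ≠ 0 := by
    unfold epl
    by_cases h : k = 0
    · subst h; simp
    · exact pow_ne_zero _ (by omega)
  exact_mod_cast this

theorem emi_pos (k : ℤ) : (emi k : ℝ) ≠ 0 := by
  have : emi k ≠ 0 := by
    unfold emi
    by_cases h : k = 0
    · subst h; simp
    · exact pow_ne_zero _ (by omega)
  exact_mod_cast this

theorem cell (i : ℕ) (hi : i < 44) : 2 * FF 16 (i + 1) + FF 24 (i + 1) + FF 40 (i + 1) - FF 20 i - FF 32 i - FF 44 i ≤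
    40 * Real.log 2 := by
  have h := cells i (Finset.mem_range.2 hi)
  have h1 : Real.log (numer i) ≤ Real.log (2 ^ 40 * denomi i) := by
    refine Real.log_le_log ?_ (by exact_mod_cast h)
    refine lt_of_le_of_ne (Nat.cast_nonneg _) (Ne.symm ?_)
    unfold numer
    push_cast
    simp only [ne_eq, mul_eq_zero, pow_eq_zero_iff, epl_pos, emi_pos, or_self, not_false_eq_true, OfNat.ofNat_ne_zero]
  have cF : ∀ (a b : ℤ), FF a b = Real.log (epl (a + b)) - Real.log (emi (a + b)) + (Real.log (epl (a - b)) - Real.log (emi (a - b))) := by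
    intro a b
    rw [← psi'_int, ← psi'_int]
    push_cast
    rfl
  have e1 := cF 16 (i + 1)
  have e2 := cF 24 (i + 1)
  have e3 := cF 40 (i + 1)
  have e4 := cF 20 i
  have e5 := cF 32 i
  have e6 := cF 44 i
  unfold numer denomi at h1
  push_cast at h1 e1 e2 e3 e4 e5 e6
  simp only [Real.log_mul, Real.log_pow, epl_pos, emi_pos, mul_ne_zero, pow_ne_zero, ne_eq, not_false_eq_true, mul_eq_zero, OfNat.ofNat_ne_zero, or_self] at h1
  rw [e1, e2, e3, e4, e5, e6]
  push_cast at h1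
  linarith

theorem log_BB' (n : ℕ) (hn : 1 ≤ n) (p : ℤ) (hp : p ∈ Pol n) :
    Real.log (BB n p) ≤ 10 * n * Real.log 2 + 14 * (Real.log (22 * n) + 1) + Real.log 2 := by
  have h := (log_BB n hn p hp).2
  have hn' : (0 : ℝ) < n := by exact_mod_cast hn
  have hc : (0 : ℝ) < n / 4 := by positivity
  rw [Pol, mem_Ico] at hp
  set y : ℝ := 4 * |(p : ℝ)| / n with hy
  have hy0 : 0 ≤ y := by positivity
  have e : ∀ a : ℝ, psi' (p + a * n) - psi' (p - a * n) = n / 4 * FF (4 * a) y + 2 * a * n * Real.log (n / 4) := by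
    intro a
    have h1 : psi' (p + a * n) - psi' (p - a * n) = FF (a * n) p := by
      unfold FF
      rw [show (p : ℝ) - a * n = -(a * n - p) by ring, psi'_neg, add_comm (p : ℝ)]
      ring
    have h2 := FF_scale hc (4 * a) y
    have e3 : (n : ℝ) / 4 * y = |(p : ℝ)| := by rw [hy]; field_simp
    rw [e3, FF_abs, show (n : ℝ) / 4 * (4 * a) = a * n by ring] at h2
    rw [h1, h2]
    ring
  rw [e 4, e 5, e 6, e 8, e 10, e 11] at h
  have hpa : |(p : ℝ)| ≤ 11 * n := by
    have : |p| ≤ 11 * n := abs_le.2 ⟨by omega, by omega⟩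
    exact_mod_cast this
  have hy44 : y ≤ 44 := by
    rw [hy, div_le_iff₀ hn']; linarith
  obtain ⟨i, hi, hi1, hi2⟩ : ∃ i : ℕ, i < 44 ∧ (i : ℝ) ≤ y ∧ y ≤ i + 1 := by
    by_cases hyy : y = 44
    · exact ⟨43, by norm_num, by rw [hyy]; norm_num, by rw [hyy]; norm_num⟩
    · refine ⟨⌊y⌋₊, ?_, Nat.floor_le hy0, (Nat.lt_floor_add_one y).le⟩
      rw [Nat.floor_lt hy0]
      exact_mod_cast lt_of_le_of_ne hy44 hyy
  have hcell := cell i hi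
  have i0 : (0 : ℝ) ≤ i := Nat.cast_nonneg i
  have f1 := FF_mono (a := 16) (by norm_num) hy0 hi2
  have f2 := FF_mono (a := 24) (by norm_num) hy0 hi2
  have f3 := FF_mono (a := 40) (by norm_num) hy0 hi2
  have f4 := FF_mono (a := 20) (by norm_num) i0 hi1
  have f5 := FF_mono (a := 32) (by norm_num) i0 hi1
  have f6 := FF_mono (a := 44) (by norm_num) i0 hi1
  have f7 : 2 * FF 16 y + FF 24 y + FF 40 y - FF 20 y - FF 32 y - FF 44 y ≤ 40 * Real.log 2 := by linarith
  have f8 := mul_le_mul_of_nonneg_left f7 hc.le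
  norm_num at h f8 ⊢
  linarith
end

section
theorem log_Dn (K : ℝ) (hK : ∀ N : ℕ, Real.log (Nat.lcmUpto N) ≤ K + 1.61 * N * Real.log 2) (n : ℕ) :
    Real.log (Dn n) ≤ 22 * K + 254.38 * n * Real.log 2 := by
  have hpos : ∀ N : ℕ, (Nat.lcmUpto N : ℝ) ≠ 0 := fun N => by
    exact_mod_cast (Nat.lcmUpto_pos N).ne'
  have hl2 : 0 < Real.log 2 := Real.log_pos (by norm_num)
  unfold Dn
  push_cast
  rw [Real.log_mul (by simp [hpos]) (hpos _), Real.log_mul (by simp [hpos]) (by simp [hpos]),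
    Real.log_mul (by simp [hpos]) (by simp [hpos]), Real.log_mul (by simp [hpos]) (by simp [hpos]),
    Real.log_pow, Real.log_pow, Real.log_pow, Real.log_pow]
  have h1 := hK (2 * n)
  have h2 := hK (22 * n / 3)
  have h3 := hK (14 * n)
  have h4 := hK (16 * n)
  have h5 := hK (22 * n)
  have h6 : ((22 * n / 3 : ℕ) : ℝ) ≤ 22 * n / 3 := by
    refine Nat.cast_div_le.trans ?_
    push_cast; exact le_rfl
  have h7 : 1.61 * ((22 * n / 3 : ℕ) : ℝ) * Real.log 2 ≤ 1.61 * (22 * n / 3) * Real.log 2 := by gcongr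
  push_cast at *
  linarith

theorem rr_abs (n : ℕ) (p : ℤ) (hp : p ∈ Pol n) (m : ℕ) :
    |rr m p| ≤ m * (22 * n * 2 ^ (m + 1)) := by
  rw [Pol, mem_Ico] at hp
  have hs : ∀ (f : ℕ → ℚ) (c : ℕ), (∀ i, |f i| ≤ 2 ^ (m + 1)) → c ≤ 11 * n →
      |∑ i ∈ range c, f i| ≤ 11 * n * 2 ^ (m + 1) := by
    intro f c hf hc
    refine (Finset.abs_sum_le_sum_abs _ _).trans ?_
    refine (Finset.sum_le_card_nsmul _ _ _ fun i _ => hf i).trans ?_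
    rw [card_range, nsmul_eq_mul]
    have : (c : ℚ) ≤ 11 * n := by exact_mod_cast hc
    gcongr
  have hinv : ∀ y : ℤ, |((y : ℚ) + 1 / 2)⁻¹ ^ (m + 1)| ≤ 2 ^ (m + 1) := by
    intro y
    rw [abs_pow, abs_inv]
    have := half_abs y
    have h2 : |(y : ℚ) + 1 / 2|⁻¹ ≤ 2 := by
      rw [inv_le_comm₀ (by linarith) (by norm_num)]; linarith
    gcongr
  unfold rr
  rw [abs_mul, Nat.abs_cast]
  refine mul_le_mul_of_nonneg_left ?_ (by positivity)
  refine (abs_sub _ _).trans ?_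
  have h1 := hs (fun i => ((-(i : ℚ) - 1 / 2)⁻¹) ^ (m + 1)) (p + 1).toNat (fun i => by
    have := hinv (-i - 1)
    push_cast at this
    convert this using 4
    ring) (by omega)
  have h2 := hs (fun i => (((i : ℚ) + 1 / 2)⁻¹) ^ (m + 1)) (-p - 1).toNat (fun i => by
    have := hinv i
    push_cast at this
    exact this) (by omega)
  linarith

theorem lf_abs (h : ℕ → ℚ) : ∃ C : ℝ, 0 < C ∧ ∀ n : ℕ, 1 ≤ n →
    |((lf h n : ℚ) : ℝ)| ≤ C * n ^ 11 *
      Real.exp (30 * n * Real.log 2 + 42 * (Real.log (22 * n) + 1) + 3 * Real.log 2) := by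
  set S : ℝ := ∑ m ∈ range 13, |(h m : ℝ)| with hS
  have hS0 : 0 ≤ S := Finset.sum_nonneg fun _ _ => abs_nonneg _
  refine ⟨22 * 9 * 576 ^ 9 * 165 * (S + 12 * 22 * 2 ^ 13), by positivity, fun n hn => ?_⟩
  set EE := Real.exp (30 * n * Real.log 2 + 42 * (Real.log (22 * n) + 1) + 3 * Real.log 2) with hEE
  have hE0 : 0 < EE := Real.exp_pos _
  have hn1 : (1 : ℝ) ≤ n := by exact_mod_cast hn
  have hB : ∀ p ∈ Pol n, (0 : ℝ) ≤ BB n p ∧ (BB n p : ℝ) ^ 3 ≤ EE := by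
    intro p hp
    have h0 : (0 : ℝ) < BB n p := by exact_mod_cast (log_BB n hn p hp).1
    refine ⟨h0.le, ?_⟩
    rw [hEE, ← Real.log_le_iff_le_exp (by positivity), Real.log_pow]
    have := log_BB' n hn p hp
    push_cast
    linarith
  have hterm : ∀ p ∈ Pol n, ∀ j ∈ range (3 * tau n p),
      |((bb n p j * (-((3 * tau n p - j + 2).choose 3 : ℚ) *
        (h (3 * tau n p - j + 3) + rr (3 * tau n p - j + 3) p)) : ℚ) : ℝ)| ≤
      (576 ^ 9 * 165 * (S + 12 * 22 * 2 ^ 13)) * n ^ 10 * EE := by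
    intro p hp j hj
    rw [mem_range] at hj
    have ht := tau_le n p
    obtain ⟨m, hm⟩ : ∃ m, m = 3 * tau n p - j := ⟨_, rfl⟩
    rw [← hm]
    have hm9 : m ≤ 9 := by omega
    have hj9 : j ≤ 9 := by omega
    have hb : |(bb n p j : ℝ)| ≤ EE * (576 * n) ^ 9 := by
      have h1 : |(bb n p j : ℝ)| ≤ (BB n p : ℝ) ^ 3 * (576 * n) ^ j := by exact_mod_cast bb_arch n hn p hp j
      refine h1.trans ?_
      have h2 : (576 * (n : ℝ)) ^ j ≤ (576 * n) ^ 9 := pow_le_pow_right₀ (by linarith) hj9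
      have h3 := (hB p hp).2
      gcongr
    have hc : (((m + 2).choose 3 : ℕ) : ℝ) ≤ 165 := by
      have : (m + 2).choose 3 ≤ (11).choose 3 := Nat.choose_le_choose 3 (by omega)
      have h2 : (11).choose 3 = 165 := by decide
      rw [h2] at this
      exact_mod_cast this
    have hr : |(rr (m + 3) p : ℝ)| ≤ 12 * 22 * 2 ^ 13 * n := by
      have h1 : |(rr (m + 3) p : ℝ)| ≤ ((m + 3 : ℕ) : ℝ) * (22 * n * 2 ^ (m + 3 + 1)) := by
        exact_mod_cast rr_abs n p hp (m + 3)
      refine h1.trans ?_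
      have h2 : ((m + 3 : ℕ) : ℝ) ≤ 12 := by exact_mod_cast (by omega : m + 3 ≤ 12)
      have h3 : (2 : ℝ) ^ (m + 3 + 1) ≤ 2 ^ 13 := pow_le_pow_right₀ (by norm_num) (by omega)
      calc ((m + 3 : ℕ) : ℝ) * (22 * n * 2 ^ (m + 3 + 1)) ≤ 12 * (22 * n * 2 ^ 13) := by gcongr
        _ = _ := by ring
    have hh : |(h (m + 3) : ℝ)| ≤ S :=
      Finset.single_le_sum (f := fun m => |(h m : ℝ)|) (fun _ _ => abs_nonneg _)
        (mem_range.2 (by omega : m + 3 < 13))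
    push_cast
    rw [abs_mul, abs_mul, abs_neg, Nat.abs_cast]
    have hsum : |(h (m + 3) : ℝ) + rr (m + 3) p| ≤ (S + 12 * 22 * 2 ^ 13) * n := by
      refine (abs_add_le _ _).trans ?_
      nlinarith
    calc _ ≤ (EE * (576 * n) ^ 9) * (165 * ((S + 12 * 22 * 2 ^ 13) * n)) := by gcongr
      _ = _ := by ring
  unfold lf
  rw [Rat.cast_sum]
  refine (Finset.abs_sum_le_sum_abs _ _).trans ?_
  have hin : ∀ p ∈ Pol n, |((∑ j ∈ range (3 * tau n p), bb n p j * (-((3 * tau n p - j + 2).choose 3 : ℚ) *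
        (h (3 * tau n p - j + 3) + rr (3 * tau n p - j + 3) p)) : ℚ) : ℝ)| ≤
      9 * ((576 ^ 9 * 165 * (S + 12 * 22 * 2 ^ 13)) * n ^ 10 * EE) := by
    intro p hp
    rw [Rat.cast_sum]
    refine (Finset.abs_sum_le_sum_abs _ _).trans ?_
    refine (Finset.sum_le_card_nsmul _ _ _ (hterm p hp)).trans ?_
    rw [card_range, nsmul_eq_mul]
    have : ((3 * tau n p : ℕ) : ℝ) ≤ 9 := by exact_mod_cast (by have := tau_le n p; omega : 3 * tau n p ≤ 9)
    gcongr
  refine (Finset.sum_le_card_nsmul _ _ _ hin).trans ?_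
  have hcard : (Pol n).card = 22 * n := by
    rw [Pol, Int.card_Ico]; omega
  rw [hcard, nsmul_eq_mul]
  push_cast
  apply le_of_eq
  ring

theorem one_le_of_int (x : ℚ) (hx : x ≠ 0)
    (h : ∀ π : ℕ, [Fact π.Prime] → π ≠ 2 → padicNorm π x ≤ 1) : 1 ≤ |x| * padicNorm 2 x := by
  set v := padicValRat 2 x with hv
  set y : ℚ := x * 2 ^ (-v) with hy
  have hy0 : y ≠ 0 := mul_ne_zero hx (zpow_ne_zero _ (by norm_num))
  have hn2 : padicNorm 2 x = 2 ^ (-v) := padicNorm.eq_zpow_of_nonzero hx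
  have hall : ∀ π : ℕ, [Fact π.Prime] → padicNorm π y ≤ 1 := by
    intro π hπ
    by_cases h2 : π = 2
    · subst h2
      rw [hy, padicNorm.mul, hn2]
      have : padicNorm 2 ((2 : ℚ) ^ (-v)) = 2 ^ v := by
        have := padicNorm.eq_zpow_of_nonzero (p := 2) (q := (2 : ℚ) ^ (-v)) (zpow_ne_zero _ (by norm_num))
        rw [this]
        have h3 : padicValRat 2 ((2 : ℚ) ^ (-v)) = -v := by
          have h5 : padicValRat 2 (2 : ℚ) = 1 := by
            simpa using padicValRat.self (p := 2) (by norm_num)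
          rw [padicValRat.zpow, h5, mul_one]
        rw [h3]
        simp
      rw [this, ← zpow_add₀ (by norm_num)]
      simp
    · have hu : padicNorm π (2 : ℚ) = 1 := by
        have : padicNorm π ((2 : ℕ) : ℚ) = 1 := by
          rw [padicNorm.nat_eq_one_iff]
          intro hd
          exact h2 ((Nat.prime_dvd_prime_iff_eq hπ.out Nat.prime_two).1 hd)
        simpa using this
      have hz : ∀ w : ℤ, padicNorm π ((2 : ℚ) ^ w) = 1 := by
        intro w
        cases w with
        | ofNat a => rw [Int.ofNat_eq_natCast, zpow_natCast, pn_pow, hu, one_pow]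
        | negSucc a => rw [zpow_negSucc, pn_inv, pn_pow, hu]; simp
      rw [hy, padicNorm.mul, hz, mul_one]
      exact h π h2
  have hden : y.den = 1 := by
    by_contra hne
    obtain ⟨π, hπ, hd⟩ := Nat.exists_prime_and_dvd hne
    have : Fact π.Prime := ⟨hπ⟩
    have h1 := hall π
    rw [← Rat.num_div_den y, padicNorm.div] at h1
    have hnum : padicNorm π ((y.num : ℤ) : ℚ) = 1 := by
      rw [padicNorm.int_eq_one_iff]
      intro hc
      have := Int.natAbs_dvd_natAbs.2 hc
      rw [Int.natAbs_natCast] at this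
      exact hπ.one_lt.ne' (Nat.eq_one_of_dvd_coprimes y.reduced this hd)
    have hd1 : padicNorm π (y.den : ℚ) < 1 := padicNorm.nat_lt_one_iff _ |>.2 hd
    have hd0 : 0 < padicNorm π (y.den : ℚ) :=
      lt_of_le_of_ne (padicNorm.nonneg _) (Ne.symm (padicNorm.nonzero (by exact_mod_cast y.den_nz)))
    rw [hnum, div_le_one hd0] at h1
    linarith
  have hyi : y = (y.num : ℚ) := by
    conv_lhs => rw [← Rat.num_div_den y, hden]
    simp
  have hni : y.num ≠ 0 := by simpa using hy0
  have h1 : 1 ≤ |y| := by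
    rw [hyi]
    exact_mod_cast Int.one_le_abs hni
  rw [hn2]
  rw [hy, abs_mul, abs_of_pos (a := (2 : ℚ) ^ (-v)) (by positivity)] at h1
  exact h1

theorem lf_int (h : ℕ → ℚ) (n : ℕ) (hn : 1 ≤ n) (π : ℕ) [Fact π.Prime] (h2 : π ≠ 2) :
    padicNorm π (((∏ m ∈ range 13, (h m).den : ℕ) : ℚ) * (Dn n : ℚ) * lf h n) ≤ 1 := by
  set B : ℕ := ∏ m ∈ range 13, (h m).den with hB
  have hnat : ∀ a : ℕ, padicNorm π (a : ℚ) ≤ 1 := fun a => padicNorm.of_nat _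
  have hBm : ∀ m, m < 13 → padicNorm π ((B : ℚ) * h m) ≤ 1 := by
    intro m hm
    obtain ⟨c, hc⟩ : (h m).den ∣ B := Finset.dvd_prod_of_mem (fun m => (h m).den) (mem_range.2 hm)
    have : (B : ℚ) * h m = (((c : ℤ) * (h m).num : ℤ) : ℚ) := by
      rw [hc]
      push_cast
      conv_lhs => rw [mul_comm ((h m).den : ℚ), mul_assoc, mul_comm ((h m).den : ℚ), Rat.mul_den_eq_num]
    rw [this]
    exact padicNorm.of_int _
  unfold lf
  rw [Finset.mul_sum]
  refine padicNorm.sum_le' (fun p hp => ?_) zero_le_one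
  rw [Finset.mul_sum]
  refine padicNorm.sum_le' (fun j hj => ?_) zero_le_one
  rw [mem_range] at hj
  obtain ⟨d1, d2⟩ := denom (π := π) n hn h2 p hp j hj
  have ht := tau_le n p
  obtain ⟨m, hm⟩ : ∃ m, m = 3 * tau n p - j := ⟨_, rfl⟩
  rw [← hm] at d2 ⊢
  have e : (B : ℚ) * (Dn n : ℚ) * (bb n p j * (-((m + 2).choose 3 : ℚ) * (h (m + 3) + rr (m + 3) p))) =
      ((-((m + 2).choose 3 : ℤ) : ℤ) : ℚ) * ((B * h (m + 3)) * (Dn n * bb n p j) +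
        B * (Dn n * (bb n p j * rr (m + 3) p))) := by
    push_cast
    ring
  rw [e, padicNorm.mul]
  refine mul_le_one₀ (padicNorm.of_int _) (padicNorm.nonneg _) ?_
  refine padicNorm.nonarchimedean.trans (max_le ?_ ?_)
  · rw [padicNorm.mul]
    exact mul_le_one₀ (hBm _ (by omega)) (padicNorm.nonneg _) d1
  · rw [padicNorm.mul]
    exact mul_le_one₀ (hnat _) (padicNorm.nonneg _) d2

theorem key_log (B D C x : ℝ) (N k : ℕ) (E : ℝ) (hB : 0 < B) (hD : 0 < D) (hC : 0 < C) (hx : 0 < x)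
    (h : 1 ≤ B * D * (C * x ^ 11 * Real.exp E) * (2 * (2 ^ (k + 3)) ^ 7 * 2 ^ 18 * ((2 : ℝ) ^ (288 * N))⁻¹)) :
    0 ≤ Real.log B + Real.log D + Real.log C + 11 * Real.log x + E +
      (1 + 7 * ((k : ℝ) + 3) + 18 - 288 * N) * Real.log 2 := by
  have key5 := Real.log_nonneg h
  have hp : ∀ a : ℕ, ((2 : ℝ) ^ a) ≠ 0 := fun a => pow_ne_zero _ two_ne_zero
  have hq : (((2 : ℝ) ^ (288 * N))⁻¹) ≠ 0 := inv_ne_zero (hp _)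
  have hr : 2 * ((2 : ℝ) ^ (k + 3)) ^ 7 * 2 ^ 18 ≠ 0 := by positivity
  rw [Real.log_mul (by positivity) (mul_ne_zero hr hq), Real.log_mul (by positivity) (by positivity),
    Real.log_mul (by positivity) (by positivity), Real.log_mul (by positivity) (by positivity),
    Real.log_mul (by positivity) (by positivity), Real.log_exp,
    Real.log_mul hr hq, Real.log_mul (by positivity) (by positivity),
    Real.log_mul (by positivity) (by positivity),
    Real.log_inv, Real.log_pow, Real.log_pow, Real.log_pow, Real.log_pow, Real.log_pow] at key5
  push_cast at key5
  linarith

set_option maxHeartbeats 2000000 in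
theorem no_H (H : ℕ → ℚ_[2]) (h : ℕ → ℚ)
    (hH : ∀ m, Vol (fun x => (((x : ℚ_[2]) + 1 / 2)⁻¹) ^ m) (H m)) (h4 : h 4 = 0)
    (hh : ∀ m, 5 ≤ m → m ≤ 12 → H m = h m) : False := by
  obtain ⟨K, hK0, hK⟩ := cheb
  obtain ⟨C, hC, hlf⟩ := lf_abs h
  set B : ℕ := ∏ m ∈ range 13, (h m).den with hB
  have hB0 : 0 < B := Finset.prod_pos fun m _ => (h m).pos
  have hl2 : 0 < Real.log 2 := Real.log_pos (by norm_num)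
  -- main inequality
  have main : ∀ k : ℕ, 0 ≤ (Real.log B + 22 * K + Real.log C + 42 * Real.log 22 + 42 + 43 * Real.log 2)
      + 60 * k * Real.log 2 - 3.62 * 2 ^ k * Real.log 2 := by
    intro k
    obtain ⟨L, hL, hLn⟩ := two_adic k
    set n : ℕ := 2 ^ k with hn
    have hn1 : 1 ≤ n := Nat.one_le_two_pow
    have hLe := lf_eq H h hH h4 hh n hn1 L hL
    have hnR : (n : ℝ) = 2 ^ k := by rw [hn]; push_cast; rfl
    have hD0 : (Dn n : ℚ) ≠ 0 := by
      unfold Dn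
      push_cast
      have hpos : ∀ N : ℕ, (Nat.lcmUpto N : ℚ) ≠ 0 := fun N => by
        exact_mod_cast (Nat.lcmUpto_pos N).ne'
      simp [hpos]
    have hnorm : ((padicNorm 2 (lf h n) : ℚ) : ℝ) = 2 * (2 ^ (k + 3)) ^ 7 * 2 ^ 18 * ((2 : ℝ) ^ (288 * n))⁻¹ := by
      rw [← Padic.eq_padicNorm, ← hLe, hLn]
    have hlf0 : lf h n ≠ 0 := by
      intro h0
      rw [h0] at hnorm
      simp at hnorm
    have hBq : (B : ℚ) ≠ 0 := by exact_mod_cast hB0.ne'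
    have key := one_le_of_int ((B : ℚ) * (Dn n : ℚ) * lf h n)
      (mul_ne_zero (mul_ne_zero hBq hD0) hlf0) (fun π _ h2 => lf_int h n hn1 π h2)
    have hle : padicNorm 2 ((B : ℚ) * (Dn n : ℚ) * lf h n) ≤ padicNorm 2 (lf h n) := by
      rw [padicNorm.mul]
      have : padicNorm 2 ((B : ℚ) * (Dn n : ℚ)) ≤ 1 := by exact_mod_cast padicNorm.of_nat (p := 2) (B * Dn n)
      exact mul_le_of_le_one_left (padicNorm.nonneg _) this
    have key2 : (1 : ℚ) ≤ (B * Dn n * |lf h n|) * padicNorm 2 (lf h n) := by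
      refine key.trans ?_
      rw [abs_mul, abs_mul, Nat.abs_cast, Nat.abs_cast]
      gcongr
    have key3 : (1 : ℝ) ≤ (B * Dn n * |((lf h n : ℚ) : ℝ)|) * ((padicNorm 2 (lf h n) : ℚ) : ℝ) := by
      exact_mod_cast key2
    rw [hnorm] at key3
    have hD0' : (0 : ℝ) < Dn n := by
      have : Dn n ≠ 0 := by exact_mod_cast hD0
      exact_mod_cast Nat.pos_of_ne_zero this
    have hB0' : (0 : ℝ) < B := by exact_mod_cast hB0
    have hn0' : (0 : ℝ) < n := by exact_mod_cast hn1
    have key4 := key3.trans (mul_le_mul_of_nonneg_right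
      (mul_le_mul_of_nonneg_left (hlf n hn1) (by positivity)) (by positivity))
    have key5 := key_log _ _ _ _ n k _ hB0' hD0' hC hn0' key4
    rw [Real.log_mul (by norm_num) hn0'.ne'] at key5
    have hlogn : Real.log n = k * Real.log 2 := by rw [hnR, Real.log_pow]
    have hDl := log_Dn K hK n
    rw [hlogn] at key5
    push_cast at key5 hDl
    rw [hnR] at key5 hDl
    clear hLn hnorm key key2 key3 key4 hle hL hLe hlf hK hH hh
    generalize (2 : ℝ) ^ k = t at *
    generalize Real.log 2 = l at *
    generalize Real.log (Dn n) = d at *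
    linarith
  set c := Real.log B + 22 * K + Real.log C + 42 * Real.log 22 + 42 + 43 * Real.log 2 with hc
  obtain ⟨k0, hk0⟩ := exists_nat_gt (c / Real.log 2)
  have hk := main (k0 + 100)
  have hsq : ∀ a : ℕ, ((a : ℝ) + 100) * 61 ≤ 2 ^ (a + 100) := by
    intro a
    induction a with
    | zero => norm_num
    | succ a ih =>
      rw [show a + 1 + 100 = (a + 100) + 1 by ring, pow_succ]
      push_cast
      have : (0 : ℝ) ≤ a := Nat.cast_nonneg a
      nlinarith
  have h1 := hsq k0
  rw [div_lt_iff₀ hl2] at hk0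
  push_cast at hk
  have hk0' : (0 : ℝ) ≤ k0 := Nat.cast_nonneg _
  nlinarith [mul_le_mul_of_nonneg_right h1 hl2.le, mul_nonneg hk0' hl2.le]
end

theorem irrational_zeta2Quarter_7_9_11_13 :
    ∃ j : ℕ, (j = 7 ∨ j = 9 ∨ j = 11 ∨ j = 13) ∧
      ∃ z : ℚ_[2], zeta2Quarter j z ∧ ∀ q : ℚ, z ≠ (q : ℚ_[2]) := by
  by_contra hcon
  obtain ⟨H, h, hH, h4, hh⟩ := main_H (fun j hj z hz => by
    by_contra hq
    push Not at hq
    exact hcon ⟨j, hj, z, hz, hq⟩)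
  exact no_H H h hH h4 hh
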